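/- arXiv:2205.10777 — 9 statements merged into one kernel-verified Lean document; each statement's English description precedes it below -/
import Mathlib

section
/- Let β ∈ [0,1] and let f(z) = z + Σ_{n=2}^∞ aₙ zⁿ be in 𝒜. Then f ∈ 𝒜_β if and only if for every ζ ∈ ℂ with |ζ| = 1 and ζ ≠ 1, and every z ∈ 𝔻 with z ≠ 0, one has (f ∗ h_ζ)(z) ≠ 0, where h_ζ(z) = z(1 − βz)/(1 − z)² − z(1 + ζ)/(1 − ζ). -/
open Complex Metric Set

noncomputable section

/-- The class 𝒜 : analytic functions on the unit disk normalized by f(0)=0, f'(0)=1. -/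
def memA (f : ℂ → ℂ) : Prop :=
  DifferentiableOn ℂ f (ball (0 : ℂ) 1) ∧ f 0 = 0 ∧ deriv f 0 = 1

/-- The class 𝒜_β : f ∈ 𝒜 with Re(β f(z)/z + (1-β) f'(z)) > 0 on 𝔻
(at z = 0 the quantity equals 1 by the convention f(z)/z = 1 there). -/
def memAb (β : ℝ) (f : ℂ → ℂ) : Prop :=
  memA f ∧ ∀ z ∈ ball (0 : ℂ) 1, z ≠ 0 →
    0 < ((β : ℂ) * (f z / z) + (1 - (β : ℂ)) * deriv f z).re

/-- Hadamard product (convolution) of two functions analytic at 0,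
defined through their Taylor coefficients at the origin. -/
def hadamard (f g : ℂ → ℂ) : ℂ → ℂ := fun z =>
  ∑' n : ℕ, (iteratedDeriv n f 0 / n.factorial) * (iteratedDeriv n g 0 / n.factorial) * z ^ n

/-- Taylor coefficients from a convergent power series. -/
theorem coeff_of_hasSum (g : ℂ → ℂ) (c : ℕ → ℂ)
    (h : ∀ w : ℂ, ‖w‖ < 1 → HasSum (fun n => c n * w ^ n) (g w)) (n : ℕ) :
    iteratedDeriv n g 0 / n.factorial = c n := by
  have h1 : HasFPowerSeriesAt g (FormalMultilinearSeries.ofScalars ℂ c) 0 := by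
    rw [hasFPowerSeriesAt_iff]
    filter_upwards [Metric.ball_mem_nhds (0 : ℂ) one_pos] with w hw
    have := h w (by simpa using hw)
    simpa [FormalMultilinearSeries.coeff_ofScalars, mul_comm] using this
  have h2 := (h1.analyticAt).hasFPowerSeriesAt
  have h3 := h2.eq_formalMultilinearSeries h1
  have h4 := congrArg (fun p => p.coeff n) h3
  simpa [FormalMultilinearSeries.coeff_ofScalars] using h4

/-- The coefficients of the kernel. -/
theorem kernel_coeff (b k : ℂ) (n : ℕ) :
    iteratedDeriv n (fun w : ℂ => w * (1 - b * w) / (1 - w) ^ 2 - w * k) 0 / n.factorial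
      = (1 - b) * n + b - (if n = 0 then b else 0) - (if n = 1 then k else 0) := by
  apply coeff_of_hasSum _ (fun n : ℕ => (1 - b) * n + b - (if n = 0 then b else 0)
    - (if n = 1 then k else 0))
  intro w hw
  have hne : (1 : ℂ) - w ≠ 0 := by
    intro h
    have : w = 1 := (sub_eq_zero.1 h).symm
    simp [this] at hw
  have h1 := (hasSum_coe_mul_geometric_of_norm_lt_one hw).mul_left (1 - b)
  have h2 := (hasSum_geometric_of_norm_lt_one hw).mul_left b
  have h3 := hasSum_ite_eq (0 : ℕ) b
  have h4 := hasSum_ite_eq (1 : ℕ) (k * w)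
  have h5 := ((h1.add h2).sub h3).sub h4
  convert! h5 using 1
  · ext n
    rcases n with _ | _ | n
    · simp
    · simp; ring
    · simp; ring
  · field_simp
    ring

/-- Closed form of the convolution. -/
theorem hadamard_kernel (f : ℂ → ℂ) (hf : memA f) (b k z : ℂ) (hz : z ∈ ball (0 : ℂ) 1) :
    hadamard f (fun w : ℂ => w * (1 - b * w) / (1 - w) ^ 2 - w * k) z
      = b * f z + (1 - b) * (z * deriv f z) - k * z := by
  obtain ⟨hd, h0, h1⟩ := hf
  have hd' : DifferentiableOn ℂ (deriv f) (ball (0 : ℂ) 1) := hd.deriv isOpen_ball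
  have s1 := Complex.hasSum_taylorSeries_on_ball hd hz
  have s2 := (Complex.hasSum_taylorSeries_on_ball hd' hz).mul_left z
  have s3 : HasSum (fun n : ℕ => (n : ℂ) * (iteratedDeriv n f 0 / n.factorial) * z ^ n)
      (z * deriv f z) := by
    rw [← hasSum_nat_add_iff' 1]
    convert! s2 using 1
    · ext n
      rw [← iteratedDeriv_succ']
      have : (n.factorial : ℂ) ≠ 0 := by exact_mod_cast n.factorial_ne_zero
      have : (n : ℂ) + 1 ≠ 0 := by exact_mod_cast n.succ_ne_zero
      simp only [Nat.factorial_succ, sub_zero, smul_eq_mul]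
      push_cast
      field_simp
      ring
    · simp
  have s4 := hasSum_ite_eq (1 : ℕ) (k * z)
  have s5 := ((s1.mul_left b).add (s3.mul_left (1 - b))).sub s4
  unfold hadamard
  rw [← s5.tsum_eq]
  congr 1
  ext n
  rw [kernel_coeff]
  rcases n with _ | _ | n
  · simp [h0]
  · simp [h1]; ring
  · simp; ring

theorem re_cayley (ζ : ℂ) (h : ‖ζ‖ = 1) : ((1 + ζ) / (1 - ζ)).re = 0 := by
  have h2 : ζ.re * ζ.re + ζ.im * ζ.im = 1 := by
    have := Complex.normSq_eq_norm_sq ζ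
    rw [h, Complex.normSq_apply] at this
    simpa using this
  rw [Complex.div_re, ← add_div]
  simp only [add_re, one_re, sub_re, add_im, one_im, sub_im]
  rw [div_eq_zero_iff]
  left
  linear_combination -h2

theorem exists_cayley (p : ℂ) (h : p.re = 0) :
    ∃ ζ : ℂ, ‖ζ‖ = 1 ∧ ζ ≠ 1 ∧ (1 + ζ) / (1 - ζ) = p := by
  have hp : p + 1 ≠ 0 := by
    intro h'
    have := congrArg Complex.re h'
    simp [h] at this
  refine ⟨(p - 1) / (p + 1), ?_, ?_, ?_⟩
  · have : ‖p - 1‖ = ‖p + 1‖ := by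
      rw [Complex.norm_def, Complex.norm_def, Complex.normSq_apply, Complex.normSq_apply]
      simp [h]
    rw [norm_div, this, div_self (norm_ne_zero_iff.2 hp)]
  · intro h'
    rw [div_eq_one_iff_eq hp] at h'
    have := congrArg Complex.re h'
    simp [h] at this
    norm_num at this
  · have e1 : 1 + (p - 1) / (p + 1) = 2 * p / (p + 1) := by field_simp; ring
    have e2 : 1 - (p - 1) / (p + 1) = 2 / (p + 1) := by field_simp; ring
    rw [e1, e2]
    field_simp

/-- membership criterion for 𝒜_β in terms of the Hadamard product. -/
theorem mem_Abeta_iff_hadamard_ne_zero (β : ℝ) (hβ : β ∈ Set.Icc (0 : ℝ) 1)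
    (f : ℂ → ℂ) (hf : memA f) :
    memAb β f ↔
      ∀ ζ : ℂ, ‖ζ‖ = 1 → ζ ≠ 1 → ∀ z ∈ ball (0 : ℂ) 1, z ≠ 0 →
        hadamard f
          (fun w => w * (1 - (β : ℂ) * w) / (1 - w) ^ 2 - w * (1 + ζ) / (1 - ζ)) z ≠ 0 := by
  have key : ∀ ζ z : ℂ, z ∈ ball (0 : ℂ) 1 → z ≠ 0 →
      (hadamard f
          (fun w => w * (1 - (β : ℂ) * w) / (1 - w) ^ 2 - w * (1 + ζ) / (1 - ζ)) z = 0 ↔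
        (β : ℂ) * (f z / z) + (1 - (β : ℂ)) * deriv f z = (1 + ζ) / (1 - ζ)) := by
    intro ζ z hz hz0
    simp only [mul_div_assoc _ (1 + ζ)]
    rw [hadamard_kernel f hf _ _ z hz]
    have e : (β : ℂ) * f z + (1 - β) * (z * deriv f z) - (1 + ζ) / (1 - ζ) * z
        = z * (((β : ℂ) * (f z / z) + (1 - (β : ℂ)) * deriv f z) - (1 + ζ) / (1 - ζ)) := by
      have : z * (f z / z) = f z := mul_div_cancel₀ _ hz0
      linear_combination -(β : ℂ) * this
    rw [e, mul_eq_zero, or_iff_right hz0, sub_eq_zero]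
  constructor
  · rintro ⟨-, h⟩ ζ hζ hζ1 z hz hz0 hh
    have h1 := h z hz hz0
    rw [(key ζ z hz hz0).1 hh, re_cayley ζ hζ] at h1
    exact lt_irrefl _ h1
  · intro h
    refine ⟨hf, ?_⟩
    obtain ⟨hd, h0, h1⟩ := hf
    set g : ℂ → ℂ := fun z => (β : ℂ) * dslope f 0 z + (1 - (β : ℂ)) * deriv f z with hg
    have hgz : ∀ z : ℂ, z ≠ 0 → g z = (β : ℂ) * (f z / z) + (1 - (β : ℂ)) * deriv f z := by
      intro z hz
      simp only [hg]
      rw [dslope_of_ne _ hz, slope_def_field, h0, sub_zero, sub_zero]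
    have hg0 : g 0 = 1 := by
      simp only [hg]
      rw [dslope_same, h1]
      ring
    have hnb : ball (0 : ℂ) 1 ∈ nhds (0 : ℂ) := Metric.ball_mem_nhds _ one_pos
    have hc : ContinuousOn g (ball (0 : ℂ) 1) := by
      have c1 : ContinuousOn (dslope f 0) (ball (0 : ℂ) 1) :=
        (continuousOn_dslope hnb).2 ⟨hd.continuousOn, hd.differentiableAt hnb⟩
      have c2 : ContinuousOn (deriv f) (ball (0 : ℂ) 1) := (hd.deriv isOpen_ball).continuousOn
      exact (continuousOn_const.mul c1).add (continuousOn_const.mul c2)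
    have hcr : ContinuousOn (fun z => (g z).re) (ball (0 : ℂ) 1) :=
      Complex.continuous_re.comp_continuousOn hc
    intro z hz hz0
    rw [← hgz z hz0]
    by_contra hneg
    push Not at hneg
    have hpre : IsPreconnected (ball (0 : ℂ) 1) := (convex_ball (0 : ℂ) 1).isPreconnected
    have hiv := hpre.intermediate_value hz (Metric.mem_ball_self one_pos) hcr
    obtain ⟨w, hw, hw0⟩ := hiv (show (0 : ℝ) ∈ Set.Icc (g z).re (g 0).re from
      ⟨hneg, by rw [hg0]; simp⟩)
    have hwne : w ≠ 0 := by
      rintro rfl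
      simp [hg0] at hw0
    obtain ⟨ζ, a1, a2, a3⟩ := exists_cayley (g w) hw0
    exact h ζ a1 a2 w hw hwne ((key ζ w hw hwne).2 (by rw [a3, hgz w hwne]))
end
end

section
/- Let β ∈ [0,1], let f ∈ 𝒜_β, and let g ∈ 𝒜 satisfy Re(g(z)/z) > 1/2 for all z ∈ 𝔻 \ {0}. Then the Hadamard product f ∗ g belongs to 𝒜_β. -/
open Complex Metric Set

noncomputable section

lemma had_hs {ι : Type*} {u v : ι → ℂ} {s : ℂ} (h : HasSum u s) (e : ∀ i, v i = u i) :
    HasSum v s := by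
  rwa [show v = u from funext e]

lemma had_prod {u v : ℕ → ℂ} (hu : Summable fun n => ‖u n‖) (hv : Summable fun n => ‖v n‖) :
    HasSum (fun x : ℕ × ℕ => u x.1 * v x.2) ((∑' n, u n) * ∑' n, v n) := by
  rw [tsum_mul_tsum_of_summable_norm hu hv]
  exact (summable_mul_of_summable_norm hu hv).hasSum

lemma had_integral_exp (k : ℤ) :
    (∫ θ in (0:ℝ)..(2 * Real.pi), Complex.exp ((k : ℂ) * I * θ)) =
      if k = 0 then ((2 * Real.pi : ℝ) : ℂ) else 0 := by
  split_ifs with h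
  · subst h; simp
  · have hk : (k : ℂ) * I ≠ 0 := mul_ne_zero (by exact_mod_cast h) I_ne_zero
    rw [integral_exp_mul_complex hk]
    have : (k : ℂ) * I * ((2 * Real.pi : ℝ) : ℂ) = k * (2 * Real.pi * I) := by push_cast; ring
    rw [this, Complex.exp_int_mul_two_pi_mul_I]
    simp

/-- Fourier series with nonnegative frequencies, orientation `k`. -/
def hadFour (k : ℤ) (q : ℕ → ℂ) (θ : ℝ) : ℂ :=
  ∑' n : ℕ, q n * Complex.exp (((k * n : ℤ) : ℂ) * I * θ)

lemma had_norm_exp (k : ℤ) (θ : ℝ) : ‖Complex.exp ((k : ℂ) * I * θ)‖ = 1 := by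
  have : (k : ℂ) * I * θ = ((k * θ : ℝ) : ℂ) * I := by push_cast; ring
  rw [this, Complex.norm_exp_ofReal_mul_I]

lemma hadFour_summable (k : ℤ) {q : ℕ → ℂ} (hq : Summable fun n => ‖q n‖) (θ : ℝ) :
    Summable fun n => ‖q n * Complex.exp (((k * n : ℤ) : ℂ) * I * θ)‖ := by
  simpa only [norm_mul, had_norm_exp, mul_one] using hq

lemma hadFour_continuous (k : ℤ) {q : ℕ → ℂ} (hq : Summable fun n => ‖q n‖) :
    Continuous (hadFour k q) := by
  unfold hadFour
  refine continuous_tsum (fun n => by fun_prop) hq (fun n θ => ?_)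
  rw [norm_mul, had_norm_exp, mul_one]

lemma had_integral_mul (k : ℤ) {p q : ℕ → ℂ} (hp : Summable fun n => ‖p n‖)
    (hq : Summable fun n => ‖q n‖) :
    HasSum (fun x : ℕ × ℕ => if (x.1 : ℤ) + k * x.2 = 0 then
        p x.1 * q x.2 * ((2 * Real.pi : ℝ) : ℂ) else 0)
      (∫ θ in (0:ℝ)..(2 * Real.pi), hadFour 1 p θ * hadFour k q θ) := by
  have hprod : ∀ θ : ℝ, HasSum (fun x : ℕ × ℕ => p x.1 * q x.2 *
      Complex.exp (((x.1 + k * x.2 : ℤ) : ℂ) * I * θ)) (hadFour 1 p θ * hadFour k q θ) := by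
    intro θ
    have this := had_prod (hadFour_summable 1 hp θ) (hadFour_summable k hq θ)
    refine had_hs this fun x => ?_
    rw [mul_mul_mul_comm, ← Complex.exp_add]
    congr 2
    push_cast
    ring
  have key := intervalIntegral.hasSum_integral_of_dominated_convergence
    (μ := MeasureTheory.volume) (a := 0) (b := 2 * Real.pi)
    (F := fun (x : ℕ × ℕ) (θ : ℝ) => p x.1 * q x.2 *
      Complex.exp (((x.1 + k * x.2 : ℤ) : ℂ) * I * θ))
    (f := fun θ => hadFour 1 p θ * hadFour k q θ)
    (fun x _ => ‖p x.1 * q x.2‖)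
    (fun x => by
      refine Continuous.aestronglyMeasurable ?_
      fun_prop)
    (fun x => Filter.Eventually.of_forall fun θ _ => by
      rw [norm_mul _ (Complex.exp _), had_norm_exp, mul_one])
    (Filter.Eventually.of_forall fun θ _ => by
      exact hp.mul_norm hq)
    (by simp)
    (Filter.Eventually.of_forall fun θ _ => hprod θ)
  refine had_hs (key) fun x => ?_
  rw [intervalIntegral.integral_const_mul, had_integral_exp]
  split_ifs <;> simp

lemma had_core {p q : ℕ → ℂ} (hp : Summable fun n => ‖p n‖)
    (hq : Summable fun n => ‖q n‖) (hp0 : p 0 = 1) (hq0 : q 0 = 1)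
    (hP : ∀ u : ℂ, ‖u‖ = 1 → 0 < (∑' n, p n * u ^ n).re)
    (hQ : ∀ u : ℂ, ‖u‖ = 1 → 1 / 2 < (∑' n, q n * u ^ n).re) :
    0 < (∑' n, p n * q n).re := by
  have hF : ∀ (k : ℤ) (c : ℕ → ℂ) (θ : ℝ),
      hadFour k c θ = ∑' n, c n * (Complex.exp ((k : ℂ) * I * θ)) ^ n := by
    intro k c θ
    unfold hadFour
    congr 1; ext n
    rw [← Complex.exp_nat_mul]
    congr 2; push_cast; ring
  have i1 : (∫ θ in (0:ℝ)..(2 * Real.pi), hadFour 1 p θ * hadFour (-1) q θ)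
      = (∑' n, p n * q n) * ((2 * Real.pi : ℝ) : ℂ) := by
    have h := had_integral_mul (-1) hp hq
    have hs : Summable fun n => p n * q n :=
      (summable_mul_of_summable_norm hp hq).comp_injective
        (i := fun n : ℕ => (n, n)) (fun a b h => by simpa using h)
    have h2 : HasSum (fun n => p n * q n * ((2 * Real.pi : ℝ) : ℂ)) _ :=
      hs.hasSum.mul_right _
    refine HasSum.unique ?_ h2
    have hinj : Function.Injective (fun n : ℕ => (n, n)) := fun a b h => by simpa using h
    rw [← hinj.hasSum_iff] at h
    · refine had_hs h fun n => ?_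
      simp
    · rintro ⟨a, b⟩ hab
      rw [if_neg]
      intro h0
      apply hab
      exact ⟨a, by ext <;> simp; push_cast at h0; omega⟩
  have i2 : ∀ c : ℕ → ℂ, (Summable fun n => ‖c n‖) → c 0 = 1 →
      (∫ θ in (0:ℝ)..(2 * Real.pi), hadFour 1 p θ * hadFour 1 c θ)
      = ((2 * Real.pi : ℝ) : ℂ) := by
    intro c hc hc0
    have h := had_integral_mul 1 hp hc
    refine h.unique ?_
    convert hasSum_single ((0, 0) : ℕ × ℕ) ?_ using 1
    · simp [hp0, hc0]
    · rintro ⟨a, b⟩ hab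
      rw [if_neg]
      intro h0
      apply hab
      ext <;> simp <;> push_cast at h0 <;> omega
  let d : ℕ → ℂ := fun n => if n = 0 then 1 else 0
  let c : ℕ → ℂ := fun n => (starRingEnd ℂ) (q n)
  have hd : Summable fun n => ‖d n‖ :=
    summable_of_ne_finset_zero (s := {0}) (by intro n hn; simp at hn; simp [d, hn])
  have hc : Summable fun n => ‖c n‖ := by simpa [c] using hq
  have i3 := i2 d hd (by simp [d])
  have i4 := i2 c hc (by simp [c, hq0])
  have hd1 : ∀ θ, hadFour 1 d θ = 1 := by
    intro θ
    rw [hF, tsum_eq_single 0]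
    · simp [d]
    · intro n hn; simp [d, hn]
  have hcq : ∀ θ, hadFour 1 c θ = (starRingEnd ℂ) (hadFour (-1) q θ) := by
    intro θ
    rw [hF, hF, Complex.conj_tsum]
    congr 1; ext n
    simp [c, ← Complex.exp_conj]
  have c1 := hadFour_continuous 1 hp
  have c2 := hadFour_continuous (-1) hq
  have c3 := hadFour_continuous 1 hc
  have c4 := hadFour_continuous 1 hd
  have hI : (∫ θ in (0:ℝ)..(2 * Real.pi), hadFour 1 p θ *
      ((2 * (hadFour (-1) q θ).re - 1 : ℝ) : ℂ)) =
      (∑' n, p n * q n) * ((2 * Real.pi : ℝ) : ℂ) := by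
    have : ∀ θ, hadFour 1 p θ * ((2 * (hadFour (-1) q θ).re - 1 : ℝ) : ℂ) =
        hadFour 1 p θ * hadFour (-1) q θ + hadFour 1 p θ * hadFour 1 c θ
          - hadFour 1 p θ * hadFour 1 d θ := by
      intro θ
      have := Complex.add_conj (hadFour (-1) q θ)
      rw [hd1, hcq]
      push_cast at this ⊢
      rw [← this]; ring
    simp_rw [this]
    rw [intervalIntegral.integral_sub, intervalIntegral.integral_add, i1, i3, i4]
    · ring
    all_goals
      apply Continuous.intervalIntegrable
      fun_prop
  have hre : (∫ θ in (0:ℝ)..(2 * Real.pi), (hadFour 1 p θ).re *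
      (2 * (hadFour (-1) q θ).re - 1)) = (∑' n, p n * q n).re * (2 * Real.pi) := by
    have h := congrArg Complex.re hI
    rw [Complex.re_mul_ofReal] at h
    rw [← h, ← Complex.reCLM_apply, ← ContinuousLinearMap.intervalIntegral_comp_comm]
    · simp only [Complex.reCLM_apply, Complex.re_mul_ofReal]
    · apply Continuous.intervalIntegrable
      fun_prop
  have hpos : 0 < (∫ θ in (0:ℝ)..(2 * Real.pi), (hadFour 1 p θ).re *
      (2 * (hadFour (-1) q θ).re - 1)) := by
    apply intervalIntegral.intervalIntegral_pos_of_pos_on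
    · apply Continuous.intervalIntegrable
      fun_prop
    · intro θ _
      have h1 := hP _ (had_norm_exp 1 θ)
      have h2 := hQ _ (had_norm_exp (-1) θ)
      rw [← hF] at h1 h2
      exact mul_pos h1 (by linarith)
    · positivity
  rw [hre] at hpos
  exact pos_of_mul_pos_left hpos (by positivity)

lemma had_ps {c : ℕ → ℂ} {F : ℂ → ℂ}
    (h : ∀ z ∈ ball (0:ℂ) 1, HasSum (fun n => c n * z ^ n) (F z)) :
    DifferentiableOn ℂ F (ball 0 1) ∧ ∀ z ∈ ball (0:ℂ) 1,
      HasSum (fun n : ℕ => ((n:ℂ) + 1) * c (n + 1) * z ^ n) (deriv F z) := by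
  have main : ∀ z ∈ ball (0:ℂ) 1, DifferentiableAt ℂ F z ∧
      HasSum (fun n : ℕ => ((n:ℂ) + 1) * c (n + 1) * z ^ n) (deriv F z) := by
    intro z hz
    obtain ⟨s, hs1, hs2⟩ := exists_between (mem_ball_zero_iff.1 hz)
    have hs0 : 0 ≤ s := (norm_nonneg z).trans hs1.le
    have hu : Summable fun n => ‖c n * (s:ℂ) ^ n‖ :=
      (h s (by simpa [abs_of_nonneg hs0] using hs2)).summable.norm
    have hle : ∀ (n : ℕ) (w : ℂ), w ∈ ball (0:ℂ) s → ‖c n * w ^ n‖ ≤ ‖c n * (s:ℂ) ^ n‖ := by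
      intro n w hw
      rw [norm_mul, norm_mul, norm_pow, norm_pow, Complex.norm_real, Real.norm_of_nonneg hs0]
      have := (mem_ball_zero_iff.1 hw).le
      gcongr
    have hdiff : ∀ n : ℕ, DifferentiableOn ℂ (fun w : ℂ => c n * w ^ n) (ball 0 s) :=
      fun n => by fun_prop
    have hz' : z ∈ ball (0:ℂ) s := mem_ball_zero_iff.2 hs1
    have d1 := differentiableOn_tsum_of_summable_norm hu hdiff isOpen_ball hle
    have d2 := hasSum_deriv_of_summable_norm hu hdiff isOpen_ball hle hz'
    have heq : F =ᶠ[nhds z] fun w => ∑' n, c n * w ^ n := by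
      filter_upwards [isOpen_ball.mem_nhds hz] with w hw
      exact (h w hw).tsum_eq.symm
    refine ⟨heq.differentiableAt_iff.2 (d1.differentiableAt (isOpen_ball.mem_nhds hz')), ?_⟩
    rw [heq.deriv_eq]
    rw [← hasSum_nat_add_iff' 1] at d2
    simpa [mul_comm, mul_assoc, mul_left_comm] using d2
  exact ⟨fun z hz => (main z hz).1.differentiableWithinAt, fun z hz => (main z hz).2⟩

lemma had_div {c : ℕ → ℂ} {w z : ℂ} (hz : z ≠ 0) (hc : c 0 = 0)
    (h : HasSum (fun n => c n * z ^ n) w) : HasSum (fun n => c (n + 1) * z ^ n) (w / z) := by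
  rw [← hasSum_nat_add_iff' 1] at h
  have := h.div_const z
  simp only [Finset.range_one, Finset.sum_singleton, hc, zero_mul, sub_zero] at this
  refine had_hs (this) fun n => ?_
  field_simp
  ring

lemma had_comb (β : ℝ) {c : ℕ → ℂ} {F : ℂ → ℂ} (hc : c 0 = 0)
    (h : ∀ z ∈ ball (0:ℂ) 1, HasSum (fun n => c n * z ^ n) (F z)) :
    ∀ z ∈ ball (0:ℂ) 1, z ≠ 0 → HasSum
      (fun n : ℕ => ((β:ℂ) + (1 - β) * ((n:ℂ) + 1)) * c (n + 1) * z ^ n)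
      ((β : ℂ) * (F z / z) + (1 - (β : ℂ)) * deriv F z) := by
  intro z hz hz0
  have h1 := (had_div hz0 hc (h z hz)).mul_left (β:ℂ)
  have h2 := ((had_ps h).2 z hz).mul_left (1 - (β:ℂ))
  refine had_hs (h1.add h2) fun n => ?_
  ring

lemma had_taylor {f : ℂ → ℂ} (hf : DifferentiableOn ℂ f (ball (0 : ℂ) 1)) :
    ∀ z ∈ ball (0:ℂ) 1, HasSum (fun n => iteratedDeriv n f 0 / n.factorial * z ^ n) (f z) := by
  intro z hz
  refine had_hs (Complex.hasSum_taylorSeries_on_ball hf hz) fun n => ?_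
  simp only [sub_zero, smul_eq_mul]
  ring

/-- the Hadamard product of f ∈ 𝒜_β with g ∈ 𝒜 satisfying
Re(g(z)/z) > 1/2 again belongs to 𝒜_β. -/
theorem hadamard_mem_Abeta_of_re_gt_half (β : ℝ) (hβ : β ∈ Set.Icc (0 : ℝ) 1)
    (f g : ℂ → ℂ) (hf : memAb β f) (hg : memA g)
    (hgre : ∀ z ∈ ball (0 : ℂ) 1, z ≠ 0 → (1 : ℝ) / 2 < (g z / z).re) :
    memAb β (hadamard f g) := by
  obtain ⟨⟨hfd, hf0, hf1⟩, hfre⟩ := hf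
  obtain ⟨hgd, hg0, hg1⟩ := hg
  have ha := had_taylor hfd
  have hb := had_taylor hgd
  have hdef : hadamard f g = fun z => ∑' n : ℕ, (iteratedDeriv n f 0 / n.factorial) *
    (iteratedDeriv n g 0 / n.factorial) * z ^ n := rfl
  have ha0 : iteratedDeriv 0 f 0 / (Nat.factorial 0 : ℂ) = 0 := by simp [hf0]
  have hb0 : iteratedDeriv 0 g 0 / (Nat.factorial 0 : ℂ) = 0 := by simp [hg0]
  have ha1 : iteratedDeriv 1 f 0 / (Nat.factorial 1 : ℂ) = 1 := by simp [hf1]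
  have hb1 : iteratedDeriv 1 g 0 / (Nat.factorial 1 : ℂ) = 1 := by simp [hg1]
  generalize hA : (fun n : ℕ => iteratedDeriv n f 0 / (n.factorial : ℂ)) = a at *
  generalize hB : (fun n : ℕ => iteratedDeriv n g 0 / (n.factorial : ℂ)) = b at *
  have hA' : ∀ n : ℕ, iteratedDeriv n f 0 / (n.factorial : ℂ) = a n := fun n => congrFun hA n
  have hB' : ∀ n : ℕ, iteratedDeriv n g 0 / (n.factorial : ℂ) = b n := fun n => congrFun hB n
  simp only [hA', hB'] at *
  have hfac : ∀ z ∈ ball (0:ℂ) 1, ∃ x ∈ ball (0:ℂ) 1, ∃ y ∈ ball (0:ℂ) 1, x * y = z := by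
    intro z hz
    rw [mem_ball_zero_iff] at hz
    have hr : √‖z‖ < 1 := by rw [Real.sqrt_lt' one_pos]; simpa using hz
    by_cases hz0 : z = 0
    · exact ⟨0, by simp, 0, by simp, by simp [hz0]⟩
    have hp : 0 < √‖z‖ := Real.sqrt_pos.2 (norm_pos_iff.2 hz0)
    refine ⟨z / (√‖z‖ : ℝ), ?_, ((√‖z‖ : ℝ) : ℂ), ?_, ?_⟩
    · rw [mem_ball_zero_iff, norm_div, Complex.norm_real, Real.norm_of_nonneg hp.le,
        Real.div_sqrt]
      exact hr
    · rw [mem_ball_zero_iff, Complex.norm_real, Real.norm_of_nonneg hp.le]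
      exact hr
    · rw [div_mul_cancel₀]
      exact_mod_cast hp.ne'
  have hh : ∀ z ∈ ball (0:ℂ) 1, HasSum (fun n => a n * b n * z ^ n) (hadamard f g z) := by
    intro z hz
    obtain ⟨x, hx, y, hy, rfl⟩ := hfac z hz
    have hs := (summable_mul_of_summable_norm (ha x hx).summable.norm
      (hb y hy).summable.norm).comp_injective
        (i := fun n : ℕ => (n, n)) (fun a b h => by simpa using h)
    rw [hdef]
    refine Summable.hasSum ?_
    refine hs.congr fun n => ?_
    simp only [Function.comp]
    ring
  have hc0 : a 0 * b 0 = 0 := by rw [ha0, zero_mul]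
  refine ⟨⟨(had_ps hh).1, ?_, ?_⟩, ?_⟩
  · rw [hdef]
    simp only
    rw [tsum_eq_single 0]
    · simp [hc0]
    · intro n hn; simp [hn]
  · have h1 := (had_ps hh).2 0 (by simp)
    refine h1.unique ?_
    convert hasSum_single 0 ?_ using 1
    · simp [ha1, hb1]
    · intro n hn; simp [hn]
  · intro z hz hz0
    have h1 := had_comb β (c := fun n => a n * b n) hc0 hh z hz hz0
    rw [← h1.tsum_eq]
    obtain ⟨x, hx, y, hy, rfl⟩ := hfac z hz
    have hx0 : x ≠ 0 := left_ne_zero_of_mul hz0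
    have hy0 : y ≠ 0 := right_ne_zero_of_mul hz0
    have hPx := had_comb β ha0 ha
    have core := had_core
      (p := fun n : ℕ => ((β:ℂ) + (1 - β) * ((n:ℂ) + 1)) * a (n + 1) * x ^ n)
      (q := fun n : ℕ => b (n + 1) * y ^ n)
      (hPx x hx hx0).summable.norm (had_div hy0 hb0 (hb y hy)).summable.norm
      (by simp [ha1]) (by simp [hb1])
      (fun u hu => by
        have hu0 : u ≠ 0 := by rintro rfl; simp at hu
        have hm : x * u ∈ ball (0:ℂ) 1 := by
          rw [mem_ball_zero_iff] at *; rwa [norm_mul, hu, mul_one]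
        have := hfre _ hm (mul_ne_zero hx0 hu0)
        rw [← (hPx _ hm (mul_ne_zero hx0 hu0)).tsum_eq] at this
        simpa only [mul_pow, mul_assoc] using this)
      (fun u hu => by
        have hu0 : u ≠ 0 := by rintro rfl; simp at hu
        have hm : y * u ∈ ball (0:ℂ) 1 := by
          rw [mem_ball_zero_iff] at *; rwa [norm_mul, hu, mul_one]
        have := hgre _ hm (mul_ne_zero hy0 hu0)
        rw [← (had_div (mul_ne_zero hy0 hu0) hb0 (hb _ hm)).tsum_eq] at this
        simpa only [mul_pow, mul_assoc] using this)
    convert core using 4 with n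
    rw [mul_pow]
    ring
end
end

section
/- Let β ∈ [0,1], let f ∈ 𝒜_β, and let g ∈ 𝒦. Then the Hadamard product f ∗ g belongs to 𝒜_β. -/
open Complex Metric Set

noncomputable section

/-- The class 𝒦 of convex functions: f ∈ 𝒜, injective on 𝔻, with convex image f(𝔻). -/
def memK (f : ℂ → ℂ) : Prop :=
  memA f ∧ Set.InjOn f (ball (0 : ℂ) 1) ∧ Convex ℝ (f '' ball (0 : ℂ) 1)

lemma inv_aux (g : ℂ → ℂ) (hg : DifferentiableOn ℂ g (ball (0 : ℂ) 1))
    (hi : Set.InjOn g (ball (0 : ℂ) 1)) :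
    ∃ ψ : ℂ → ℂ, (∀ z ∈ ball (0 : ℂ) 1, ψ (g z) = z) ∧
      (∀ z ∈ ball (0 : ℂ) 1, DifferentiableAt ℂ ψ (g z)) ∧
      (∀ z ∈ ball (0 : ℂ) 1, deriv g z ≠ 0) := by
  classical
  have hinv : ∀ z ∈ ball (0 : ℂ) 1, Function.invFunOn g (ball (0 : ℂ) 1) (g z) = z :=
    fun z hz => hi.leftInvOn_invFunOn hz
  set ψ := Function.invFunOn g (ball (0 : ℂ) 1) with hψ
  have hU : ∀ z ∈ ball (0 : ℂ) 1, ball (0 : ℂ) 1 ∈ nhds z := fun z hz => isOpen_ball.mem_nhds hz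
  have han : ∀ z ∈ ball (0 : ℂ) 1, AnalyticAt ℂ g z := fun z hz => hg.analyticAt (hU z hz)
  have hnc : ∀ z ∈ ball (0 : ℂ) 1, ¬ (∀ᶠ w in nhds z, g w = g z) := by
    intro z hz h
    have h2 : ∀ᶠ w in nhds z, w = z := by
      filter_upwards [h, hU z hz] with w hw hwU
      exact hi hwU hz hw
    have : ∀ᶠ w in nhdsWithin z {z}ᶜ, False := by
      filter_upwards [h2.filter_mono nhdsWithin_le_nhds, self_mem_nhdsWithin] with w h3 h4
      exact h4 h3
    exact absurd (Filter.eventually_false_iff_eq_bot.1 this) (Filter.NeBot.ne inferInstance)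
  have hopen : ∀ z ∈ ball (0 : ℂ) 1, nhds (g z) ≤ Filter.map g (nhds z) := fun z hz =>
    (han z hz).eventually_constant_or_nhds_le_map_nhds.resolve_left (hnc z hz)
  have hcont : ∀ z ∈ ball (0 : ℂ) 1, ContinuousAt ψ (g z) := by
    intro z hz
    unfold ContinuousAt
    rw [hinv z hz]
    refine (Filter.tendsto_map'_iff.2 ?_ : Filter.Tendsto ψ (Filter.map g (nhds z)) (nhds z)).mono_left (hopen z hz)
    refine Filter.Tendsto.congr' ?_ Filter.tendsto_id
    filter_upwards [hU z hz] with w hw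
    exact (hinv w hw).symm
  have hright : ∀ z ∈ ball (0 : ℂ) 1, ∀ᶠ w in nhds (g z), w ∈ g '' ball (0 : ℂ) 1 := by
    intro z hz
    exact hopen z hz (Filter.image_mem_map (hU z hz))
  have hright' : ∀ w ∈ g '' ball (0 : ℂ) 1, g (ψ w) = w := by
    rintro _ ⟨z, hz, rfl⟩
    rw [hinv z hz]
  have hreg : ∀ z ∈ ball (0 : ℂ) 1, deriv g z ≠ 0 → DifferentiableAt ℂ ψ (g z) := by
    intro z hz hd
    refine (HasDerivAt.of_local_left_inverse (f := g) (f' := deriv g z) (hcont z hz) ?_ hd ?_).differentiableAt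
    · rw [hinv z hz]; exact (han z hz).differentiableAt.hasDerivAt
    · filter_upwards [hright z hz] with w hw using hright' w hw
  have hdiff : ∀ z ∈ ball (0 : ℂ) 1, DifferentiableAt ℂ ψ (g z) := by
    intro z hz
    have hd := (han z hz).deriv
    rcases hd.eventually_eq_zero_or_eventually_ne_zero with h | h
    · exfalso
      obtain ⟨r, hr, hr2⟩ := Metric.eventually_nhds_iff_ball.1 (h.and (hU z hz))
      apply hnc z hz
      refine Metric.eventually_nhds_iff_ball.2 ⟨r, hr, fun w hw => ?_⟩
      refine (convex_ball z r).is_const_of_fderivWithin_eq_zero (𝕜 := ℂ) (f := g) ?_ ?_ hw (mem_ball_self hr)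
      · intro y hy
        exact (han y (hr2 y hy).2).differentiableAt.differentiableWithinAt
      · intro y hy
        rw [fderivWithin_of_isOpen isOpen_ball hy]
        ext
        simpa using (hr2 y hy).1
    · refine (Complex.analyticAt_of_differentiable_on_punctured_nhds_of_continuousAt ?_ (hcont z hz)).differentiableAt
      have h' : ∀ᶠ y in nhds z, y ≠ z → deriv g y ≠ 0 := eventually_nhdsWithin_iff.1 h
      have hc := hcont z hz
      unfold ContinuousAt at hc
      rw [hinv z hz] at hc
      rw [eventually_nhdsWithin_iff]
      filter_upwards [hc.eventually h', hright z hz] with w hw hw2 hw3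
      obtain ⟨y, hy, rfl⟩ := hw2
      rw [hinv y hy] at hw
      exact hreg y hy (hw (fun h => hw3 (by simp [h])))
  refine ⟨ψ, hinv, hdiff, ?_⟩
  intro z hz h0
  have h1 := (hdiff z hz).hasDerivAt.comp z (han z hz).differentiableAt.hasDerivAt
  rw [h0, mul_zero] at h1
  have h2 : HasDerivAt (ψ ∘ g) 1 z := (hasDerivAt_id z).congr_of_eventuallyEq (by
    filter_upwards [hU z hz] with w hw using hinv w hw)
  exact one_ne_zero (h2.unique h1)

lemma real_aux (γ : ℝ → ℂ) (z v : ℂ) (h0 : γ 0 = z) (hd : HasDerivAt γ v 0)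
    (hle : ∀ t ∈ Set.Ioo (0:ℝ) 1, ‖γ t‖ ≤ ‖z‖) : (v * (starRingEnd ℂ) z).re ≤ 0 := by
  have h1 : HasDerivAt (fun t => ((γ t) * (starRingEnd ℂ) z).re) ((v * (starRingEnd ℂ) z).re) 0 := by
    have := hd.mul_const ((starRingEnd ℂ) z)
    exact (Complex.reCLM.hasFDerivAt.comp_hasDerivAt _ this)
  have h2 := h1.hasDerivWithinAt (s := Set.Ioi 0)
  rw [hasDerivWithinAt_iff_tendsto_slope' (by simp)] at h2
  refine le_of_tendsto h2 ?_
  filter_upwards [Ioo_mem_nhdsGT (show (0:ℝ) < 1 by norm_num)] with t ht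
  rw [slope_def_field]
  apply div_nonpos_of_nonpos_of_nonneg _ (by simpa using ht.1.le)
  rw [h0, sub_nonpos]
  calc _ ≤ ‖γ t * (starRingEnd ℂ) z‖ := Complex.re_le_norm _
    _ = ‖γ t‖ * ‖z‖ := by simp
    _ ≤ ‖z‖ * ‖z‖ := by gcongr; exact hle t ht
    _ = _ := by rw [Complex.mul_conj, Complex.normSq_eq_norm_sq]; simp [sq]

lemma conv_aux (g : ℂ → ℂ) (hg : DifferentiableOn ℂ g (ball (0 : ℂ) 1))
    (hi : Set.InjOn g (ball (0 : ℂ) 1)) (hc : Convex ℝ (g '' ball (0 : ℂ) 1))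
    (z w : ℂ) (hz : z ∈ ball (0 : ℂ) 1) (hz0 : z ≠ 0) (hw : ‖w‖ ≤ ‖z‖) :
    0 ≤ ((g z - g w) / (z * deriv g z)).re := by
  obtain ⟨ψ, hψ, hψd, hg0⟩ := inv_aux g hg hi
  set x := w / z with hx
  have hx1 : ‖x‖ ≤ 1 := by
    rw [hx, norm_div]; exact div_le_one_of_le₀ hw (norm_nonneg _)
  have hxw : x * z = w := by rw [hx]; field_simp
  have hxU : ∀ ζ ∈ ball (0 : ℂ) 1, x * ζ ∈ ball (0 : ℂ) 1 := by
    intro ζ hζ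
    rw [mem_ball_zero_iff] at *
    rw [norm_mul]
    nlinarith [norm_nonneg x, norm_nonneg ζ]
  have hdg : ∀ y ∈ ball (0 : ℂ) 1, DifferentiableAt ℂ g y := fun y hy =>
    hg.differentiableAt (isOpen_ball.mem_nhds hy)
  let γ : ℝ → ℂ → ℂ := fun t ζ => ψ (g ζ + (t:ℂ) * (g (x * ζ) - g ζ))
  have hmem : ∀ t ∈ Set.Ioo (0:ℝ) 1, ∀ ζ ∈ ball (0 : ℂ) 1,
      ∃ y ∈ ball (0 : ℂ) 1, g y = g ζ + (t:ℂ) * (g (x * ζ) - g ζ) := by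
    intro t ht ζ hζ
    have := hc (mem_image_of_mem g hζ) (mem_image_of_mem g (hxU ζ hζ)) (a := 1 - t) (b := t)
      (by linarith [ht.2]) ht.1.le (by ring)
    obtain ⟨y, hy, hy2⟩ := this
    refine ⟨y, hy, hy2.trans ?_⟩
    simp; ring
  have hle : ∀ t ∈ Set.Ioo (0:ℝ) 1, ‖γ t z‖ ≤ ‖z‖ := by
    intro t ht
    refine Complex.norm_le_norm_of_mapsTo_ball (f := γ t) (R := 1) ?_ ?_ ?_ (by simpa using hz)
    · intro ζ hζ
      obtain ⟨y, hy, hy2⟩ := hmem t ht ζ hζ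
      have h1 := hψd y hy
      rw [hy2] at h1
      have h3 : DifferentiableAt ℂ (fun ζ => g (x * ζ)) ζ :=
        DifferentiableAt.comp (g := g) ζ (hdg _ (hxU ζ hζ)) (by fun_prop)
      have h2 : DifferentiableAt ℂ (fun ζ => g ζ + (t:ℂ) * (g (x * ζ) - g ζ)) ζ :=
        (hdg ζ hζ).add ((h3.sub (hdg ζ hζ)).const_mul _)
      exact (DifferentiableAt.comp (g := ψ) ζ h1 h2).differentiableWithinAt
    · intro ζ hζ
      obtain ⟨y, hy, hy2⟩ := hmem t ht ζ hζ
      show γ t ζ ∈ _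
      simp only [γ]
      rw [← hy2, hψ y hy]
      exact ball_subset_closedBall hy
    · simp [γ, hψ 0 (by simp)]
  have hder : HasDerivAt (fun t : ℝ => γ t z) ((g w - g z) / deriv g z) 0 := by
    have h1 : HasDerivAt ψ (deriv g z)⁻¹ (g z) := by
      have hd := (hψd z hz).hasDerivAt
      have hcmp := hd.comp z (hdg z hz).hasDerivAt
      have h2 : HasDerivAt (ψ ∘ g) 1 z := (hasDerivAt_id z).congr_of_eventuallyEq (by
        filter_upwards [isOpen_ball.mem_nhds hz] with w hw using hψ w hw)
      have := hcmp.unique h2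
      rwa [eq_inv_of_mul_eq_one_left this] at hd
    have h2 : HasDerivAt (fun t : ℝ => g z + (t:ℂ) * (g w - g z)) (g w - g z) 0 := by
      have := ((Complex.ofRealCLM.hasDerivAt (x := 0)).mul_const (g w - g z)).const_add (g z)
      simpa using this
    have h3 : HasDerivAt ψ (deriv g z)⁻¹ (g z + ((0:ℝ):ℂ) * (g w - g z)) := by simpa using h1
    have := h3.comp (0:ℝ) h2
    simp only [γ, hxw]
    rw [div_eq_inv_mul]
    exact this
  have := real_aux (fun t => γ t z) z _ (by simp [γ, hψ z hz]) hder hle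
  have hzz : (g z - g w) / (z * deriv g z) = ((-((g w - g z) / deriv g z * (starRingEnd ℂ) z) * ((‖z‖^2)⁻¹ : ℝ) : ℂ)) := by
    have h1 : ((‖z‖^2 : ℝ) : ℂ) = z * (starRingEnd ℂ) z := by
      rw [Complex.mul_conj, Complex.normSq_eq_norm_sq]
    rw [Complex.ofReal_inv, h1]
    have := hg0 z hz
    have hz' : (starRingEnd ℂ) z ≠ 0 := by simpa using hz0
    field_simp
    ring
  rw [hzz, Complex.re_mul_ofReal, Complex.neg_re]
  have : 0 ≤ (‖z‖^2)⁻¹ := by positivity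
  nlinarith

lemma half_aux (g : ℂ → ℂ) (hg : DifferentiableOn ℂ g (ball (0 : ℂ) 1))
    (hi : Set.InjOn g (ball (0 : ℂ) 1)) (hc : Convex ℝ (g '' ball (0 : ℂ) 1))
    (z : ℂ) (hz : z ∈ ball (0 : ℂ) 1) (hz0 : z ≠ 0) :
    1 / 2 ≤ ((z * deriv g z) / (g z - g 0)).re := by
  have hg0 : deriv g z ≠ 0 := by
    obtain ⟨ψ, _, _, hg0⟩ := inv_aux g hg hi
    exact hg0 z hz
  let p : ℂ → ℂ := fun u => (z * deriv g z) / (g z - g (u * z))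
  have hU : ∀ u ∈ ball (0 : ℂ) 1, u * z ∈ ball (0 : ℂ) 1 := by
    intro u hu
    rw [mem_ball_zero_iff] at *
    rw [norm_mul]
    nlinarith [norm_nonneg z, norm_nonneg u]
  have hne : ∀ u ∈ ball (0 : ℂ) 1, g z - g (u * z) ≠ 0 := by
    intro u hu h
    have := hi hz (hU u hu) (sub_eq_zero.1 h)
    have h1 : u = 1 := by
      have : (u - 1) * z = 0 := by linear_combination -this
      rcases mul_eq_zero.1 this with h | h
      · linear_combination h
      · exact absurd h hz0
    rw [h1] at hu
    simp at hu
  have hp : DifferentiableOn ℂ p (ball 0 1) := by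
    intro u hu
    have h1 : DifferentiableAt ℂ (fun u => g (u * z)) u :=
      DifferentiableAt.comp (g := g) u (hg.differentiableAt (isOpen_ball.mem_nhds (hU u hu))) (by fun_prop)
    exact ((differentiableAt_const _).div ((differentiableAt_const _).sub h1) (hne u hu)).differentiableWithinAt
  have hpre : ∀ u ∈ ball (0 : ℂ) 1, 0 ≤ (p u).re := by
    intro u hu
    have := conv_aux g hg hi hc z (u * z) hz hz0 (by
      rw [norm_mul]; rw [mem_ball_zero_iff] at hu; nlinarith [norm_nonneg z])
    have h2 : p u = ((g z - g (u * z)) / (z * deriv g z))⁻¹ := by simp [p]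
    rw [h2, Complex.inv_re]
    exact div_nonneg this (normSq_nonneg _)
  have key : ∀ M, (p 0).re < M → 1 / 2 ≤ M := by
    intro M hM
    have hM0 : 0 < M := (hpre 0 (by simp)).trans_lt hM
    have hb : ∀ s ∈ Set.Ioo (0:ℝ) 1, (1 - s) * (p s).re ≤ (1 - s) * (p 0).re + 2 * M * s := by
      intro s hs
      have hsU : (s:ℂ) ∈ ball (0:ℂ) 1 := by simp [abs_lt]; constructor <;> linarith [hs.1, hs.2]
      have := Complex.borelCaratheodory_zero (f := fun u => p 0 - p u) (R := 1) hM0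
        (hp.const_sub _) (by
          intro u hu
          have := hpre u hu
          simp only [Set.mem_ofPred_eq, sub_re]; linarith) one_pos hsU (by simp)
      have h2 := (abs_le.1 (Complex.abs_re_le_norm (p 0 - p s))).1
      have h3 : ‖(s:ℂ)‖ = s := by simp [abs_of_pos hs.1]
      rw [h3] at this
      rw [le_div_iff₀ (by linarith [hs.2])] at this
      rw [sub_re] at h2
      nlinarith [hs.2]
    have hlim : Filter.Tendsto (fun s : ℝ => (((1 - s : ℝ) : ℂ) * p s).re) (nhdsWithin 1 (Set.Iio 1)) (nhds 1) := by
      have hd : HasDerivAt (fun s : ℝ => g (s * z)) (deriv g z * z) 1 := by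
        have h1 : HasDerivAt g (deriv g z) (((1:ℝ):ℂ) * z) := by
          simpa using (hg.differentiableAt (isOpen_ball.mem_nhds hz)).hasDerivAt
        have h2 := (Complex.ofRealCLM.hasDerivAt (x := 1)).mul_const z
        have h3 := h1.comp (1:ℝ) h2
        simp only [Complex.ofRealCLM_apply, Complex.ofReal_one, one_mul] at h3
        exact h3
      have hd2 := hd.hasDerivWithinAt (s := Set.Iio 1)
      rw [hasDerivWithinAt_iff_tendsto_slope' (by simp)] at hd2
      have h3 := (tendsto_const_nhds (x := z * deriv g z)).div hd2 (mul_ne_zero hg0 hz0)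
      rw [mul_comm, div_self (mul_ne_zero hg0 hz0)] at h3
      have h4 := (Complex.continuous_re.tendsto _).comp h3
      simp only [Complex.one_re] at h4
      refine h4.congr' ?_
      filter_upwards [self_mem_nhdsWithin] with s hs
      simp only [Function.comp, Pi.div_apply, p, slope_def_module]
      congr 1
      have : (1:ℝ) - s ≠ 0 := by have := (Set.mem_Iio.1 hs); linarith
      have h5 : (1:ℂ) - s ≠ 0 := by exact_mod_cast this
      have h6 : (s:ℂ) - 1 ≠ 0 := by intro h; apply h5; linear_combination -h
      rw [Complex.real_smul]
      push_cast
      rw [one_mul, ← neg_sub (g z), ← neg_sub (1:ℂ), inv_neg, neg_mul_neg, ← div_eq_inv_mul, div_div_eq_mul_div]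
      ring
    have hlim2 : Filter.Tendsto (fun s : ℝ => (1 - s) * (p 0).re + 2 * M * s) (nhdsWithin 1 (Set.Iio 1)) (nhds (2 * M)) := by
      have : Continuous (fun s : ℝ => (1 - s) * (p 0).re + 2 * M * s) := by fun_prop
      have := (this.tendsto 1).mono_left (nhdsWithin_le_nhds (s := Set.Iio 1))
      simpa using this
    have := le_of_tendsto_of_tendsto hlim hlim2 (by
      filter_upwards [Ioo_mem_nhdsLT (show (0:ℝ) < 1 by norm_num)] with s hs
      rw [Complex.re_ofReal_mul]
      exact hb s hs)
    linarith
  have := le_of_forall_gt_imp_ge_of_dense key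
  simpa [p] using this

lemma schwarz_aux' (g : ℂ → ℂ) (hg : DifferentiableOn ℂ g (ball (0 : ℂ) 1))
    (hi : Set.InjOn g (ball (0 : ℂ) 1)) (hc : Convex ℝ (g '' ball (0 : ℂ) 1))
    (z : ℂ) (hz : z ∈ ball (0 : ℂ) 1) (hz0 : z ≠ 0) :
    ‖1 - (g z - g 0) / (z * deriv g z)‖ ≤ ‖z‖ := by
  obtain ⟨ψ, _, _, hg0⟩ := inv_aux g hg hi
  let ω : ℂ → ℂ := fun u => 1 - dslope g 0 u / deriv g u
  have hω : ∀ u, u ≠ 0 → ω u = 1 - (g u - g 0) / (u * deriv g u) := by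
    intro u hu
    simp only [ω]
    rw [dslope_of_ne _ hu, slope_def_field, sub_zero, div_div]
  rw [← hω z hz0]
  have h0 : (0:ℂ) ∈ ball (0:ℂ) 1 := by simp
  have hω0 : ω 0 = 0 := by simp [ω, hg0 0 h0]
  refine Complex.norm_le_norm_of_mapsTo_ball (R := 1) ?_ ?_ hω0 (by simpa using hz)
  · have h1 : DifferentiableOn ℂ (dslope g 0) (ball 0 1) :=
      (Complex.differentiableOn_dslope (isOpen_ball.mem_nhds h0)).2 hg
    exact (h1.div (hg.deriv isOpen_ball) hg0).const_sub _
  · intro u hu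
    rw [mem_closedBall_zero_iff]
    by_cases hu0 : u = 0
    · rw [hu0, hω0]; simp
    rw [hω u hu0]
    have h1 := half_aux g hg hi hc u hu hu0
    set S := (u * deriv g u) / (g u - g 0) with hS
    have h2 : (g u - g 0) / (u * deriv g u) = S⁻¹ := by rw [hS, inv_div]
    rw [h2]
    have hS0 : S ≠ 0 := by
      intro h; rw [h] at h1; simp at h1; linarith
    have h3 : 1 - S⁻¹ = (S - 1) / S := by field_simp
    rw [h3, norm_div]
    apply div_le_one_of_le₀ _ (norm_nonneg _)
    rw [← sq_le_sq₀ (norm_nonneg _) (norm_nonneg _), ← Complex.normSq_eq_norm_sq, ← Complex.normSq_eq_norm_sq,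
      Complex.normSq_apply, Complex.normSq_apply]
    simp
    nlinarith

lemma half_plane (g : ℂ → ℂ) (hg : DifferentiableOn ℂ g (ball (0 : ℂ) 1))
    (hi : Set.InjOn g (ball (0 : ℂ) 1)) (hc : Convex ℝ (g '' ball (0 : ℂ) 1))
    (hg0 : g 0 = 0) (hg1 : deriv g 0 = 1)
    (c : ℂ) (hcU : c ∈ ball (0 : ℂ) 1) (hc0 : c ≠ 0) :
    1 / 2 < (g c / c).re := by
  let T : ℂ → ℂ := fun z => (c - z) / (1 - (starRingEnd ℂ) c * z)
  have hc1 : ‖c‖ < 1 := by simpa using hcU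
  have hden : ∀ z ∈ ball (0 : ℂ) 1, 1 - (starRingEnd ℂ) c * z ≠ 0 := by
    intro z hz h
    have h1 : ‖(starRingEnd ℂ) c * z‖ = 1 := by
      rw [← sub_eq_zero.1 h]; simp
    rw [norm_mul, Complex.norm_conj] at h1
    rw [mem_ball_zero_iff] at hz
    nlinarith [norm_nonneg c, norm_nonneg z]
  have hTU : ∀ z ∈ ball (0 : ℂ) 1, T z ∈ ball (0 : ℂ) 1 := by
    intro z hz
    have hd := hden z hz
    rw [mem_ball_zero_iff] at *
    simp only [T]
    rw [norm_div, div_lt_one (norm_pos_iff.2 hd), ← sq_lt_sq₀ (norm_nonneg _) (norm_nonneg _),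
      ← Complex.normSq_eq_norm_sq, ← Complex.normSq_eq_norm_sq]
    have h1 : normSq c < 1 := by rw [Complex.normSq_eq_norm_sq]; nlinarith [norm_nonneg c]
    have h2 : normSq z < 1 := by rw [Complex.normSq_eq_norm_sq]; nlinarith [norm_nonneg z]
    rw [Complex.normSq_apply] at *
    rw [Complex.normSq_apply]
    simp
    nlinarith [mul_pos (sub_pos.2 h1) (sub_pos.2 h2)]
  have hTT : ∀ z ∈ ball (0 : ℂ) 1, T (T z) = z := by
    intro z hz
    have hd := hden z hz
    have hd2 := hden _ (hTU z hz)
    show (c - T z) / (1 - (starRingEnd ℂ) c * T z) = z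
    rw [div_eq_iff hd2]
    have h1 : T z * (1 - (starRingEnd ℂ) c * z) = c - z := div_mul_cancel₀ _ hd
    linear_combination -h1
  have hTd : ∀ z ∈ ball (0 : ℂ) 1, HasDerivAt T ((-1 * (1 - (starRingEnd ℂ) c * z) - (c - z) * (-(starRingEnd ℂ) c)) / (1 - (starRingEnd ℂ) c * z)^2) z := by
    intro z hz
    refine HasDerivAt.div (c := fun z => c - z) (d := fun z => 1 - (starRingEnd ℂ) c * z) ?_ ?_ (hden z hz)
    · simpa using (hasDerivAt_id z).const_sub c
    · simpa using ((hasDerivAt_id z).const_mul ((starRingEnd ℂ) c)).const_sub 1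
  have himg : (g ∘ T) '' ball (0 : ℂ) 1 = g '' ball (0 : ℂ) 1 := by
    rw [image_comp]
    congr 1
    ext z
    constructor
    · rintro ⟨y, hy, rfl⟩; exact hTU y hy
    · intro hz; exact ⟨T z, hTU z hz, hTT z hz⟩
  have hGd : DifferentiableOn ℂ (g ∘ T) (ball 0 1) :=
    hg.comp (fun z hz => (hTd z hz).differentiableAt.differentiableWithinAt) hTU
  have hGi : Set.InjOn (g ∘ T) (ball 0 1) := by
    intro a ha b hb hab
    have := hi (hTU a ha) (hTU b hb) hab
    rw [← hTT a ha, this, hTT b hb]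
  have hmain := schwarz_aux' (g ∘ T) hGd hGi (by rw [himg]; exact hc) c hcU hc0
  have hTc : T c = 0 := by simp [T]
  have hT0 : T 0 = c := by simp [T]
  have hnn : (starRingEnd ℂ) c * c = ((‖c‖^2 : ℝ) : ℂ) := by
    rw [mul_comm, Complex.mul_conj, Complex.normSq_eq_norm_sq]
  have hdd : deriv (g ∘ T) c = -(((1 - ‖c‖^2 : ℝ) : ℂ))⁻¹ := by
    have h1 : HasDerivAt g 1 (T c) := by
      rw [hTc, ← hg1]; exact (hg.differentiableAt (isOpen_ball.mem_nhds (by simp))).hasDerivAt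
    have h2 := (h1.comp c (hTd c hcU)).deriv
    rw [h2, hnn]
    have := hden c hcU
    rw [hnn] at this
    push_cast at *
    field_simp
    ring
  simp only [Function.comp, hTc, hT0, hg0] at hmain
  rw [hdd] at hmain
  have h3 : (0 - g c) / (c * -(((1 - ‖c‖^2 : ℝ) : ℂ))⁻¹) = g c / c * ((1 - ‖c‖^2 : ℝ) : ℂ) := by
    rw [mul_neg, zero_sub, neg_div_neg_eq, div_mul_eq_div_div, div_inv_eq_mul]
  rw [h3] at hmain
  have h4 := (Complex.re_le_norm _).trans hmain
  rw [sub_re, Complex.re_mul_ofReal, one_re] at h4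
  have h5 : 0 < ‖c‖ := norm_pos_iff.2 hc0
  by_contra hcon
  push Not at hcon
  nlinarith [mul_pos h5 (sub_pos.2 hc1)]

lemma int_exp (k : ℤ) : ∫ θ in (0:ℝ)..(2 * Real.pi), Complex.exp (k * θ * I) =
    if k = 0 then 2 * Real.pi else 0 := by
  split_ifs with h
  · simp [h]
  · have hk : (k : ℂ) * I ≠ 0 := mul_ne_zero (by exact_mod_cast h) I_ne_zero
    have h1 : ∀ θ : ℝ, Complex.exp (k * θ * I) = Complex.exp ((k * I) * θ) := fun θ => by
      congr 1; ring
    simp_rw [h1]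
    rw [integral_exp_mul_complex hk]
    have : Complex.exp (k * I * ((2 * Real.pi : ℝ) : ℂ)) = 1 := by
      rw [Complex.exp_eq_one_iff]
      exact ⟨k, by push_cast; ring⟩
    rw [this]; simp

lemma norm_exp_aux (k : ℤ) (θ : ℝ) : ‖Complex.exp (k * θ * I)‖ = 1 := by
  have := Complex.norm_exp_ofReal_mul_I (k * θ)
  push_cast at this
  exact this

lemma int_series {ι : Type} [Countable ι] (c : ι → ℂ) (k : ι → ℤ) (hc : Summable fun i => ‖c i‖) :
    ∫ θ in (0:ℝ)..(2 * Real.pi), ∑' i, c i * Complex.exp (k i * θ * I) =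
      2 * Real.pi * ∑' i, if k i = 0 then c i else 0 := by
  have h := intervalIntegral.hasSum_integral_of_dominated_convergence (a := 0) (b := 2 * Real.pi)
    (μ := MeasureTheory.volume)
    (F := fun i (θ : ℝ) => c i * Complex.exp (k i * θ * I))
    (f := fun θ : ℝ => ∑' i, c i * Complex.exp (k i * θ * I))
    (fun i _ => ‖c i‖) (fun i => by
      apply Continuous.aestronglyMeasurable; fun_prop)
    (fun i => Filter.Eventually.of_forall fun θ _ => by rw [norm_mul, norm_exp_aux, mul_one])
    (Filter.Eventually.of_forall fun θ _ => hc)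
    (by simp)
    (Filter.Eventually.of_forall fun θ _ => by
      apply Summable.hasSum
      apply Summable.of_norm
      simpa only [norm_mul, norm_exp_aux, mul_one] using hc)
  rw [← h.tsum_eq, ← tsum_mul_left]
  congr 1; ext i
  rw [intervalIntegral.integral_const_mul, int_exp]
  split_ifs <;> simp <;> ring

lemma cont_series (c : ℕ → ℂ) (k : ℕ → ℤ) (hc : Summable fun i => ‖c i‖) :
    Continuous fun θ : ℝ => ∑' i, c i * Complex.exp (k i * θ * I) := by
  refine continuous_tsum (fun i => by fun_prop) hc ?_
  intro i θ
  rw [norm_mul, norm_exp_aux, mul_one]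

lemma prod_series (α γ : ℕ → ℂ) (k l : ℕ → ℤ) (hα : Summable fun n => ‖α n‖)
    (hγ : Summable fun n => ‖γ n‖) :
    ∫ θ in (0:ℝ)..(2 * Real.pi), (∑' i, α i * Complex.exp (k i * θ * I)) *
        (∑' i, γ i * Complex.exp (l i * θ * I)) =
      2 * Real.pi * ∑' i : ℕ × ℕ, if k i.1 + l i.2 = 0 then α i.1 * γ i.2 else 0 := by
  rw [← int_series (fun i : ℕ × ℕ => α i.1 * γ i.2) (fun i => k i.1 + l i.2)
    (summable_mul_of_summable_norm hα hγ).norm]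
  congr 1; ext θ
  rw [tsum_mul_tsum_of_summable_norm]
  · congr 1; ext i
    push_cast
    rw [add_mul, add_mul, Complex.exp_add]; ring
  · simpa only [norm_mul, norm_exp_aux, mul_one] using hα
  · simpa only [norm_mul, norm_exp_aux, mul_one] using hγ

lemma conv_int (α γ : ℕ → ℂ) (hα : Summable fun n => ‖α n‖)
    (hγ : Summable fun n => ‖γ n‖) :
    ∫ θ in (0:ℝ)..(2 * Real.pi),
        (((2 * (∑' i, α i * Complex.exp ((i:ℤ) * θ * I)).re : ℝ)) : ℂ) *
        (∑' i, γ i * Complex.exp ((-(i:ℤ) : ℤ) * θ * I)) =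
      2 * Real.pi * ((∑' n, α n * γ n) + (starRingEnd ℂ) (α 0) * γ 0) := by
  have e1 := prod_series α γ (fun i => i) (fun i => -i) hα hγ
  have hα' : Summable fun n => ‖(starRingEnd ℂ) (α n)‖ := by simpa using hα
  have e2 := prod_series (fun n => (starRingEnd ℂ) (α n)) γ (fun i => -i) (fun i => -i) hα' hγ
  have s1 : (∑' i : ℕ × ℕ, if ((i.1 : ℤ)) + -(i.2 : ℤ) = 0 then α i.1 * γ i.2 else 0)
      = ∑' n, α n * γ n := by
    have hinj : Function.Injective (fun n : ℕ => (n, n)) := fun a b h => (Prod.ext_iff.1 h).1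
    rw [← hinj.tsum_eq]
    · simp
    · rintro ⟨a, b⟩ h
      rw [Function.mem_support] at h
      have : (a:ℤ) + -(b:ℤ) = 0 := by by_contra h'; simp [h'] at h
      exact ⟨a, by ext <;> simp; omega⟩
  have s2 : (∑' i : ℕ × ℕ, if (-(i.1 : ℤ)) + -(i.2 : ℤ) = 0 then (starRingEnd ℂ) (α i.1) * γ i.2 else 0)
      = (starRingEnd ℂ) (α 0) * γ 0 := by
    rw [tsum_eq_single (0, 0)]
    · simp
    · rintro ⟨a, b⟩ h
      rw [if_neg]
      intro h'
      apply h
      ext <;> simp at * <;> omega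
  have c1 := cont_series α (fun i => i) hα
  have c2 := cont_series (fun n => (starRingEnd ℂ) (α n)) (fun i => -i) hα'
  have c3 := cont_series γ (fun i => -i) hγ
  rw [s1] at e1
  rw [s2] at e2
  rw [mul_add, ← e1, ← e2, ← intervalIntegral.integral_add]
  · congr 1; ext θ
    rw [← add_mul]
    congr 1
    have : (∑' i, (starRingEnd ℂ) (α i) * Complex.exp ((-(i:ℤ) : ℤ) * θ * I)) =
        (starRingEnd ℂ) (∑' i, α i * Complex.exp ((i:ℤ) * θ * I)) := by
      rw [Complex.conj_tsum]
      congr 1; ext i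
      rw [map_mul, ← Complex.exp_conj]
      simp
    rw [this, Complex.add_conj]
  · exact (c1.mul c3).intervalIntegrable _ _
  · exact (c2.mul c3).intervalIntegrable _ _

lemma conv_pos (P b : ℕ → ℂ) (p q : ℂ → ℂ) (hP : ∀ z ∈ ball (0:ℂ) 1, HasSum (fun n => P n * z ^ n) (p z))
    (hb : ∀ z ∈ ball (0:ℂ) 1, HasSum (fun n => b n * z ^ n) (q z))
    (hP0 : P 0 = 1) (hb0 : b 0 = 1) (hp : ∀ z ∈ ball (0:ℂ) 1, 0 < (p z).re)
    (hq : ∀ z ∈ ball (0:ℂ) 1, 1 / 2 < (q z).re) (z : ℂ) (hz : z ∈ ball (0:ℂ) 1) :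
    0 < (∑' n, P n * b n * z ^ n).re := by
  rw [mem_ball_zero_iff] at hz
  obtain ⟨ρ, hρ, hρ1⟩ := exists_between hz
  have hρ0 : 0 < ρ := (norm_nonneg z).trans_lt hρ
  have hρc : (ρ:ℂ) ≠ 0 := by exact_mod_cast hρ0.ne'
  let u : ℂ := z / ρ
  have hu : u ∈ ball (0:ℂ) 1 := by
    rw [mem_ball_zero_iff]
    simp only [u, norm_div, Complex.norm_real, Real.norm_eq_abs, abs_of_pos hρ0]
    rw [div_lt_one hρ0]; exact hρ
  have hρb : (ρ:ℂ) ∈ ball (0:ℂ) 1 := by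
    rw [mem_ball_zero_iff]; simpa [abs_of_pos hρ0] using hρ1
  let α : ℕ → ℂ := fun n => P n * ρ ^ n
  let δ : ℕ → ℂ := fun n => if n = 0 then 1 / 2 else 0
  let γ : ℕ → ℂ := fun n => b n * u ^ n - δ n
  have hδ : HasSum δ (1/2) := by
    have := hasSum_single (f := δ) 0 (by intro n hn; simp [δ, hn])
    simpa [δ] using this
  have hα : Summable fun n => ‖α n‖ := (hP _ hρb).summable.norm
  have hγ : Summable fun n => ‖γ n‖ := ((hb _ hu).summable.sub hδ.summable).norm
  have key := conv_int α γ hα hγ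
  have hα0 : α 0 = 1 := by simp [α, hP0]
  have hγ0 : γ 0 = 1 / 2 := by simp [γ, δ, hb0]; norm_num
  have hs : Summable fun n => α n * γ n := by
    obtain h := (hγ.mul_norm hα)
    have hαb : Summable fun n => ‖α n * γ n‖ := by
      refine Summable.of_nonneg_of_le (fun _ => norm_nonneg _) (fun n => ?_) (hγ.mul_left (∑' n, ‖α n‖))
      rw [norm_mul]
      gcongr
      exact hα.le_tsum n (fun _ _ => norm_nonneg _)
    exact hαb.of_norm
  have hS : (∑' n, P n * b n * z ^ n) = (∑' n, α n * γ n) + (starRingEnd ℂ) (α 0) * γ 0 := by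
    have h1 : HasSum (fun n => α n * γ n + δ n) ((∑' n, α n * γ n) + 1 / 2) := hs.hasSum.add hδ
    rw [hα0, hγ0, map_one, one_mul, ← h1.tsum_eq]
    congr 1; ext n
    by_cases hn : n = 0
    · subst hn; rw [hα0, hγ0]; simp [δ, hP0, hb0]; norm_num
    · simp only [α, γ, δ, u, hn, if_false, sub_zero, add_zero, div_pow]
      field_simp
  rw [hS]
  have hEp : ∀ θ : ℝ, (∑' i, α i * Complex.exp ((i:ℤ) * θ * I)) = p (ρ * Complex.exp (θ * I)) ∧
      ρ * Complex.exp (θ * I) ∈ ball (0:ℂ) 1 := by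
    intro θ
    have hm : ρ * Complex.exp (θ * I) ∈ ball (0:ℂ) 1 := by
      rw [mem_ball_zero_iff, norm_mul, Complex.norm_exp_ofReal_mul_I, mul_one]
      simpa using hρb
    refine ⟨?_, hm⟩
    rw [← (hP _ hm).tsum_eq]
    congr 1; ext n
    simp only [α]
    rw [mul_pow, ← Complex.exp_nat_mul]
    push_cast
    ring_nf
  have hEq : ∀ θ : ℝ, (∑' i, γ i * Complex.exp ((-(i:ℤ) : ℤ) * θ * I)) = q (u * Complex.exp ((-θ : ℝ) * I)) - 1 / 2 ∧
      u * Complex.exp ((-θ : ℝ) * I) ∈ ball (0:ℂ) 1 := by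
    intro θ
    have hm : u * Complex.exp ((-θ : ℝ) * I) ∈ ball (0:ℂ) 1 := by
      rw [mem_ball_zero_iff, norm_mul, Complex.norm_exp_ofReal_mul_I, mul_one]
      simpa using hu
    refine ⟨?_, hm⟩
    rw [← ((hb _ hm).sub hδ).tsum_eq]
    congr 1; ext n
    simp only [γ]
    by_cases hn : n = 0
    · subst hn; simp
    · simp only [δ, hn, if_false, sub_zero]
      rw [mul_pow, ← Complex.exp_nat_mul]
      push_cast
      ring_nf
  have c1 := cont_series α (fun i => i) hα
  have c3 := cont_series γ (fun i => -i) hγ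
  have hc : Continuous fun θ : ℝ => (((2 * (∑' i, α i * Complex.exp ((i:ℤ) * θ * I)).re : ℝ)) : ℂ) *
        (∑' i, γ i * Complex.exp ((-(i:ℤ) : ℤ) * θ * I)) :=
    (Complex.continuous_ofReal.comp ((Complex.continuous_re.comp c1).const_mul 2)).mul c3
  have hre := Complex.reCLM.intervalIntegral_comp_comm (hc.intervalIntegrable (μ := MeasureTheory.volume) 0 (2 * Real.pi))
  rw [key] at hre
  have hpos : 0 < ∫ θ in (0:ℝ)..(2 * Real.pi), Complex.reCLM ((((2 * (∑' i, α i * Complex.exp ((i:ℤ) * θ * I)).re : ℝ)) : ℂ) *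
        (∑' i, γ i * Complex.exp ((-(i:ℤ) : ℤ) * θ * I))) := by
    apply intervalIntegral.intervalIntegral_pos_of_pos
    · exact (Complex.reCLM.continuous.comp hc).intervalIntegrable _ _
    · intro θ
      rw [(hEp θ).1, (hEq θ).1]
      have h1 := hp _ (hEp θ).2
      have h2 := hq _ (hEq θ).2
      rw [Complex.reCLM_apply, Complex.re_ofReal_mul, Complex.sub_re]
      have : (1 / 2 : ℂ).re = 1 / 2 := by norm_num
      rw [this]
      have := sub_pos.2 h2
      positivity
    · positivity
  rw [hre, Complex.reCLM_apply] at hpos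
  have h2 : (2 * (Real.pi:ℂ)) = ((2 * Real.pi : ℝ) : ℂ) := by push_cast; ring
  rw [h2, Complex.re_ofReal_mul] at hpos
  exact pos_of_mul_pos_right hpos (by positivity)

lemma ps_aux (c : ℕ → ℂ) (hc : ∀ r ∈ Set.Ioo (0:ℝ) 1, Summable fun n => ‖c n‖ * r ^ n)
    (z : ℂ) (hz : z ∈ ball (0:ℂ) 1) :
    HasSum (fun n => c n * z ^ n) (∑' n, c n * z ^ n) ∧
    DifferentiableAt ℂ (fun z => ∑' n, c n * z ^ n) z ∧
    HasSum (fun n => c n * (n * z ^ (n - 1))) (deriv (fun z => ∑' n, c n * z ^ n) z) := by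
  rw [mem_ball_zero_iff] at hz
  obtain ⟨r, hr, hr1⟩ := exists_between hz
  have hr0 : 0 < r := (norm_nonneg z).trans_lt hr
  have hs := hc r ⟨hr0, hr1⟩
  have hle : ∀ (n : ℕ) (w : ℂ), w ∈ ball (0:ℂ) r → ‖c n * w ^ n‖ ≤ ‖c n‖ * r ^ n := by
    intro n w hw
    rw [norm_mul, norm_pow]
    rw [mem_ball_zero_iff] at hw
    gcongr
  have hzr : z ∈ ball (0:ℂ) r := by rwa [mem_ball_zero_iff]
  have hd : ∀ n : ℕ, DifferentiableOn ℂ (fun w : ℂ => c n * w ^ n) (ball 0 r) := fun n => by fun_prop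
  refine ⟨(Summable.of_norm (Summable.of_nonneg_of_le (fun _ => norm_nonneg _) (fun n => hle n z hzr) hs)).hasSum, ?_, ?_⟩
  · exact (Complex.differentiableOn_tsum_of_summable_norm hs hd isOpen_ball hle).differentiableAt
      (isOpen_ball.mem_nhds hzr)
  · have := Complex.hasSum_deriv_of_summable_norm hs hd isOpen_ball hle hzr
    convert! this using 2 with n
    simp

lemma comb_aux (β : ℂ) (c : ℕ → ℂ) (h0 : c 0 = 0) (z H D : ℂ) (hz0 : z ≠ 0)
    (hH : HasSum (fun n => c n * z ^ n) H) (hD : HasSum (fun n => c n * (n * z ^ (n - 1))) D) :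
    HasSum (fun n : ℕ => (β + (1 - β) * (n + 1)) * c (n + 1) * z ^ n) (β * (H / z) + (1 - β) * D) := by
  have h1 := (hasSum_nat_add_iff' 1).2 hH
  have h2 := (hasSum_nat_add_iff' 1).2 hD
  simp only [Finset.sum_range_one, h0, zero_mul, sub_zero] at h1 h2
  convert! ((h1.div_const z).mul_left β).add (h2.mul_left (1 - β)) using 2 with n
  rw [pow_succ]
  push_cast
  field_simp

lemma taylor_aux (f : ℂ → ℂ) (hf : DifferentiableOn ℂ f (ball (0 : ℂ) 1)) (z : ℂ)
    (hz : z ∈ ball (0:ℂ) 1) :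
    HasSum (fun n : ℕ => iteratedDeriv n f 0 / n.factorial * z ^ n) (f z) := by
  have := Complex.hasSum_taylorSeries_on_ball hf hz
  have e : (fun n : ℕ => iteratedDeriv n f 0 / n.factorial * z ^ n) =
      fun n : ℕ => (n.factorial : ℂ)⁻¹ • (z - 0) ^ n • iteratedDeriv n f 0 := by
    funext n
    rw [sub_zero, smul_eq_mul, smul_eq_mul]
    ring
  rw [e]
  exact this

lemma summ_aux (c : ℕ → ℂ) (f : ℂ → ℂ) (h : ∀ z ∈ ball (0:ℂ) 1, HasSum (fun n => c n * z ^ n) (f z)) :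
    ∀ r ∈ Set.Ioo (0:ℝ) 1, Summable fun n => ‖c n‖ * r ^ n := by
  intro r hr
  have := (h r (by simpa [abs_of_pos hr.1] using hr.2)).summable.norm
  simpa [abs_of_pos hr.1] using this

lemma summ_mul (a b : ℕ → ℂ) (ha : ∀ r ∈ Set.Ioo (0:ℝ) 1, Summable fun n => ‖a n‖ * r ^ n)
    (hb : ∀ r ∈ Set.Ioo (0:ℝ) 1, Summable fun n => ‖b n‖ * r ^ n) :
    ∀ r ∈ Set.Ioo (0:ℝ) 1, Summable fun n => ‖a n * b n‖ * r ^ n := by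
  intro r hr
  have hs : Real.sqrt r ∈ Set.Ioo (0:ℝ) 1 := ⟨Real.sqrt_pos.2 hr.1, by
    rw [Real.sqrt_lt' one_pos]; simpa using hr.2⟩
  have h1 := ha _ hs
  have h2 := hb _ hs
  have hp := hs.1
  refine Summable.of_nonneg_of_le (fun n => mul_nonneg (norm_nonneg _) (pow_nonneg hr.1.le _)) (fun n => ?_)
    (h2.mul_left (∑' n, ‖a n‖ * Real.sqrt r ^ n))
  have h3 := h1.le_tsum n (fun _ _ => by positivity)
  calc ‖a n * b n‖ * r ^ n = (‖a n‖ * Real.sqrt r ^ n) * (‖b n‖ * Real.sqrt r ^ n) := by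
        rw [norm_mul]
        nth_rewrite 1 [← Real.mul_self_sqrt hr.1.le]
        rw [mul_pow]; ring
    _ ≤ _ := by gcongr

lemma comb_f (β : ℂ) (f : ℂ → ℂ) (c : ℕ → ℂ) (hc0 : c 0 = 0)
    (h : ∀ z ∈ ball (0:ℂ) 1, HasSum (fun n => c n * z ^ n) (f z))
    (z : ℂ) (hz : z ∈ ball (0:ℂ) 1) (hz0 : z ≠ 0) :
    HasSum (fun n : ℕ => (β + (1 - β) * (n + 1)) * c (n + 1) * z ^ n)
      (β * (f z / z) + (1 - β) * deriv f z) := by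
  have h2 := (ps_aux c (summ_aux c f h) z hz).2.2
  refine comb_aux β c hc0 z _ _ hz0 (h z hz) ?_
  convert h2 using 1
  apply Filter.EventuallyEq.deriv_eq
  filter_upwards [isOpen_ball.mem_nhds hz] with w hw
  exact (h w hw).tsum_eq.symm


/-- the Hadamard product of f ∈ 𝒜_β with a convex function g ∈ 𝒦
again belongs to 𝒜_β. -/
theorem hadamard_mem_Abeta_of_convex (β : ℝ) (hβ : β ∈ Set.Icc (0 : ℝ) 1)
    (f g : ℂ → ℂ) (hf : memAb β f) (hg : memK g) :
    memAb β (hadamard f g) := by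
  obtain ⟨⟨hfd, hf0, hf1⟩, hfp⟩ := hf
  obtain ⟨⟨hgd, hg0, hg1⟩, hgi, hgc⟩ := hg
  let A : ℕ → ℂ := fun n => iteratedDeriv n f 0 / n.factorial
  let B : ℕ → ℂ := fun n => iteratedDeriv n g 0 / n.factorial
  have hA : ∀ z ∈ ball (0:ℂ) 1, HasSum (fun n => A n * z ^ n) (f z) := taylor_aux f hfd
  have hB : ∀ z ∈ ball (0:ℂ) 1, HasSum (fun n => B n * z ^ n) (g z) := taylor_aux g hgd
  have hA0 : A 0 = 0 := by simp [A, hf0]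
  have hB0 : B 0 = 0 := by simp [B, hg0]
  have hA1 : A 1 = 1 := by simp [A, hf1]
  have hB1 : B 1 = 1 := by simp [B, hg1]
  let C : ℕ → ℂ := fun n => A n * B n
  have hC0 : C 0 = 0 := by simp [C, hA0]
  have hCs := summ_mul A B (summ_aux A f hA) (summ_aux B g hB)
  have hH : hadamard f g = fun z => ∑' n, C n * z ^ n := rfl
  have hps := ps_aux C hCs
  rw [hH]
  have h0 : (0:ℂ) ∈ ball (0:ℂ) 1 := by simp
  refine ⟨⟨fun z hz => (hps z hz).2.1.differentiableWithinAt, ?_, ?_⟩, ?_⟩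
  · show ∑' n, C n * (0:ℂ) ^ n = 0
    rw [tsum_eq_single 0 (by intro n hn; simp [hn]), hC0, zero_mul]
  · rw [← (hps 0 h0).2.2.tsum_eq, tsum_eq_single 1]
    · simp [C, hA1, hB1]
    · intro n hn
      rcases Nat.lt_or_ge n 1 with h | h
      · have : n = 0 := by omega
        subst this; simp
      · have : n - 1 ≠ 0 := by omega
        simp [this]
  · intro z hz hz0
    rw [← (comb_f (β:ℂ) _ C hC0 (fun w hw => (hps w hw).1) z hz hz0).tsum_eq]
    let P : ℕ → ℂ := fun n => ((β:ℂ) + (1 - (β:ℂ)) * (n + 1)) * A (n + 1)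
    let p : ℂ → ℂ := fun z => if z = 0 then 1 else (β : ℂ) * (f z / z) + (1 - (β : ℂ)) * deriv f z
    let q : ℂ → ℂ := fun z => if z = 0 then 1 else g z / z
    have hP0 : P 0 = 1 := by simp [P, hA1]
    have hone : ∀ c : ℕ → ℂ, c 0 = 1 → HasSum (fun n => c n * (0:ℂ) ^ n) 1 := by
      intro c hc
      have := hasSum_single (f := fun n => c n * (0:ℂ) ^ n) 0 (by intro n hn; simp [hn])
      simpa [hc] using this
    have := conv_pos P (fun n => B (n + 1)) p q ?_ ?_ hP0 hB1 ?_ ?_ z hz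
    · convert this using 4 with n
      simp only [P, C]; ring
    · intro w hw
      by_cases h : w = 0
      · subst h; simpa [p] using hone P hP0
      · simpa [p, h] using comb_f (β:ℂ) f A hA0 hA w hw h
    · intro w hw
      by_cases h : w = 0
      · subst h; simpa [q] using hone (fun n => B (n + 1)) hB1
      · simpa [q, h] using comb_f 1 g B hB0 hB w hw h
    · intro w hw
      by_cases h : w = 0
      · simp [p, h]
      · simpa [p, h] using hfp w hw h
    · intro w hw
      by_cases h : w = 0
      · simp [q, h]; norm_num
      · simpa [q, h] using half_plane g hgd hgi hgc hg0 hg1 w hw h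
end
end

section
/- Let β ∈ [0,1], let f ∈ 𝒜_β, and let γ ∈ ℂ with Re γ ≥ −1/2. Then the Bernardi integral transform F(z) = (1+γ) ∫₀¹ s^{γ−1} f(sz) ds (equivalently, F(z) = (1+γ) z^{−γ} ∫₀^z t^{γ−1} f(t) dt), where s^{γ−1} = exp((γ−1) log s) for s ∈ (0,1], belongs to 𝒜_β. -/
open Complex Metric Set intervalIntegral

noncomputable section

lemma aux_smul_mem {z : ℂ} (hz : z ∈ ball (0 : ℂ) 1) {s : ℝ} (hs : s ∈ Icc (0 : ℝ) 1) :
    (s : ℂ) * z ∈ ball (0 : ℂ) 1 := by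
  simp only [mem_ball_zero_iff, norm_mul, Complex.norm_real, Real.norm_eq_abs,
    abs_of_nonneg hs.1] at *
  nlinarith [hs.1, hs.2, norm_nonneg z]

lemma aux_cont {h : ℂ → ℂ} (hh : ContinuousOn h (ball (0 : ℂ) 1)) {z : ℂ}
    (hz : z ∈ ball (0 : ℂ) 1) :
    ContinuousOn (fun s : ℝ => h ((s : ℂ) * z)) (uIcc (0 : ℝ) 1) := by
  rw [uIcc_of_le zero_le_one]
  exact hh.comp (by fun_prop) (fun s hs => aux_smul_mem hz hs)

lemma aux_int {h : ℂ → ℂ} (hh : ContinuousOn h (ball (0 : ℂ) 1)) {γ : ℂ} (hγ : -1 < γ.re)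
    {z : ℂ} (hz : z ∈ ball (0 : ℂ) 1) :
    IntervalIntegrable (fun s : ℝ => (s : ℂ) ^ γ * h ((s : ℂ) * z)) MeasureTheory.volume 0 1 :=
  (intervalIntegrable_cpow' hγ).mul_continuousOn (aux_cont hh hz)

/-- differentiation under the integral sign -/
lemma aux_deriv {g : ℂ → ℂ} (hg : DifferentiableOn ℂ g (ball (0 : ℂ) 1)) {γ : ℂ}
    (hγ : -1 < γ.re) {z : ℂ} (hz : z ∈ ball (0 : ℂ) 1) :
    HasDerivAt (fun z => ∫ s in (0 : ℝ)..1, (s : ℂ) ^ γ * g ((s : ℂ) * z))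
      (∫ s in (0 : ℝ)..1, (s : ℂ) ^ γ * (deriv g ((s : ℂ) * z) * s)) z := by
  have hg' : ContinuousOn (deriv g) (ball (0 : ℂ) 1) := (hg.deriv isOpen_ball).continuousOn
  have hz1 : ‖z‖ < 1 := by simpa using hz
  obtain ⟨ρ, hzρ, hρ⟩ := exists_between hz1
  have hsub : closedBall (0 : ℂ) ρ ⊆ ball 0 1 := closedBall_subset_ball hρ
  obtain ⟨M, hM⟩ := (isCompact_closedBall (0 : ℂ) ρ).exists_bound_of_continuousOn (hg'.mono hsub)
  have hnhds : ball (0 : ℂ) ρ ∈ nhds z := isOpen_ball.mem_nhds (by simpa using hzρ)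
  have hint' : IntervalIntegrable (fun s : ℝ => (s : ℂ) ^ γ * (deriv g ((s : ℂ) * z) * s))
      MeasureTheory.volume 0 1 :=
    (intervalIntegrable_cpow' hγ).mul_continuousOn ((aux_cont hg' hz).mul (by fun_prop))
  refine (hasDerivAt_integral_of_dominated_loc_of_deriv_le (μ := MeasureTheory.volume)
    (F := fun z (s : ℝ) => (s : ℂ) ^ γ * g ((s : ℂ) * z))
    (F' := fun z (s : ℝ) => (s : ℂ) ^ γ * (deriv g ((s : ℂ) * z) * s))
    (bound := fun s : ℝ => ‖(s : ℂ) ^ γ‖ * M) hnhds ?_ (aux_int hg.continuousOn hγ hz) ?_ ?_ ?_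
    ?_).2
  · filter_upwards [hnhds] with w hw
    have := (aux_int hg.continuousOn hγ (hsub (ball_subset_closedBall hw)))
    exact (intervalIntegrable_iff.1 this).aestronglyMeasurable
  · exact (intervalIntegrable_iff.1 hint').aestronglyMeasurable
  · refine Filter.Eventually.of_forall fun s hs w hw => ?_
    rw [uIoc_of_le zero_le_one] at hs
    have hw1 : ‖w‖ < ρ := by simpa using hw
    have hmem : (s : ℂ) * w ∈ closedBall (0 : ℂ) ρ := by
      simp only [mem_closedBall_zero_iff, norm_mul, Complex.norm_real, Real.norm_eq_abs,
        abs_of_pos hs.1]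
      nlinarith [hs.1, hs.2, norm_nonneg w]
    have h1 := hM _ hmem
    have h2 : ‖(s : ℂ)‖ ≤ 1 := by
      simpa [abs_of_pos hs.1] using hs.2
    rw [norm_mul, norm_mul]
    refine mul_le_mul_of_nonneg_left ?_ (norm_nonneg _)
    calc _ ≤ ‖deriv g (s * w)‖ * 1 := mul_le_mul_of_nonneg_left h2 (norm_nonneg _)
      _ ≤ M := by simpa using h1
  · exact (intervalIntegrable_cpow' hγ).norm.mul_const M
  · refine Filter.Eventually.of_forall fun s hs w hw => ?_
    rw [uIoc_of_le zero_le_one] at hs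
    have hmem := aux_smul_mem (hsub (ball_subset_closedBall hw)) ⟨hs.1.le, hs.2⟩
    have hd : HasDerivAt g (deriv g (s * w)) (s * w) :=
      (hg.differentiableAt (isOpen_ball.mem_nhds hmem)).hasDerivAt
    have hl : HasDerivAt (fun w : ℂ => (s : ℂ) * w) (s : ℂ) w := by
      simpa using (hasDerivAt_id w).const_mul (s : ℂ)
    exact (hd.comp w hl).const_mul _

/-- the integrated differential equation -/
lemma aux_ode {g : ℂ → ℂ} (hg : DifferentiableOn ℂ g (ball (0 : ℂ) 1)) {γ : ℂ}
    (hγ : -1 < γ.re) {z : ℂ} (hz : z ∈ ball (0 : ℂ) 1) :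
    z * (∫ s in (0 : ℝ)..1, (s : ℂ) ^ γ * (deriv g ((s : ℂ) * z) * s)) +
      (1 + γ) * (∫ s in (0 : ℝ)..1, (s : ℂ) ^ γ * g ((s : ℂ) * z)) = g z := by
  have hg' : ContinuousOn (deriv g) (ball (0 : ℂ) 1) := (hg.deriv isOpen_ball).continuousOn
  have hint' : IntervalIntegrable (fun s : ℝ => (s : ℂ) ^ γ * (deriv g ((s : ℂ) * z) * s))
      MeasureTheory.volume 0 1 :=
    (intervalIntegrable_cpow' hγ).mul_continuousOn ((aux_cont hg' hz).mul (by fun_prop))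
  have hint := aux_int hg.continuousOn hγ hz
  have hre : 0 < (γ + 1).re := by simp; linarith
  have hne : γ + 1 ≠ 0 := by
    intro h; rw [h] at hre; simp at hre
  have hc := aux_cont hg.continuousOn hz
  rw [uIcc_of_le zero_le_one] at hc
  have key := integral_eq_sub_of_hasDerivAt_of_le (zero_le_one' ℝ)
    (f := fun s : ℝ => (s : ℂ) ^ (γ + 1) * g ((s : ℂ) * z))
    (f' := fun s : ℝ => z * ((s : ℂ) ^ γ * (deriv g ((s : ℂ) * z) * s)) +
      (1 + γ) * ((s : ℂ) ^ γ * g ((s : ℂ) * z)))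
    ((continuous_ofReal_cpow_const hre).continuousOn.mul hc) ?_
    ((hint'.const_mul z).add (hint.const_mul (1 + γ)))
  · rw [integral_add (hint'.const_mul z) (hint.const_mul (1 + γ)), integral_const_mul,
      integral_const_mul] at key
    rw [key]
    simp [zero_cpow hne]
  · intro s hs
    have hs0 : (s : ℂ) ≠ 0 := by exact_mod_cast hs.1.ne'
    have hmem := aux_smul_mem hz ⟨hs.1.le, hs.2.le⟩
    have hd : HasDerivAt g (deriv g (s * z)) (s * z) :=
      (hg.differentiableAt (isOpen_ball.mem_nhds hmem)).hasDerivAt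
    have hl : HasDerivAt (fun s : ℝ => (s : ℂ) * z) z s := by
      simpa using (Complex.ofRealCLM.hasDerivAt (x := s)).mul_const z
    have h1 := (hasDerivAt_ofReal_cpow_const hs.1.ne' hne).mul (hd.comp s hl)
    refine h1.congr_deriv ?_
    rw [cpow_add _ _ hs0, cpow_one, add_sub_cancel_right]
    simp only [Function.comp]
    ring

/-- Miller-Mocanu type lemma. -/
lemma aux_pos {P : ℂ → ℂ} (hP : DifferentiableOn ℂ P (ball (0 : ℂ) 1)) (hP0 : P 0 = 1)
    {α : ℂ} (hα : 0 ≤ α.re)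
    (h : ∀ z ∈ ball (0 : ℂ) 1, z ≠ 0 → 0 < (P z + α * (z * deriv P z)).re)
    {z : ℂ} (hz : z ∈ ball (0 : ℂ) 1) : 0 < (P z).re := by
  by_contra! hneg
  have hz1 : ‖z‖ < 1 := by simpa using hz
  have hsub : closedBall (0 : ℂ) ‖z‖ ⊆ ball 0 1 := closedBall_subset_ball hz1
  obtain ⟨w, hw, hmin⟩ := (isCompact_closedBall (0 : ℂ) ‖z‖).exists_isMinOn
    ⟨z, by simp⟩ (Complex.continuous_re.comp_continuousOn (hP.continuousOn.mono hsub))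
  have hmin' : ∀ u : ℂ, ‖u‖ ≤ ‖z‖ → (P w).re ≤ (P u).re := fun u hu =>
    hmin (by simpa using hu)
  have hwz : ‖w‖ ≤ ‖z‖ := by simpa using hw
  have hw0 : (P w).re ≤ 0 := (hmin' z le_rfl).trans hneg
  have hwne : w ≠ 0 := by
    rintro rfl
    rw [hP0] at hw0; norm_num at hw0
  have hd : HasDerivAt P (deriv P w) w :=
    (hP.differentiableAt (isOpen_ball.mem_nhds (hsub hw))).hasDerivAt
  -- tangential derivative
  have him : (w * deriv P w).im = 0 := by
    have hl : HasDerivAt (fun t : ℝ => w * Complex.exp (t * I)) (w * I) 0 := by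
      have h1 : HasDerivAt (fun t : ℝ => (t : ℂ) * I) I 0 := by
        simpa using (Complex.ofRealCLM.hasDerivAt (x := 0)).mul_const I
      simpa using (h1.cexp).const_mul w
    have hd' : HasDerivAt P (deriv P w) (w * Complex.exp (((0 : ℝ) : ℂ) * I)) := by simpa using hd
    have h2 := hd'.comp (0 : ℝ) hl
    have h3 := Complex.reCLM.hasFDerivAt.comp_hasDerivAt (0 : ℝ) h2
    have h4 : IsLocalMin (fun t : ℝ => (P (w * Complex.exp (t * I))).re) 0 := by
      refine Filter.Eventually.of_forall fun t => ?_
      simpa using hmin' (w * Complex.exp (t * I)) (by simpa [Complex.norm_exp_ofReal_mul_I] using hwz)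
    have h5 := h4.hasDerivAt_eq_zero h3
    simp at h5
    simp
    linarith
  -- radial derivative
  have hre : (w * deriv P w).re ≤ 0 := by
    have hl : HasDerivAt (fun t : ℝ => w * (1 - (t : ℂ))) (-w) 0 := by
      simpa using ((Complex.ofRealCLM.hasDerivAt (x := 0)).const_sub 1).const_mul w
    have hd' : HasDerivAt P (deriv P w) (w * (1 - ((0 : ℝ) : ℂ))) := by simpa using hd
    have h2 := hd'.comp (0 : ℝ) hl
    have h3 := Complex.reCLM.hasFDerivAt.comp_hasDerivAt (0 : ℝ) h2
    have h4 : 0 ≤ (deriv P w * -w).re := by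
      have h5 := h3.hasDerivWithinAt (s := Ioi 0)
      rw [hasDerivWithinAt_iff_tendsto_slope' (by simp)] at h5
      refine ge_of_tendsto h5 ?_
      filter_upwards [Ioo_mem_nhdsGT (zero_lt_one' ℝ)] with t ht
      have h6 := hmin' (w * (1 - (t : ℂ))) (by
        rw [norm_mul, ← Complex.ofReal_one, ← Complex.ofReal_sub, Complex.norm_real,
          Real.norm_eq_abs, abs_of_nonneg (by linarith [ht.2])]
        nlinarith [ht.1, ht.2, norm_nonneg w])
      rw [slope_def_field]
      refine div_nonneg ?_ (by linarith [ht.1])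
      simpa using h6
    simp at h4 ⊢
    linarith
  have := h w (hsub hw) hwne
  rw [add_re, mul_re, him] at this
  nlinarith [mul_nonneg hα (neg_nonneg.2 hre)]

/-- the Bernardi integral transform
F(z) = (1+γ) ∫₀¹ s^{γ-1} f(sz) ds preserves the class 𝒜_β when Re γ ≥ -1/2.
Here s^{γ-1} is the complex power of the positive real s. -/
theorem bernardi_mem_Abeta (β : ℝ) (hβ : β ∈ Set.Icc (0 : ℝ) 1)
    (γ : ℂ) (hγ : -(1 / 2 : ℝ) ≤ γ.re)
    (f : ℂ → ℂ) (hf : memAb β f) :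
    memAb β (fun z => (1 + γ) * ∫ s in (0 : ℝ)..1, (s : ℂ) ^ (γ - 1) * f ((s : ℂ) * z)) := by
  have hγ1 : -1 < γ.re := by linarith
  have hre : 0 < (1 + γ).re := by simp; linarith
  have hne : 1 + γ ≠ 0 := by
    intro h; rw [h] at hre; simp at hre
  obtain ⟨⟨hfd, hf0, hf1⟩, hfp⟩ := hf
  have h0 : (0 : ℂ) ∈ ball (0 : ℂ) 1 := by simp
  set g := dslope f 0 with hgdef
  have hg : DifferentiableOn ℂ g (ball (0 : ℂ) 1) :=
    (differentiableOn_dslope (isOpen_ball.mem_nhds h0)).2 hfd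
  have hfg : ∀ w, f w = w * g w := fun w => by
    have := sub_smul_dslope f 0 w
    simpa [hf0] using this.symm
  have hg0 : g 0 = 1 := by rw [hgdef, dslope_same, hf1]
  set G : ℂ → ℂ := fun z => (1 + γ) * ∫ s in (0 : ℝ)..1, (s : ℂ) ^ γ * g ((s : ℂ) * z) with hG
  have hFG : (fun z => (1 + γ) * ∫ s in (0 : ℝ)..1, (s : ℂ) ^ (γ - 1) * f ((s : ℂ) * z)) =
      fun z => z * G z := by
    funext z
    have : ∫ s in (0 : ℝ)..1, (s : ℂ) ^ (γ - 1) * f ((s : ℂ) * z) =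
        ∫ s in (0 : ℝ)..1, z * ((s : ℂ) ^ γ * g ((s : ℂ) * z)) := by
      refine integral_congr_ae (Filter.Eventually.of_forall fun s hs => ?_)
      rw [uIoc_of_le zero_le_one] at hs
      have hs0 : (s : ℂ) ≠ 0 := by exact_mod_cast hs.1.ne'
      rw [hfg, cpow_sub _ _ hs0, cpow_one]
      field_simp
    rw [this, integral_const_mul, hG]
    ring
  rw [hFG]
  have hGd : DifferentiableOn ℂ G (ball (0 : ℂ) 1) := fun z hz =>
    ((aux_deriv hg hγ1 hz).const_mul (1 + γ)).differentiableAt.differentiableWithinAt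
  have hG'd : DifferentiableOn ℂ (deriv G) (ball (0 : ℂ) 1) := hGd.deriv isOpen_ball
  have hGat : ∀ z ∈ ball (0 : ℂ) 1, HasDerivAt G (deriv G z) z := fun z hz =>
    (hGd.differentiableAt (isOpen_ball.mem_nhds hz)).hasDerivAt
  have hG'at : ∀ z ∈ ball (0 : ℂ) 1, HasDerivAt (deriv G) (deriv (deriv G) z) z := fun z hz =>
    (hG'd.differentiableAt (isOpen_ball.mem_nhds hz)).hasDerivAt
  have hgat : ∀ z ∈ ball (0 : ℂ) 1, HasDerivAt g (deriv g z) z := fun z hz =>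
    (hg.differentiableAt (isOpen_ball.mem_nhds hz)).hasDerivAt
  have ode : ∀ z ∈ ball (0 : ℂ) 1, z * deriv G z + (1 + γ) * G z = (1 + γ) * g z := by
    intro z hz
    have h1 := ((aux_deriv hg hγ1 hz).const_mul (1 + γ)).deriv
    have h2 := aux_ode hg hγ1 hz
    have h3 : deriv G z = _ := h1
    rw [h3, ← h2]
    simp only [hG]
    ring
  have hG0 : G 0 = 1 := by
    have := ode 0 h0
    rw [hg0] at this
    apply mul_left_cancel₀ hne
    simpa using this
  have ode' : ∀ z ∈ ball (0 : ℂ) 1,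
      z * deriv (deriv G) z + (2 + γ) * deriv G z = (1 + γ) * deriv g z := by
    intro z hz
    have h1 := ((hasDerivAt_id z).mul (hG'at z hz)).add ((hGat z hz).const_mul (1 + γ))
    have h2 := (hgat z hz).const_mul (1 + γ)
    have h3 := h2.congr_of_eventuallyEq (f₁ := fun z => z * deriv G z + (1 + γ) * G z) (by
      filter_upwards [isOpen_ball.mem_nhds hz] with w hw using ode w hw)
    have h4 := h1.unique h3
    simp only [id] at h4
    rw [← h4]
    ring
  have hFat : ∀ z ∈ ball (0 : ℂ) 1, HasDerivAt (fun z => z * G z) (G z + z * deriv G z) z :=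
    fun z hz => by exact ((hasDerivAt_id z).mul (hGat z hz)).congr_deriv (by simp)
  refine ⟨⟨fun z hz => (hFat z hz).differentiableAt.differentiableWithinAt, by simp, ?_⟩, ?_⟩
  · rw [(hFat 0 h0).deriv]; simp [hG0]
  intro z hz hz0
  have hPat : ∀ z ∈ ball (0 : ℂ) 1,
      HasDerivAt (fun z => G z + (1 - (β : ℂ)) * (z * deriv G z))
        (deriv G z + (1 - (β : ℂ)) * (deriv G z + z * deriv (deriv G) z)) z := fun z hz => by
    exact ((hGat z hz).add (((hasDerivAt_id z).mul (hG'at z hz)).const_mul (1 - (β : ℂ)))).congr_deriv (by simp)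
  have main := aux_pos (P := fun z => G z + (1 - (β : ℂ)) * (z * deriv G z))
    (fun z hz => (hPat z hz).differentiableAt.differentiableWithinAt) (by simp [hG0])
    (α := (1 + γ)⁻¹) (by rw [inv_re]; exact div_nonneg hre.le (normSq_nonneg _)) ?_ hz
  · rw [(hFat z hz).deriv]
    convert main using 2
    field_simp
    ring
  · intro w hw hw0
    have h1 := hfp w hw hw0
    have h2 : HasDerivAt f (g w + w * deriv g w) w := by
      rw [funext hfg]
      exact ((hasDerivAt_id w).mul (hgat w hw)).congr_deriv (by simp)
    rw [h2.deriv, hfg w] at h1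
    rw [(hPat w hw).deriv]
    convert h1 using 2
    have e1 := ode w hw
    have e2 := ode' w hw
    apply mul_left_cancel₀ hne
    field_simp
    linear_combination e1 + (1 - (β : ℂ)) * w * e2
end
end

section
/- Let β ∈ [0,1] and let f ∈ 𝒜_β. Then the Alexander transform F(z) = ∫₀¹ f(sz)/s ds (equivalently, the analytic function F on 𝔻 with F(0) = 0 and F'(z) = f(z)/z) belongs to 𝒜_β. -/
open Complex Metric Set intervalIntegral

noncomputable section

/-- the Alexander transform F(z) = ∫₀¹ f(sz)/s ds preserves 𝒜_β. -/
theorem alexander_mem_Abeta (β : ℝ) (hβ : β ∈ Set.Icc (0 : ℝ) 1)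
    (f : ℂ → ℂ) (hf : memAb β f) :
    memAb β (fun z => ∫ s in (0 : ℝ)..1, f ((s : ℂ) * z) / (s : ℂ)) := by
  obtain ⟨⟨hd, h0, h1⟩, hpos⟩ := hf
  have hB : ball (0 : ℂ) 1 ∈ nhds (0 : ℂ) := ball_mem_nhds _ one_pos
  have hg : DifferentiableOn ℂ (dslope f 0) (ball (0 : ℂ) 1) :=
    (Complex.differentiableOn_dslope hB).2 hd
  have hgne : ∀ z : ℂ, z ≠ 0 → dslope f 0 z = f z / z := by
    intro z hz
    rw [dslope_of_ne _ hz, slope_def_field, h0, sub_zero, sub_zero]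
  have hg0 : dslope f 0 0 = 1 := by rw [dslope_same, h1]
  obtain ⟨G, hG0, hG⟩ := hg.isExactOn_ball.with_val_at 0 0
  have hmem : ∀ z ∈ ball (0 : ℂ) 1, ∀ s ∈ Icc (0 : ℝ) 1, (s : ℂ) * z ∈ ball (0 : ℂ) 1 := by
    intro z hz s hs
    rw [mem_ball_zero_iff] at hz ⊢
    rw [norm_mul, Complex.norm_real, Real.norm_of_nonneg hs.1]
    nlinarith [hs.1, hs.2, norm_nonneg z]
  have hlin : ∀ (z : ℂ) (s : ℝ), HasDerivAt (fun t : ℝ => (t : ℂ) * z) z s := by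
    intro z s
    simpa using (Complex.ofRealCLM.hasDerivAt (x := s)).mul_const z
  have hGs : ∀ z ∈ ball (0 : ℂ) 1, ∀ s ∈ Icc (0 : ℝ) 1,
      HasDerivAt (fun t : ℝ => G ((t : ℂ) * z)) (dslope f 0 ((s : ℂ) * z) * z) s := by
    intro z hz s hs
    exact (hG _ (hmem z hz s hs)).comp s (hlin z s)
  have hfs : ∀ z ∈ ball (0 : ℂ) 1, ∀ s ∈ Icc (0 : ℝ) 1,
      HasDerivAt (fun t : ℝ => f ((t : ℂ) * z)) (deriv f ((s : ℂ) * z) * z) s := by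
    intro z hz s hs
    have := (hd.differentiableAt (isOpen_ball.mem_nhds (hmem z hz s hs))).hasDerivAt
    exact this.comp s (hlin z s)
  have hF : EqOn (fun z => ∫ s in (0 : ℝ)..1, f ((s : ℂ) * z) / (s : ℂ)) G (ball (0 : ℂ) 1) := by
    intro z hz
    have e : (∫ s in (0 : ℝ)..1, f ((s : ℂ) * z) / (s : ℂ))
        = ∫ s in (0 : ℝ)..1, dslope f 0 ((s : ℂ) * z) * z := by
      apply integral_congr_Ioo_of_le zero_le_one
      intro s hs
      have hs0 : (s : ℂ) ≠ 0 := by exact_mod_cast hs.1.ne'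
      by_cases hz0 : z = 0
      · simp [hz0, h0]
      · simp only [hgne _ (mul_ne_zero hs0 hz0)]
        field_simp
    have hc : ContinuousOn (fun s : ℝ => dslope f 0 ((s : ℂ) * z) * z) (uIcc (0 : ℝ) 1) := by
      rw [uIcc_of_le zero_le_one]
      refine ContinuousOn.mul ?_ continuousOn_const
      exact hg.continuousOn.comp (by fun_prop) (fun s hs => hmem z hz s hs)
    have := integral_eq_sub_of_hasDerivAt (f := fun t : ℝ => G ((t : ℂ) * z))
      (f' := fun s : ℝ => dslope f 0 ((s : ℂ) * z) * z) (a := 0) (b := 1)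
      (by rw [uIcc_of_le zero_le_one]; exact hGs z hz) hc.intervalIntegrable
    simp only [e, this]
    simp [hG0]
  have hFd : ∀ z ∈ ball (0 : ℂ) 1,
      HasDerivAt (fun z => ∫ s in (0 : ℝ)..1, f ((s : ℂ) * z) / (s : ℂ)) (dslope f 0 z) z := by
    intro z hz
    exact (hG z hz).congr_of_eventuallyEq (hF.eventuallyEq_of_mem (isOpen_ball.mem_nhds hz))
  refine ⟨⟨fun z hz => (hFd z hz).differentiableAt.differentiableWithinAt, ?_, ?_⟩, ?_⟩
  · exact (hF (mem_ball_self one_pos)).trans hG0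
  · rw [(hFd 0 (mem_ball_self one_pos)).deriv, hg0]
  · intro z hz hz0
    rw [(hFd z hz).deriv, hgne z hz0]
    have hFz := hF hz
    simp only at hFz ⊢
    rw [hFz]
    have hD : ∀ s ∈ Icc (0 : ℝ) 1, HasDerivAt
        (fun t : ℝ => ((β : ℂ) * (G ((t : ℂ) * z) / z) + (1 - (β : ℂ)) * (f ((t : ℂ) * z) / z)).re)
        ((β : ℂ) * (dslope f 0 ((s : ℂ) * z)) + (1 - (β : ℂ)) * deriv f ((s : ℂ) * z)).re s := by
      intro s hs
      have h := (((hGs z hz s hs).div_const z).const_mul (β : ℂ)).add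
        (((hfs z hz s hs).div_const z).const_mul (1 - (β : ℂ)))
      rw [mul_div_cancel_right₀ _ hz0, mul_div_cancel_right₀ _ hz0] at h
      exact (Complex.reCLM.hasFDerivAt.comp_hasDerivAt s h)
    have hmono := strictMonoOn_of_deriv_pos (convex_Icc (0 : ℝ) 1)
      (fun s hs => (hD s hs).continuousAt.continuousWithinAt) (by
        intro s hs
        rw [interior_Icc] at hs
        have hs' := Ioo_subset_Icc_self hs
        have hs0 : (s : ℂ) ≠ 0 := by exact_mod_cast hs.1.ne'
        rw [(hD s hs').deriv, hgne _ (mul_ne_zero hs0 hz0)]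
        exact hpos _ (hmem z hz s hs') (mul_ne_zero hs0 hz0))
    have := hmono (left_mem_Icc.2 zero_le_one) (right_mem_Icc.2 zero_le_one) zero_lt_one
    simpa only [Complex.ofReal_zero, Complex.ofReal_one, zero_mul, one_mul, hG0, h0, zero_div,
      mul_zero, add_zero, Complex.zero_re] using this
end
end

section
/- Let β ∈ [0,1] and let f ∈ 𝒜_β. Then the Libera-type transform F(z) = 2 ∫₀¹ f(sz) ds (equivalently, F(z) = (2/z) ∫₀^z f(t) dt) belongs to 𝒜_β. -/
open Complex Metric Set intervalIntegral

noncomputable section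

theorem libera_hasDerivAt (f : ℂ → ℂ) (hf : DifferentiableOn ℂ f (ball (0 : ℂ) 1))
    (z : ℂ) (hz : z ∈ ball (0 : ℂ) 1) :
    IntervalIntegrable (fun s : ℝ => (s : ℂ) * deriv f ((s : ℂ) * z)) MeasureTheory.volume 0 1 ∧
    HasDerivAt (fun z => ∫ s in (0 : ℝ)..1, f ((s : ℂ) * z))
      (∫ s in (0 : ℝ)..1, (s : ℂ) * deriv f ((s : ℂ) * z)) z := by
  have hz' : ‖z‖ < 1 := by simpa using hz
  obtain ⟨r, hzr, hr1⟩ := exists_between hz'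
  have hd : ContinuousOn (deriv f) (ball (0 : ℂ) 1) := (hf.deriv isOpen_ball).continuousOn
  obtain ⟨C, hC⟩ := (isCompact_closedBall (0 : ℂ) r).exists_bound_of_continuousOn
    (hd.mono (closedBall_subset_ball hr1))
  have hmul : ∀ w : ℂ, ‖w‖ < r → ∀ s : ℝ, s ∈ Icc (0 : ℝ) 1 → ‖(s : ℂ) * w‖ < r := by
    intro w hw s hs
    rw [norm_mul, Complex.norm_real, Real.norm_of_nonneg hs.1]
    nlinarith [norm_nonneg w, hs.1, hs.2]
  have hmaps : ∀ w : ℂ, ‖w‖ < r →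
      MapsTo (fun s : ℝ => (s : ℂ) * w) (Icc (0 : ℝ) 1) (ball (0 : ℂ) 1) := by
    intro w hw s hs
    have := hmul w hw s hs
    simp only [mem_ball_zero_iff]
    linarith
  have hlin : ∀ w : ℂ, ContinuousOn (fun s : ℝ => (s : ℂ) * w) (Icc (0 : ℝ) 1) := by
    intro w
    fun_prop
  have hcf : ∀ w : ℂ, ‖w‖ < r →
      IntervalIntegrable (fun s : ℝ => f ((s : ℂ) * w)) MeasureTheory.volume 0 1 := by
    intro w hw
    apply ContinuousOn.intervalIntegrable
    rw [uIcc_of_le zero_le_one]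
    exact hf.continuousOn.comp (hlin w) (hmaps w hw)
  have hcd : IntervalIntegrable (fun s : ℝ => (s : ℂ) * deriv f ((s : ℂ) * z))
      MeasureTheory.volume 0 1 := by
    apply ContinuousOn.intervalIntegrable
    rw [uIcc_of_le zero_le_one]
    exact (Complex.continuous_ofReal.continuousOn).mul (hd.comp (hlin z) (hmaps z hzr))
  have hnhds : ball (0 : ℂ) r ∈ nhds z := isOpen_ball.mem_nhds (by simpa using hzr)
  refine ⟨hcd, ?_⟩
  refine (intervalIntegral.hasDerivAt_integral_of_dominated_loc_of_deriv_le
    (F := fun w (s : ℝ) => f ((s : ℂ) * w)) (F' := fun w (s : ℝ) => (s : ℂ) * deriv f ((s : ℂ) * w))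
    (bound := fun _ => C) hnhds ?_ (hcf z hzr) ?_ ?_ ?_ ?_).2
  · filter_upwards [hnhds] with w hw
    have := (hcf w (by simpa using hw)).def'.aestronglyMeasurable
    exact this
  · exact hcd.def'.aestronglyMeasurable
  · refine Filter.Eventually.of_forall fun s hs w hw => ?_
    rw [uIoc_of_le zero_le_one] at hs
    have hs' : s ∈ Icc (0 : ℝ) 1 := ⟨hs.1.le, hs.2⟩
    have h1 := hC ((s : ℂ) * w) (by simpa using (hmul w (by simpa using hw) s hs').le)
    rw [norm_mul, Complex.norm_real, Real.norm_of_nonneg hs'.1]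
    nlinarith [norm_nonneg (deriv f ((s : ℂ) * w)), hs'.1, hs'.2]
  · exact intervalIntegrable_const
  · refine Filter.Eventually.of_forall fun s hs w hw => ?_
    rw [uIoc_of_le zero_le_one] at hs
    have hs' : s ∈ Icc (0 : ℝ) 1 := ⟨hs.1.le, hs.2⟩
    have h1 := hmaps w (by simpa using hw) hs'
    have h2 : HasDerivAt f (deriv f ((s : ℂ) * w)) ((s : ℂ) * w) :=
      (hf.differentiableAt (isOpen_ball.mem_nhds h1)).hasDerivAt
    have h3 : HasDerivAt (fun w : ℂ => (s : ℂ) * w) (s : ℂ) w := by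
      simpa using (hasDerivAt_id w).const_mul (s : ℂ)
    have h4 := HasDerivAt.comp w h2 h3
    rw [mul_comm]
    exact h4

/-- the Libera-type transform F(z) = 2∫₀¹ f(sz) ds preserves 𝒜_β. -/
theorem libera_mem_Abeta (β : ℝ) (hβ : β ∈ Set.Icc (0 : ℝ) 1)
    (f : ℂ → ℂ) (hf : memAb β f) :
    memAb β (fun z => 2 * ∫ s in (0 : ℝ)..1, f ((s : ℂ) * z)) := by
  obtain ⟨⟨hd, h0, h1⟩, hpos⟩ := hf
  have hD : ∀ z ∈ ball (0 : ℂ) 1, HasDerivAt (fun z => 2 * ∫ s in (0 : ℝ)..1, f ((s : ℂ) * z))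
      (2 * ∫ s in (0 : ℝ)..1, (s : ℂ) * deriv f ((s : ℂ) * z)) z :=
    fun z hz => (libera_hasDerivAt f hd z hz).2.const_mul 2
  refine ⟨⟨fun z hz => (hD z hz).differentiableAt.differentiableWithinAt, by simp [h0], ?_⟩, ?_⟩
  · rw [(hD 0 (by simp)).deriv]
    simp only [mul_zero, h1, mul_one]
    rw [intervalIntegral.integral_ofReal, integral_id]
    norm_num
  · intro z hz hz0
    rw [(hD z hz).deriv]
    have hz' : ‖z‖ < 1 := by simpa using hz
    have hmaps : MapsTo (fun s : ℝ => (s : ℂ) * z) (Icc (0 : ℝ) 1) (ball (0 : ℂ) 1) := by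
      intro s hs
      simp only [mem_ball_zero_iff]
      rw [norm_mul, Complex.norm_real, Real.norm_of_nonneg hs.1]
      nlinarith [norm_nonneg z, hs.1, hs.2]
    have hi1 := (libera_hasDerivAt f hd z hz).1
    have hi2 : IntervalIntegrable (fun s : ℝ => f ((s : ℂ) * z)) MeasureTheory.volume 0 1 := by
      apply ContinuousOn.intervalIntegrable
      rw [uIcc_of_le zero_le_one]
      exact hd.continuousOn.comp (by fun_prop) hmaps
    have hi3 := hi2.const_mul ((β : ℂ) * 2 / z)
    have hi4 := hi1.const_mul ((1 - (β : ℂ)) * 2)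
    have hi := hi3.add hi4
    have e : (β : ℂ) * ((2 * ∫ s in (0 : ℝ)..1, f ((s : ℂ) * z)) / z) +
        (1 - (β : ℂ)) * (2 * ∫ s in (0 : ℝ)..1, (s : ℂ) * deriv f ((s : ℂ) * z)) =
        ∫ s in (0 : ℝ)..1, ((β : ℂ) * 2 / z * f ((s : ℂ) * z) +
          (1 - (β : ℂ)) * 2 * ((s : ℂ) * deriv f ((s : ℂ) * z))) := by
      rw [intervalIntegral.integral_add hi3 hi4, intervalIntegral.integral_const_mul,
        intervalIntegral.integral_const_mul]
      ring
    show 0 < ((β : ℂ) * ((2 * ∫ s in (0 : ℝ)..1, f ((s : ℂ) * z)) / z) +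
        (1 - (β : ℂ)) * (2 * ∫ s in (0 : ℝ)..1, (s : ℂ) * deriv f ((s : ℂ) * z))).re
    rw [e]
    have hre := Complex.reCLM.intervalIntegral_comp_comm hi
    simp only [Complex.reCLM_apply] at hre
    refine lt_of_lt_of_eq ?_ hre
    apply intervalIntegral.intervalIntegral_pos_of_pos_on
    · exact ⟨hi.1.re, hi.2.re⟩
    · intro s hs
      have hs0 : (s : ℂ) ≠ 0 := by exact_mod_cast hs.1.ne'
      have hp := hpos ((s : ℂ) * z) (hmaps ⟨hs.1.le, hs.2.le⟩) (mul_ne_zero hs0 hz0)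
      have e2 : (β : ℂ) * 2 / z * f ((s : ℂ) * z) +
          (1 - (β : ℂ)) * 2 * ((s : ℂ) * deriv f ((s : ℂ) * z)) =
          ((2 * s : ℝ) : ℂ) * ((β : ℂ) * (f ((s : ℂ) * z) / ((s : ℂ) * z)) +
            (1 - (β : ℂ)) * deriv f ((s : ℂ) * z)) := by
        push_cast
        field_simp
      show 0 < ((β : ℂ) * 2 / z * f ((s : ℂ) * z) +
          (1 - (β : ℂ)) * 2 * ((s : ℂ) * deriv f ((s : ℂ) * z))).re
      rw [e2, Complex.re_ofReal_mul]
      have := hs.1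
      positivity
    · exact zero_lt_one
end
end

section
/- Let β ∈ [0,1], let f ∈ 𝒜_β, and let x ∈ ℂ with |x| ≤ 1 and x ≠ 1. Then the function F(z) = ∫₀¹ (f(sz) − f(xsz)) / ((1−x)s) ds (equivalently, F(z) = ∫₀^z (f(t) − f(xt))/(t − xt) dt) belongs to 𝒜_β. -/
open Complex Metric Set intervalIntegral

noncomputable section

/-- Noshiro–Warschawski: if the derivative has positive real part, so do difference quotients. -/
theorem re_slope_pos (S S' : ℂ → ℂ) (hS : ∀ w ∈ ball (0 : ℂ) 1, HasDerivAt S (S' w) w)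
    (hpos : ∀ w ∈ ball (0 : ℂ) 1, 0 < (S' w).re)
    (a b : ℂ) (ha : a ∈ ball (0 : ℂ) 1) (hb : b ∈ ball (0 : ℂ) 1) (hab : a ≠ b) :
    0 < ((S b - S a) / (b - a)).re := by
  have hne : b - a ≠ 0 := sub_ne_zero.2 hab.symm
  have hmem : ∀ t ∈ Icc (0 : ℝ) 1, a + (t : ℂ) * (b - a) ∈ ball (0 : ℂ) 1 := by
    intro t ht
    have := (convex_ball (0 : ℂ) 1).add_smul_sub_mem ha hb ht
    simpa using this
  have hd : ∀ t ∈ Icc (0 : ℝ) 1,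
      HasDerivAt (fun t : ℝ => (S (a + (t : ℂ) * (b - a)) / (b - a)).re)
        (S' (a + (t : ℂ) * (b - a))).re t := by
    intro t ht
    have h1 : HasDerivAt (fun w : ℂ => a + w * (b - a)) (b - a) (t : ℂ) := by
      simpa using ((hasDerivAt_id (t : ℂ)).mul_const (b - a)).const_add a
    have h2 := ((hS _ (hmem t ht)).comp (t : ℂ) h1).div_const (b - a)
    have h3 := h2.real_of_complex
    rw [mul_div_cancel_right₀ _ hne] at h3
    exact h3
  obtain ⟨c, hc, hc'⟩ := exists_hasDerivAt_eq_slope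
    (fun t : ℝ => (S (a + (t : ℂ) * (b - a)) / (b - a)).re)
    (fun t : ℝ => (S' (a + (t : ℂ) * (b - a))).re) zero_lt_one
    (fun t ht => (hd t ht).continuousAt.continuousWithinAt)
    (fun t ht => hd t (Ioo_subset_Icc_self ht))
  have h := hpos _ (hmem c (Ioo_subset_Icc_self hc))
  have e : (S' (a + (c : ℂ) * (b - a))).re = ((S b - S a) / (b - a)).re := by
    rw [hc', sub_div (S b), Complex.sub_re]; simp
  rwa [e] at h

/-- for |x| ≤ 1, x ≠ 1, the transform
F(z) = ∫₀¹ (f(sz) - f(xsz)) / ((1-x)s) ds preserves 𝒜_β. -/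
theorem difference_transform_mem_Abeta (β : ℝ) (hβ : β ∈ Set.Icc (0 : ℝ) 1)
    (x : ℂ) (hx : ‖x‖ ≤ 1) (hx1 : x ≠ 1)
    (f : ℂ → ℂ) (hf : memAb β f) :
    memAb β (fun z =>
      ∫ s in (0 : ℝ)..1, (f ((s : ℂ) * z) - f (x * ((s : ℂ) * z))) / ((1 - x) * (s : ℂ))) := by
  obtain ⟨⟨hfd, hf0, hf1⟩, hre⟩ := hf
  have hB : ball (0 : ℂ) 1 ∈ nhds (0 : ℂ) := ball_mem_nhds _ one_pos
  have hx' : (1 : ℂ) - x ≠ 0 := sub_ne_zero.2 hx1.symm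
  obtain ⟨q, hqdef⟩ : ∃ q, q = dslope f 0 := ⟨_, rfl⟩
  have hqd : DifferentiableOn ℂ q (ball 0 1) := by
    rw [hqdef]; exact (differentiableOn_dslope hB).2 hfd
  have hwq : ∀ w, w * q w = f w := by
    intro w
    have := sub_smul_dslope f 0 w
    rw [hqdef]; simpa [hf0] using this
  have hq0 : q 0 = 1 := by rw [hqdef, dslope_same, hf1]
  obtain ⟨Q, hQ⟩ := hqd.isExactOn_ball
  have hxmem : ∀ w ∈ ball (0 : ℂ) 1, x * w ∈ ball (0 : ℂ) 1 := by
    intro w hw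
    simp only [mem_ball_zero_iff, norm_mul] at hw ⊢
    nlinarith [norm_nonneg w, norm_nonneg x]
  obtain ⟨k, hk⟩ : ∃ k : ℂ → ℂ, k = fun w => (q w - x * q (x * w)) / (1 - x) := ⟨_, rfl⟩
  obtain ⟨R, hR⟩ : ∃ R : ℂ → ℂ, R = fun w => (Q w - Q (x * w)) / (1 - x) := ⟨_, rfl⟩
  have hRd : ∀ w ∈ ball (0 : ℂ) 1, HasDerivAt R (k w) w := by
    intro w hw
    have h1 : HasDerivAt (fun w : ℂ => x * w) x w := by
      simpa using (hasDerivAt_id w).const_mul x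
    have h2 := ((hQ w hw).sub ((hQ _ (hxmem w hw)).comp w h1)).div_const (1 - x)
    rw [hR, hk]
    rw [mul_comm (q (x * w)) x] at h2
    exact h2
  have hkc : ContinuousOn k (ball 0 1) := by
    rw [hk]
    refine ContinuousOn.div_const (hqd.continuousOn.sub (continuousOn_const.mul ?_)) _
    exact hqd.continuousOn.comp (by fun_prop) hxmem
  have hR0 : R 0 = 0 := by rw [hR]; simp
  have hF : ∀ z ∈ ball (0 : ℂ) 1, (∫ s in (0 : ℝ)..1,
      (f ((s : ℂ) * z) - f (x * ((s : ℂ) * z))) / ((1 - x) * (s : ℂ))) = R z := by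
    intro z hz
    have hsm : ∀ s ∈ Icc (0 : ℝ) 1, (s : ℂ) * z ∈ ball (0 : ℂ) 1 := by
      intro s hs
      simp only [mem_ball_zero_iff, norm_mul, Complex.norm_real, Real.norm_eq_abs,
        abs_of_nonneg hs.1] at hz ⊢
      nlinarith [norm_nonneg z, hs.1, hs.2]
    have hI : (∫ s in (0 : ℝ)..1, k ((s : ℂ) * z) * z)
        = R (((1 : ℝ) : ℂ) * z) - R (((0 : ℝ) : ℂ) * z) := by
      refine integral_eq_sub_of_hasDerivAt (f := fun s : ℝ => R ((s : ℂ) * z)) ?_ ?_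
      · intro s hs
        rw [uIcc_of_le zero_le_one] at hs
        have h1 : HasDerivAt (fun w : ℂ => w * z) z (s : ℂ) := by
          simpa using (hasDerivAt_id (s : ℂ)).mul_const z
        exact ((hRd _ (hsm s hs)).comp (s : ℂ) h1).comp_ofReal
      · refine ContinuousOn.intervalIntegrable ?_
        rw [uIcc_of_le zero_le_one]
        refine ContinuousOn.mul (hkc.comp (by fun_prop) hsm) continuousOn_const
    have hI2 : (∫ s in (0 : ℝ)..1,
        (f ((s : ℂ) * z) - f (x * ((s : ℂ) * z))) / ((1 - x) * (s : ℂ)))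
        = ∫ s in (0 : ℝ)..1, k ((s : ℂ) * z) * z := by
      refine integral_congr_uIoo ?_
      intro s hs
      rw [uIoo_of_le zero_le_one] at hs
      have hs0 : (s : ℂ) ≠ 0 := by exact_mod_cast hs.1.ne'
      simp only [hk]
      rw [← hwq, ← hwq (x * _)]
      field_simp
    rw [hI2, hI]
    simp [hR0]
  have hev : ∀ z ∈ ball (0 : ℂ) 1, HasDerivAt (fun z => ∫ s in (0 : ℝ)..1,
      (f ((s : ℂ) * z) - f (x * ((s : ℂ) * z))) / ((1 - x) * (s : ℂ))) (k z) z := by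
    intro z hz
    refine (hRd z hz).congr_of_eventuallyEq ?_
    filter_upwards [isOpen_ball.mem_nhds hz] with w hw using hF w hw
  have h0 : (0 : ℂ) ∈ ball (0 : ℂ) 1 := mem_ball_self one_pos
  refine ⟨⟨fun z hz => (hev z hz).differentiableAt.differentiableWithinAt, ?_, ?_⟩, ?_⟩
  · exact (hF 0 h0).trans hR0
  · rw [(hev 0 h0).deriv, hk]
    simp [hq0, hx']
  · intro z hz hz0
    rw [(hev z hz).deriv]
    simp only [hF z hz]
    have key := re_slope_pos (fun w => (β : ℂ) * Q w + (1 - (β : ℂ)) * f w)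
      (fun w => (β : ℂ) * q w + (1 - (β : ℂ)) * deriv f w)
      (fun w hw => ((hQ w hw).const_mul _).add
        ((hfd.differentiableAt (isOpen_ball.mem_nhds hw)).hasDerivAt.const_mul _))
      (by
        intro w hw
        by_cases hw0 : w = 0
        · subst hw0
          simp [hq0, hf1]
        · have := hre w hw hw0
          rwa [← hwq w, mul_div_cancel_left₀ _ hw0] at this)
      (x * z) z (hxmem z hz) hz
      (fun h => hx1 (mul_right_cancel₀ hz0 (by rw [h, one_mul])))
    have hd : z - x * z = (1 - x) * z := by ring
    convert key using 2
    simp only [hR, hk]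
    rw [← hwq z, ← hwq (x * z), hd]
    field_simp
    ring
end
end

section
/- Let Ψ be analytic on 𝔻 with Ψ(0) = 0, injective on 𝔻, and with Ψ(𝔻) a convex set. Let f ∈ 𝒜 satisfy f(z) ≠ 0 for all z ∈ 𝔻 \ {0}, and suppose z f'(z)/f(z) − 1 ≺ Ψ(z). Then f(z)/z ≺ exp(∫₀^z Ψ(t)/t dt), where f(z)/z is understood as 1 at z = 0 and Ψ(t)/t is extended analytically by the value Ψ'(0) at t = 0. -/
open Complex Metric Set intervalIntegral

noncomputable section

/-- Subordination of analytic functions on the unit disk: g ≺ h iff there is an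
analytic self-map ω of 𝔻 with ω(0) = 0 and g = h ∘ ω on 𝔻. -/
def subordinate (g h : ℂ → ℂ) : Prop :=
  ∃ ω : ℂ → ℂ, DifferentiableOn ℂ ω (ball (0 : ℂ) 1) ∧ ω 0 = 0 ∧
    (∀ z ∈ ball (0 : ℂ) 1, ω z ∈ ball (0 : ℂ) 1) ∧
    ∀ z ∈ ball (0 : ℂ) 1, g z = h (ω z)

open Filter Topology

lemma inv_exists (F : ℂ → ℂ) (hd : DifferentiableOn ℂ F (ball (0 : ℂ) 1))
    (hinj : Set.InjOn F (ball (0 : ℂ) 1)) :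
    IsOpen (F '' ball (0 : ℂ) 1) ∧ ∃ G : ℂ → ℂ, DifferentiableOn ℂ G (F '' ball (0 : ℂ) 1) ∧
      ∀ z ∈ ball (0 : ℂ) 1, G (F z) = z := by
  have han : AnalyticOnNhd ℂ F (ball (0 : ℂ) 1) := hd.analyticOnNhd isOpen_ball
  have hopen : ∀ s ⊆ ball (0 : ℂ) 1, IsOpen s → IsOpen (F '' s) := by
    rcases han.is_constant_or_isOpen (convex_ball (0 : ℂ) 1).isPreconnected with ⟨w, hw⟩ | h
    · exfalso
      have h0 : (0 : ℂ) ∈ ball (0 : ℂ) 1 := by simp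
      have h1 : (1/2 : ℂ) ∈ ball (0 : ℂ) 1 := by simp; norm_num
      have := hinj h0 h1 ((hw _ h0).trans (hw _ h1).symm)
      norm_num at this
    · exact h
  have hO := hopen _ subset_rfl isOpen_ball
  refine ⟨hO, Function.invFunOn F (ball (0 : ℂ) 1), ?_, fun z hz => hinj.leftInvOn_invFunOn hz⟩
  set G := Function.invFunOn F (ball (0 : ℂ) 1) with hG
  have hGF : ∀ z ∈ ball (0 : ℂ) 1, G (F z) = z := fun z hz => hinj.leftInvOn_invFunOn hz
  have hcont : ∀ z ∈ ball (0 : ℂ) 1, ContinuousAt G (F z) := by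
    intro z hz
    rw [ContinuousAt, hGF z hz]
    intro N hN
    obtain ⟨V, hVN, hVo, hzV⟩ := _root_.mem_nhds_iff.1 hN
    have : F '' (V ∩ ball (0 : ℂ) 1) ∈ 𝓝 (F z) :=
      (hopen _ inter_subset_right (hVo.inter isOpen_ball)).mem_nhds ⟨z, ⟨hzV, hz⟩, rfl⟩
    refine Filter.mem_map.2 (mem_of_superset this ?_)
    rintro _ ⟨w, ⟨hwV, hw⟩, rfl⟩
    simp only [mem_preimage, hGF w hw]
    exact hVN hwV
  have hright : ∀ u ∈ F '' ball (0 : ℂ) 1, G u ∈ ball (0 : ℂ) 1 ∧ F (G u) = u := by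
    rintro _ ⟨w, hw, rfl⟩
    rw [hGF w hw]; exact ⟨hw, rfl⟩
  rintro _ ⟨z, hz, rfl⟩
  apply DifferentiableAt.differentiableWithinAt
  refine (analyticAt_of_differentiable_on_punctured_nhds_of_continuousAt ?_
    (hcont z hz)).differentiableAt
  have hne : ∀ᶠ w in 𝓝[≠] z, deriv F w ≠ 0 := by
    rcases (han z hz).deriv.eventually_eq_zero_or_eventually_ne_zero with h | h
    · exfalso
      obtain ⟨ε, hε, hb⟩ := Metric.mem_nhds_iff.1 (inter_mem h (isOpen_ball.mem_nhds hz))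
      have hc : ∀ x ∈ ball z ε, ∀ y ∈ ball z ε, F x = F y := fun x hx y hy =>
        isOpen_ball.is_const_of_deriv_eq_zero (convex_ball z ε).isPreconnected
        (hd.mono fun w hw => (hb hw).2) (fun w hw => (hb hw).1) hx hy
      have h1 : z ∈ ball z ε := mem_ball_self hε
      have h2 : z + (ε / 2 : ℝ) ∈ ball z ε := by
        simp [abs_of_pos hε, hε]
      have := hinj (hb h1).2 (hb h2).2 (hc _ h1 _ h2)
      have h3 : ((ε / 2 : ℝ) : ℂ) = 0 := by simpa using this
      have : ε / 2 = 0 := by exact_mod_cast h3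
      linarith
    · exact h
  have htend : Tendsto G (𝓝[≠] (F z)) (𝓝[≠] z) := by
    refine tendsto_nhdsWithin_iff.2 ⟨?_, ?_⟩
    · have := hcont z hz
      rw [ContinuousAt, hGF z hz] at this
      exact this.mono_left nhdsWithin_le_nhds
    · filter_upwards [self_mem_nhdsWithin,
        mem_nhdsWithin_of_mem_nhds (hO.mem_nhds ⟨z, hz, rfl⟩)] with u hu hu' h
      apply hu
      rw [mem_singleton_iff] at h ⊢
      rw [← (hright u hu').2, h]
  filter_upwards [htend.eventually hne,
    mem_nhdsWithin_of_mem_nhds (hO.mem_nhds ⟨z, hz, rfl⟩)] with u hu hu'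
  obtain ⟨w, hw, rfl⟩ := hu'
  have hD : HasDerivAt G (deriv F (G (F w)))⁻¹ (F w) := by
    refine HasDerivAt.of_local_left_inverse (f := F) (hcont w hw) ?_ hu ?_
    · rw [hGF w hw]; exact (han w hw).differentiableAt.hasDerivAt
    · filter_upwards [hO.mem_nhds ⟨w, hw, rfl⟩] with y hy using (hright y hy).2
  exact hD.differentiableAt

/-- One-sided derivative of a function with modulus at most one. -/
lemma re_deriv_nonpos (h : ℝ → ℂ) (h' : ℂ) (hh : HasDerivAt h h' 0) (h0 : h 0 = 1)
    (hle : ∀ᶠ t in 𝓝[>] (0 : ℝ), ‖h t‖ ≤ 1) : h'.re ≤ 0 := by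
  have h1 : HasDerivAt (fun t => (h t).re) h'.re 0 := by
    have := (Complex.reCLM.hasFDerivAt (x := h 0)).comp_hasDerivAt (0 : ℝ) hh
    exact this
  have h2 := (hasDerivWithinAt_iff_tendsto_slope' (s := Ioi (0:ℝ)) (by simp)).1 h1.hasDerivWithinAt
  refine le_of_tendsto h2 ?_
  filter_upwards [hle, self_mem_nhdsWithin] with t ht ht0
  have ht0 : 0 < t := ht0
  rw [slope_def_field, h0]
  have := Complex.re_le_norm (h t)
  apply div_nonpos_of_nonpos_of_nonneg
  · simp; linarith
  · linarith

/-- Noshiro-Warschawski -/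
lemma noshiro (g g' : ℂ → ℂ) (Ω : Set ℂ) (hconv : Convex ℝ Ω)
    (hg : ∀ u ∈ Ω, HasDerivAt g (g' u) u) (hpos : ∀ u ∈ Ω, 0 < (g' u).re) : InjOn g Ω := by
  intro a ha b hb hab
  by_contra hne
  have hsub : ∀ t ∈ Icc (0 : ℝ) 1, a + t * (b - a) ∈ Ω := by
    intro t ht
    have := hconv.add_smul_sub_mem ha hb ht
    simpa using this
  have hder : ∀ t ∈ Icc (0 : ℝ) 1, HasDerivAt (fun t : ℝ => (g (a + t * (b - a)) / (b - a)).re)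
      ((g' (a + t * (b - a))).re) t := by
    intro t ht
    have h1 : HasDerivAt (fun t : ℝ => a + t * (b - a)) (b - a) t := by
      have := ((Complex.ofRealCLM.hasDerivAt (x := t)).mul_const (b - a)).const_add a
      simpa using this
    have h2 := ((hg _ (hsub t ht)).comp t h1).div_const (b - a)
    have h3 := (Complex.reCLM.hasFDerivAt
      (x := (g ∘ fun t : ℝ => a + t * (b - a)) t / (b - a))).comp_hasDerivAt t h2
    rw [mul_div_cancel_right₀ _ (sub_ne_zero.2 (Ne.symm hne))] at h3
    exact h3
  obtain ⟨c, hc, hc'⟩ := exists_hasDerivAt_eq_zero (a := (0:ℝ)) (b := 1)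
    (f := (fun t : ℝ => (g (a + t * (b - a)) / (b - a)).re)) one_pos
    (fun t ht => (hder t ht).continuousAt.continuousWithinAt) (by simp [hab])
    (fun t ht => hder t (Ioo_subset_Icc_self ht))
  have := hpos _ (hsub c (Ioo_subset_Icc_self hc))
  linarith

/-- Nonnegative real part plus positivity at one point gives positivity. -/
lemma re_pos_of_nonneg (q : ℂ → ℂ) (Ω : Set ℂ) (hΩ : IsOpen Ω) (hc : IsPreconnected Ω)
    (hq : DifferentiableOn ℂ q Ω) (h0 : ∀ u ∈ Ω, 0 ≤ (q u).re) (a : ℂ) (ha : a ∈ Ω)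
    (hqa : 0 < (q a).re) : ∀ u ∈ Ω, 0 < (q u).re := by
  intro u hu
  rcases (hq.analyticOnNhd hΩ).is_constant_or_isOpen hc with ⟨w, hw⟩ | h
  · rw [hw u hu, ← hw a ha]; exact hqa
  · obtain ⟨ε, hε, hb⟩ := Metric.isOpen_iff.1 (h Ω subset_rfl hΩ) (q u) ⟨u, hu, rfl⟩
    have : q u - (ε / 2 : ℝ) ∈ ball (q u) ε := by
      simp [abs_of_pos hε, hε]
    obtain ⟨v, hv, hv'⟩ := hb this
    have := h0 v hv
    rw [hv', Complex.sub_re, Complex.ofReal_re] at this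
    linarith

lemma jack (ω : ℂ → ℂ) (r : ℝ) (hω : DifferentiableOn ℂ ω (ball (0 : ℂ) r)) (h0 : ω 0 = 0)
    (z1 : ℂ) (hz1 : z1 ∈ ball (0 : ℂ) r) (hlt : ‖z1‖ < ‖ω z1‖) :
    ∃ z0 ∈ ball (0 : ℂ) r, z0 ≠ 0 ∧ ‖z0‖ < ‖ω z0‖ ∧
      ∃ k : ℝ, 1 ≤ k ∧ z0 * deriv ω z0 = k * ω z0 := by
  have hz1ne : z1 ≠ 0 := by
    rintro rfl
    simp [h0] at hlt
  have hρ : 0 < ‖z1‖ := norm_pos_iff.2 hz1ne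
  have hr : ‖z1‖ < r := by simpa using hz1
  have hr0 : 0 < r := hρ.trans hr
  set χ := dslope ω 0 with hχ
  have hχd : DifferentiableOn ℂ χ (ball (0 : ℂ) r) :=
    (differentiableOn_dslope (isOpen_ball.mem_nhds (mem_ball_self hr0))).2 hω
  have hωχ : ∀ z, ω z = z * χ z := by
    intro z
    have := sub_smul_dslope ω 0 z
    simp [h0] at this
    exact this.symm
  have hcl : closure (ball (0 : ℂ) ‖z1‖) = closedBall 0 ‖z1‖ := closure_ball _ hρ.ne'
  have hdc : DiffContOnCl ℂ χ (ball (0 : ℂ) ‖z1‖) := by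
    apply DifferentiableOn.diffContOnCl
    rw [hcl]
    exact hχd.mono (closedBall_subset_ball hr)
  obtain ⟨z0, hz0f, hmax⟩ := Complex.exists_mem_frontier_isMaxOn_norm isBounded_ball
    ⟨0, mem_ball_self hρ⟩ hdc
  rw [frontier_ball _ hρ.ne', mem_sphere_zero_iff_norm] at hz0f
  rw [hcl] at hmax
  have hmax' : ∀ z, ‖z‖ ≤ ‖z1‖ → ‖χ z‖ ≤ ‖χ z0‖ := fun z hz =>
    hmax (by simpa using hz)
  have hz0 : z0 ∈ ball (0 : ℂ) r := by simp [hz0f, hr]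
  have hz0ne : z0 ≠ 0 := by rw [← norm_pos_iff, hz0f]; exact hρ
  have h1 : 1 < ‖χ z0‖ := by
    refine lt_of_lt_of_le ?_ (hmax' z1 le_rfl)
    rw [hωχ z1, norm_mul] at hlt
    by_contra! hc
    nlinarith
  have hχne : χ z0 ≠ 0 := by
    rw [← norm_pos_iff]; linarith
  have hχa : HasDerivAt χ (deriv χ z0) z0 :=
    (hχd.differentiableAt (isOpen_ball.mem_nhds hz0)).hasDerivAt
  set c := z0 * deriv χ z0 / χ z0 with hc
  have key : ∀ v : ℂ, v.re ≤ 0 → (c * v).re ≤ 0 := by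
    intro v hv
    refine re_deriv_nonpos (fun t : ℝ => χ (Complex.exp (t * v) * z0) / χ z0) _ ?_ ?_ ?_
    · have e1 : HasDerivAt (fun t : ℝ => Complex.exp (t * v) * z0) (v * z0) 0 := by
        have := ((Complex.ofRealCLM.hasDerivAt (x := (0:ℝ))).mul_const v).cexp.mul_const z0
        simpa using this
      have e2 : HasDerivAt χ (deriv χ z0) (Complex.exp ((0 : ℝ) * v) * z0) := by
        simpa using hχa
      have := (e2.comp (0 : ℝ) e1).div_const (χ z0)
      have e3 : c * v = deriv χ z0 * (v * z0) / χ z0 := by rw [hc]; ring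
      rw [e3]
      exact this
    · simp [hχne]
    · filter_upwards [self_mem_nhdsWithin] with t ht
      have ht : 0 < t := ht
      rw [norm_div, div_le_one (norm_pos_iff.2 hχne)]
      apply hmax'
      rw [norm_mul, Complex.norm_exp, hz0f]
      have : Real.exp ((t * v : ℂ).re) ≤ 1 := by
        rw [Real.exp_le_one_iff]
        simp
        nlinarith
      nlinarith
  have k1 := key Complex.I (by simp)
  have k2 := key (-Complex.I) (by simp)
  have k3 := key (-1) (by simp)
  simp at k1 k2 k3
  have hcr : c = (c.re : ℂ) := by
    apply Complex.ext <;> simp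
    linarith
  refine ⟨z0, hz0, hz0ne, ?_, 1 + c.re, by linarith, ?_⟩
  · rw [hωχ z0, norm_mul]
    have := norm_pos_iff.2 hz0ne
    nlinarith
  · have hd : HasDerivAt ω (1 * χ z0 + z0 * deriv χ z0) z0 := by
      have := (hasDerivAt_id z0).mul hχa
      refine this.congr_of_eventuallyEq (Eventually.of_forall fun z => ?_)
      simp [hωχ z]
    rw [hd.deriv]
    push_cast
    rw [← hcr, hωχ z0, hc]
    field_simp

section conv
variable {Ψ G : ℂ → ℂ}

lemma star_le (hΨd : DifferentiableOn ℂ Ψ (ball (0 : ℂ) 1)) (hΨ0 : Ψ 0 = 0)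
    (hΨconv : Convex ℝ (Ψ '' ball (0 : ℂ) 1))
    (hGd : DifferentiableOn ℂ G (Ψ '' ball (0 : ℂ) 1)) (hG : ∀ z ∈ ball (0 : ℂ) 1, G (Ψ z) = z)
    (t : ℝ) (ht0 : 0 ≤ t) (ht1 : t ≤ 1) (w : ℂ) (hw : w ∈ ball (0 : ℂ) 1) :
    ‖G (t * Ψ w)‖ ≤ ‖w‖ := by
  have hz : (0 : ℂ) ∈ Ψ '' ball (0 : ℂ) 1 := ⟨0, by simp, hΨ0⟩
  have hm : MapsTo (fun w => (t : ℂ) * Ψ w) (ball (0 : ℂ) 1) (Ψ '' ball (0 : ℂ) 1) := by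
    intro w hw
    have := hΨconv.smul_mem_of_zero_mem hz ⟨w, hw, rfl⟩ ⟨ht0, ht1⟩
    simpa using this
  refine Complex.norm_le_norm_of_mapsTo_ball (f := fun w => G (t * Ψ w)) (R := 1)
    (hGd.comp (hΨd.const_mul _) hm) ?_ ?_ (by simpa using hw)
  · intro w hw
    obtain ⟨x, hx, hx'⟩ := hm hw
    apply ball_subset_closedBall
    simp only at hx' ⊢
    rw [← hx', hG x hx]; exact hx
  · have := hG 0 (by simp)
    rw [hΨ0] at this
    simp [hΨ0, this]

lemma H_inj (hΨd : DifferentiableOn ℂ Ψ (ball (0 : ℂ) 1)) (hΨ0 : Ψ 0 = 0)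
    (hΨconv : Convex ℝ (Ψ '' ball (0 : ℂ) 1)) (hO : IsOpen (Ψ '' ball (0 : ℂ) 1))
    (hGd : DifferentiableOn ℂ G (Ψ '' ball (0 : ℂ) 1)) (hG : ∀ z ∈ ball (0 : ℂ) 1, G (Ψ z) = z)
    (H : ℂ → ℂ) (hH : ∀ z ∈ ball (0 : ℂ) 1, HasDerivAt H (dslope Ψ 0 z) z) :
    InjOn H (ball (0 : ℂ) 1) := by
  have h00 : (0 : ℂ) ∈ ball (0 : ℂ) 1 := by simp
  have hz : (0 : ℂ) ∈ Ψ '' ball (0 : ℂ) 1 := ⟨0, h00, hΨ0⟩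
  have hGm : MapsTo G (Ψ '' ball (0 : ℂ) 1) (ball (0 : ℂ) 1) := by
    rintro _ ⟨w, hw, rfl⟩
    rw [hG w hw]; exact hw
  have hGa : ∀ u ∈ Ψ '' ball (0 : ℂ) 1, HasDerivAt G (deriv G u) u := fun u hu =>
    (hGd.differentiableAt (hO.mem_nhds hu)).hasDerivAt
  have hQ : DifferentiableOn ℂ (dslope Ψ 0) (ball (0 : ℂ) 1) :=
    (differentiableOn_dslope (isOpen_ball.mem_nhds h00)).2 hΨd
  have hone : dslope Ψ 0 0 * deriv G 0 = 1 := by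
    have e1 : HasDerivAt Ψ (deriv Ψ 0) 0 :=
      (hΨd.differentiableAt (isOpen_ball.mem_nhds h00)).hasDerivAt
    have e2 : HasDerivAt G (deriv G 0) (Ψ 0) := by rw [hΨ0]; exact hGa 0 hz
    have e3 : HasDerivAt (G ∘ Ψ) 1 0 := by
      refine (hasDerivAt_id (0:ℂ)).congr_of_eventuallyEq ?_
      filter_upwards [isOpen_ball.mem_nhds h00] with z hz using hG z hz
    rw [dslope_same, mul_comm]
    exact (e2.comp 0 e1).unique e3
  have hpos : ∀ u ∈ Ψ '' ball (0 : ℂ) 1, 0 < (dslope Ψ 0 (G u) * deriv G u).re := by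
    refine re_pos_of_nonneg _ _ hO hΨconv.isPreconnected
      ((hQ.comp hGd hGm).mul (hGd.deriv hO)) ?_ 0 hz ?_
    · rintro _ ⟨w, hw, rfl⟩
      rcases eq_or_ne w 0 with rfl | hne
      · simp only [hG 0 h00]
        rw [hΨ0, hone]; simp
      · have hd : HasDerivAt (fun t : ℝ => G (((1 - t : ℝ) : ℂ) * Ψ w) / w)
            (-(Ψ w * deriv G (Ψ w)) / w) 0 := by
          have e1 : HasDerivAt (fun t : ℝ => ((1 - t : ℝ) : ℂ) * Ψ w) (-1 * Ψ w) 0 := by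
            have := ((Complex.ofRealCLM.hasDerivAt (x := (0:ℝ))).const_sub 1).mul_const (Ψ w)
            simpa using this
          have e2 : HasDerivAt G (deriv G (Ψ w)) (((1 - 0 : ℝ) : ℂ) * Ψ w) := by
            simpa using hGa _ ⟨w, hw, rfl⟩
          have := (e2.comp (0 : ℝ) e1).div_const w
          have e3 : -(Ψ w * deriv G (Ψ w)) / w = deriv G (Ψ w) * (-1 * Ψ w) / w := by ring
          rw [e3]
          exact this
        have := re_deriv_nonpos _ _ hd (by simp [hG w hw, hne]) (by
          filter_upwards [Ioc_mem_nhdsGT (zero_lt_one (α := ℝ))] with t ht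
          rw [norm_div, div_le_one (norm_pos_iff.2 hne)]
          exact star_le hΨd hΨ0 hΨconv hGd hG _ (by linarith [ht.2]) (by linarith [ht.1]) w hw)
        simp only [hG w hw]
        rw [dslope_of_ne _ hne, slope_def_field, hΨ0]
        rw [neg_div, Complex.neg_re] at this
        have e : (Ψ w - 0) / (w - 0) * deriv G (Ψ w) = Ψ w * deriv G (Ψ w) / w := by
          rw [sub_zero, sub_zero]; ring
        rw [e]; linarith
    · have := hG 0 h00
      rw [hΨ0] at this
      rw [this, hone]; simp
  have hinj := noshiro (H ∘ G) (fun u => dslope Ψ 0 (G u) * deriv G u) _ hΨconv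
    (fun u hu => (hH _ (hGm hu)).comp u (hGa u hu)) hpos
  intro a ha b hb hab
  have := hinj ⟨a, ha, rfl⟩ ⟨b, hb, rfl⟩ (by simp [hG a ha, hG b hb, hab])
  rw [← hG a ha, this, hG b hb]

lemma main_sub (hΨd : DifferentiableOn ℂ Ψ (ball (0 : ℂ) 1)) (hΨ0 : Ψ 0 = 0)
    (hΨinj : InjOn Ψ (ball (0 : ℂ) 1)) (hΨconv : Convex ℝ (Ψ '' ball (0 : ℂ) 1))
    (H : ℂ → ℂ) (hH : ∀ z ∈ ball (0 : ℂ) 1, HasDerivAt H (dslope Ψ 0 z) z) (hH0 : H 0 = 0)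
    (P P' φ : ℂ → ℂ) (hP0 : P 0 = 0) (hP : ∀ z ∈ ball (0 : ℂ) 1, HasDerivAt P (P' z) z)
    (hφ : ∀ z ∈ ball (0 : ℂ) 1, ‖φ z‖ ≤ ‖z‖)
    (hPφ : ∀ z ∈ ball (0 : ℂ) 1, z * P' z = Ψ (φ z)) :
    ∃ ω : ℂ → ℂ, DifferentiableOn ℂ ω (ball (0 : ℂ) 1) ∧ ω 0 = 0 ∧
    (∀ z ∈ ball (0 : ℂ) 1, ω z ∈ ball (0 : ℂ) 1) ∧
    ∀ z ∈ ball (0 : ℂ) 1, P z = H (ω z) := by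
  obtain ⟨hO, G, hGd, hG⟩ := inv_exists Ψ hΨd hΨinj
  have h00 : (0 : ℂ) ∈ ball (0 : ℂ) 1 := by simp
  have hHd : DifferentiableOn ℂ H (ball (0 : ℂ) 1) := fun z hz =>
    (hH z hz).differentiableAt.differentiableWithinAt
  have hPd : DifferentiableOn ℂ P (ball (0 : ℂ) 1) := fun z hz =>
    (hP z hz).differentiableAt.differentiableWithinAt
  obtain ⟨hHO, K, hKd, hK⟩ := inv_exists H hHd (H_inj hΨd hΨ0 hΨconv hO hGd hG H hH)
  have hK0 : K 0 = 0 := by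
    have := hK 0 h00
    rwa [hH0] at this
  have hKm : ∀ u ∈ H '' ball (0 : ℂ) 1, K u ∈ ball (0 : ℂ) 1 ∧ H (K u) = u := by
    rintro _ ⟨w, hw, rfl⟩
    rw [hK w hw]; exact ⟨hw, rfl⟩
  -- local bound
  have hloc : ∀ r ≤ (1 : ℝ), (∀ z ∈ ball (0 : ℂ) r, P z ∈ H '' ball (0 : ℂ) 1) →
      ∀ z ∈ ball (0 : ℂ) r, ‖K (P z)‖ ≤ ‖z‖ := by
    intro r hr hm z1 hz1
    by_contra! hlt
    have hsub : ball (0 : ℂ) r ⊆ ball (0 : ℂ) 1 := ball_subset_ball hr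
    have hωd : DifferentiableOn ℂ (fun z => K (P z)) (ball (0 : ℂ) r) :=
      hKd.comp (hPd.mono hsub) hm
    obtain ⟨z0, hz0, hz0ne, hlt0, k, hk, hkeq⟩ := jack (fun z => K (P z)) r hωd
      (by simp [hP0, hK0]) z1 hz1 hlt
    have hw : K (P z0) ∈ ball (0 : ℂ) 1 := (hKm _ (hm z0 hz0)).1
    have hd1 : HasDerivAt (fun z => K (P z)) (deriv (fun z => K (P z)) z0) z0 :=
      (hωd.differentiableAt (isOpen_ball.mem_nhds hz0)).hasDerivAt
    have hd2 := (hH _ hw).comp z0 hd1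
    have hd3 : HasDerivAt (H ∘ fun z => K (P z)) (P' z0) z0 := by
      refine (hP z0 (hsub hz0)).congr_of_eventuallyEq ?_
      filter_upwards [isOpen_ball.mem_nhds hz0] with z hz using (hKm _ (hm z hz)).2
    have heq := hd2.unique hd3
    set w := K (P z0) with hwdef
    have hΨw : w * dslope Ψ 0 w = Ψ w := by
      have := sub_smul_dslope Ψ 0 w
      simpa [hΨ0] using this
    have hfin : Ψ (φ z0) = k * Ψ w := by
      rw [← hPφ z0 (hsub hz0), ← heq, ← hΨw]
      linear_combination dslope Ψ 0 w * hkeq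
    have hφz : φ z0 ∈ ball (0 : ℂ) 1 := by
      have h1 := hφ z0 (hsub hz0)
      have h2 : ‖z0‖ < 1 := by simpa using hsub hz0
      simpa using h1.trans_lt h2
    have hs := star_le hΨd hΨ0 hΨconv hGd hG k⁻¹ (by positivity) (inv_le_one_of_one_le₀ hk)
      (φ z0) hφz
    have hkne : (k : ℂ) ≠ 0 := by
      have : k ≠ 0 := by linarith
      exact_mod_cast this
    rw [hfin, Complex.ofReal_inv, inv_mul_cancel_left₀ hkne, hG w hw] at hs
    linarith [hφ z0 (hsub hz0)]
  have hext : ∀ r : ℝ, 0 < r → r < 1 → (∀ z ∈ ball (0 : ℂ) r, P z ∈ H '' ball (0 : ℂ) 1) →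
      ∀ z ∈ closedBall (0 : ℂ) r, P z ∈ H '' closedBall (0 : ℂ) r := by
    intro r hr0 hr1 hm z hz
    have hcomp : IsCompact (H '' closedBall (0 : ℂ) r) :=
      (isCompact_closedBall 0 r).image_of_continuousOn
        (hHd.continuousOn.mono (closedBall_subset_ball hr1))
    rw [← closure_ball (0 : ℂ) hr0.ne'] at hz
    have hmaps : MapsTo P (ball (0 : ℂ) r) (H '' closedBall (0 : ℂ) r) := by
      intro x hx
      have h1 := hloc r hr1.le hm x hx
      have h2 : ‖x‖ < r := by simpa using hx
      exact ⟨K (P x), by simpa using h1.trans h2.le, (hKm _ (hm x hx)).2⟩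
    have hc : ContinuousOn P (closure (ball (0 : ℂ) r)) := by
      rw [closure_ball (0 : ℂ) hr0.ne']
      exact hPd.continuousOn.mono (closedBall_subset_ball hr1)
    have := hmaps.closure_of_continuousOn hc hz
    rwa [hcomp.isClosed.closure_eq] at this
  have hall : ∀ z ∈ ball (0 : ℂ) 1, P z ∈ H '' ball (0 : ℂ) 1 := by
    by_contra! hcon
    obtain ⟨z1, hz1, hz1n⟩ := hcon
    have hz1' : ‖z1‖ < 1 := by simpa using hz1
    -- minimal modulus bad point
    have hclosed : IsClosed (closedBall (0 : ℂ) ‖z1‖ ∩ P ⁻¹' (H '' ball (0 : ℂ) 1)ᶜ) :=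
      (hPd.continuousOn.mono (closedBall_subset_ball hz1')).preimage_isClosed_of_isClosed
        isClosed_closedBall hHO.isClosed_compl
    have hcpt := (isCompact_closedBall (0 : ℂ) ‖z1‖).of_isClosed_subset hclosed inter_subset_left
    obtain ⟨z0, ⟨hz0, hz0n⟩, hmin⟩ := hcpt.exists_isMinOn ⟨z1, by simp, hz1n⟩
      continuous_norm.continuousOn
    have hz0' : ‖z0‖ ≤ ‖z1‖ := by simpa using hz0
    have hpos : 0 < ‖z0‖ := by
      rw [norm_pos_iff]
      rintro rfl
      exact hz0n ⟨0, h00, by rw [hH0, hP0]⟩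
    have hm : ∀ z ∈ ball (0 : ℂ) ‖z0‖, P z ∈ H '' ball (0 : ℂ) 1 := by
      intro z hz
      have hz' : ‖z‖ < ‖z0‖ := by simpa using hz
      by_contra hn
      have : ‖z0‖ ≤ ‖z‖ := hmin ⟨by simpa using hz'.le.trans hz0', hn⟩
      linarith
    have := hext ‖z0‖ hpos (hz0'.trans_lt hz1') hm z0 (by simp)
    exact hz0n (image_mono (closedBall_subset_ball (hz0'.trans_lt hz1')) this)
  exact ⟨fun z => K (P z), hKd.comp hPd hall, by simp [hP0, hK0],
    fun z hz => (hKm _ (hall z hz)).1, fun z hz => (hKm _ (hall z hz)).2.symm⟩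

end conv

/-- if Ψ is convex univalent with Ψ(0)=0 and zf'(z)/f(z) - 1 ≺ Ψ(z),
then f(z)/z ≺ exp(∫₀^z Ψ(t)/t dt).  The integral over the segment [0,z] is written
as z·∫₀¹ Q(sz) ds where Q(t) = Ψ(t)/t extended by Ψ'(0) at t = 0. -/
theorem subordination_f_div_z (Ψ : ℂ → ℂ)
    (hΨd : DifferentiableOn ℂ Ψ (ball (0 : ℂ) 1)) (hΨ0 : Ψ 0 = 0)
    (hΨinj : Set.InjOn Ψ (ball (0 : ℂ) 1)) (hΨconv : Convex ℝ (Ψ '' ball (0 : ℂ) 1))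
    (f : ℂ → ℂ) (hf : memA f) (hf0 : ∀ z ∈ ball (0 : ℂ) 1, z ≠ 0 → f z ≠ 0)
    (hsub : subordinate (fun z => if z = 0 then 0 else z * deriv f z / f z - 1) Ψ) :
    subordinate (fun z => if z = 0 then 1 else f z / z)
      (fun z => Complex.exp (z * ∫ s in (0 : ℝ)..1,
        (if (s : ℂ) * z = 0 then deriv Ψ 0 else Ψ ((s : ℂ) * z) / ((s : ℂ) * z)))) := by
  obtain ⟨hfd, hfz, hf1⟩ := hf
  obtain ⟨φ, hφd, hφ0, hφm, hφeq⟩ := hsub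
  have h00 : (0 : ℂ) ∈ ball (0 : ℂ) 1 := by simp
  have hnh : ball (0 : ℂ) 1 ∈ 𝓝 (0 : ℂ) := isOpen_ball.mem_nhds h00
  have hQ : DifferentiableOn ℂ (dslope Ψ 0) (ball (0 : ℂ) 1) :=
    (differentiableOn_dslope hnh).2 hΨd
  obtain ⟨H, hH0, hH⟩ : ∃ H : ℂ → ℂ, H 0 = 0 ∧
      ∀ z ∈ ball (0 : ℂ) 1, HasDerivAt H (dslope Ψ 0 z) z := by
    obtain ⟨H, hH⟩ := hQ.isExactOn_ball
    exact ⟨fun z => H z - H 0, by simp, fun z hz => (hH z hz).sub_const _⟩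
  have hHint : ∀ z ∈ ball (0 : ℂ) 1, H z = z * ∫ s in (0 : ℝ)..1,
        (if (s : ℂ) * z = 0 then deriv Ψ 0 else Ψ ((s : ℂ) * z) / ((s : ℂ) * z)) := by
    intro z hz
    have e0 : ∀ s : ℝ, (if (s : ℂ) * z = 0 then deriv Ψ 0 else Ψ ((s : ℂ) * z) / ((s : ℂ) * z))
        = dslope Ψ 0 (s * z) := by
      intro s
      split_ifs with h
      · rw [h, dslope_same]
      · rw [dslope_of_ne _ h, slope_def_field, hΨ0, sub_zero, sub_zero]
    have hmem : ∀ s ∈ uIcc (0 : ℝ) 1, (s : ℂ) * z ∈ ball (0 : ℂ) 1 := by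
      intro s hs
      rw [uIcc_of_le zero_le_one] at hs
      have hz' : ‖z‖ < 1 := by simpa using hz
      simp only [mem_ball_zero_iff, norm_mul, Complex.norm_real, Real.norm_eq_abs,
        abs_of_nonneg hs.1]
      nlinarith [hs.1, hs.2, norm_nonneg z]
    have hlin : ∀ s : ℝ, HasDerivAt (fun s : ℝ => (s : ℂ) * z) z s := by
      intro s
      simpa using (Complex.ofRealCLM.hasDerivAt (x := s)).mul_const z
    simp_rw [e0]
    rw [← intervalIntegral.integral_const_mul]
    have := intervalIntegral.integral_eq_sub_of_hasDerivAt (a := (0:ℝ)) (b := 1)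
      (f := fun s : ℝ => H (s * z)) (f' := fun s : ℝ => z * dslope Ψ 0 (s * z)) ?_ ?_
    · rw [this]; simp [hH0]
    · intro s hs
      rw [mul_comm]
      exact (hH _ (hmem s hs)).comp s (hlin s)
    · apply ContinuousOn.intervalIntegrable
      apply ContinuousOn.mul continuousOn_const
      exact hQ.continuousOn.comp (by fun_prop) hmem
  -- the function f(z)/z
  set q := dslope f 0 with hq
  have hqd : DifferentiableOn ℂ q (ball (0 : ℂ) 1) := (differentiableOn_dslope hnh).2 hfd
  have hq0 : q 0 = 1 := by rw [hq, dslope_same, hf1]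
  have hqne' : ∀ z, z ≠ 0 → q z = f z / z := by
    intro z hz
    rw [hq, dslope_of_ne _ hz, slope_def_field, hfz, sub_zero, sub_zero]
  have hqne : ∀ z ∈ ball (0 : ℂ) 1, q z ≠ 0 := by
    intro z hz
    rcases eq_or_ne z 0 with rfl | h
    · rw [hq0]; exact one_ne_zero
    · rw [hqne' z h]; exact div_ne_zero (hf0 z hz h) h
  have hqa : ∀ z ∈ ball (0 : ℂ) 1, HasDerivAt q (deriv q z) z := fun z hz =>
    (hqd.differentiableAt (isOpen_ball.mem_nhds hz)).hasDerivAt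
  obtain ⟨P, hP0, hP⟩ : ∃ P : ℂ → ℂ, P 0 = 0 ∧
      ∀ z ∈ ball (0 : ℂ) 1, HasDerivAt P (deriv q z / q z) z := by
    obtain ⟨P, hP⟩ := ((hqd.deriv isOpen_ball).div hqd hqne).isExactOn_ball
    exact ⟨fun z => P z - P 0, by simp, fun z hz => (hP z hz).sub_const _⟩
  have hexp : ∀ z ∈ ball (0 : ℂ) 1, q z = Complex.exp (P z) := by
    have hder : ∀ z ∈ ball (0 : ℂ) 1,
        HasDerivAt (fun z => q z * Complex.exp (-P z)) 0 z := by
      intro z hz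
      have := (hqa z hz).mul (hP z hz).neg.cexp
      have e : deriv q z * Complex.exp (-P z) +
          q z * (Complex.exp (-P z) * -(deriv q z / q z)) = 0 := by
        have := hqne z hz
        field_simp
        ring
      exact e ▸ this
    intro z hz
    have := isOpen_ball.is_const_of_deriv_eq_zero (convex_ball (0:ℂ) 1).isPreconnected
      (fun z hz => (hder z hz).differentiableAt.differentiableWithinAt)
      (fun z hz => (hder z hz).deriv) hz h00
    simp only [hq0, hP0, neg_zero, Complex.exp_zero, mul_one, Complex.exp_neg] at this
    rwa [← div_eq_mul_inv, div_eq_one_iff_eq (Complex.exp_ne_zero _)] at this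
  have hφle : ∀ z ∈ ball (0 : ℂ) 1, ‖φ z‖ ≤ ‖z‖ := fun z hz =>
    Complex.norm_le_norm_of_mapsTo_ball hφd (fun w hw => ball_subset_closedBall (hφm w hw)) hφ0
      (by simpa using hz)
  have hPφ : ∀ z ∈ ball (0 : ℂ) 1, z * (deriv q z / q z) = Ψ (φ z) := by
    intro z hz
    rcases eq_or_ne z 0 with rfl | h
    · simp [hφ0, hΨ0]
    · rw [← hφeq z hz]
      simp only [h, if_false]
      have hfz0 := hf0 z hz h
      have hd : HasDerivAt f (1 * q z + z * deriv q z) z := by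
        have := (hasDerivAt_id z).mul (hqa z hz)
        refine this.congr_of_eventuallyEq (Eventually.of_forall fun w => ?_)
        have := sub_smul_dslope f 0 w
        simp [hfz] at this
        simp [hq, this]
      rw [hd.deriv, hqne' z h]
      field_simp
      ring
  obtain ⟨ω, hωd, hω0, hωm, hωeq⟩ := main_sub hΨd hΨ0 hΨinj hΨconv H hH hH0 P _ φ hP0 hP hφle hPφ
  refine ⟨ω, hωd, hω0, hωm, fun z hz => ?_⟩
  simp only
  rw [← hHint _ (hωm z hz), ← hωeq z hz, ← hexp z hz]
  split_ifs with h
  · rw [h, hq0]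
  · rw [hqne' z h]
end
end

section
/- Let Ψ be analytic on 𝔻 with Ψ(0) = 0, injective on 𝔻, and with Ψ(𝔻) a convex set, and suppose there is δ > 0 such that Re(exp(∫₀^z Ψ(t)/t dt)) ≥ δ for all z ∈ 𝔻, where Ψ(t)/t is extended analytically by the value Ψ'(0) at t = 0. Then every f ∈ 𝒜 with f(z) ≠ 0 for z ∈ 𝔻 \ {0} satisfying z f'(z)/f(z) − 1 ≺ Ψ(z) satisfies Re(f(z)/z) ≥ δ for all z ∈ 𝔻 \ {0}; in particular f ∈ 𝒢₀. -/
open Complex Metric Set intervalIntegral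

noncomputable section

open Filter Topology

lemma inv_differentiableOn (Ψ : ℂ → ℂ) (hd : DifferentiableOn ℂ Ψ (ball (0 : ℂ) 1))
    (hinj : Set.InjOn Ψ (ball (0 : ℂ) 1)) :
    IsOpen (Ψ '' ball (0 : ℂ) 1) ∧
    DifferentiableOn ℂ (Function.invFunOn Ψ (ball (0 : ℂ) 1)) (Ψ '' ball (0 : ℂ) 1) := by
  have han : AnalyticOnNhd ℂ Ψ (ball (0 : ℂ) 1) := hd.analyticOnNhd isOpen_ball
  have hopen : ∀ s ⊆ ball (0 : ℂ) 1, IsOpen s → IsOpen (Ψ '' s) := by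
    rcases han.is_constant_or_isOpen (convex_ball (0:ℂ) 1).isPreconnected with ⟨w, hw⟩ | h
    · exfalso
      have h0 : (0 : ℂ) ∈ ball (0 : ℂ) 1 := by simp
      have h1 : (1/2 : ℂ) ∈ ball (0 : ℂ) 1 := by simp; norm_num
      have := hinj h0 h1 ((hw _ h0).trans (hw _ h1).symm)
      norm_num at this
    · exact h
  have hO := hopen _ le_rfl isOpen_ball
  refine ⟨hO, ?_⟩
  set g := Function.invFunOn Ψ (ball (0 : ℂ) 1) with hg
  have hgm : ∀ y ∈ Ψ '' ball (0 : ℂ) 1, g y ∈ ball (0 : ℂ) 1 := fun y hy =>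
    Function.invFunOn_mem hy
  have hge : ∀ y ∈ Ψ '' ball (0 : ℂ) 1, Ψ (g y) = y := fun y hy =>
    Function.invFunOn_eq hy
  have hgl : ∀ x ∈ ball (0 : ℂ) 1, g (Ψ x) = x := fun x hx =>
    hinj (hgm _ ⟨x, hx, rfl⟩) hx (hge _ ⟨x, hx, rfl⟩)
  have hcont : ∀ y ∈ Ψ '' ball (0 : ℂ) 1, ContinuousAt g y := by
    intro y hy
    rw [ContinuousAt, (nhds_basis_opens (g y)).tendsto_right_iff]
    rintro s ⟨hs, hso⟩
    have hmem : Ψ '' (s ∩ ball (0 : ℂ) 1) ∈ 𝓝 y :=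
      (hopen _ inter_subset_right (hso.inter isOpen_ball)).mem_nhds
        ⟨g y, ⟨hs, hgm y hy⟩, hge y hy⟩
    filter_upwards [hmem]
    rintro _ ⟨x, ⟨hx, hxb⟩, rfl⟩
    rw [hgl x hxb]; exact hx
  have hdiff : ∀ y ∈ Ψ '' ball (0 : ℂ) 1, deriv Ψ (g y) ≠ 0 → DifferentiableAt ℂ g y := by
    intro y hy hne
    refine (HasDerivAt.of_local_left_inverse (hcont y hy)
      ((hd.differentiableAt (isOpen_ball.mem_nhds (hgm y hy))).hasDerivAt) hne ?_).differentiableAt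
    filter_upwards [hO.mem_nhds hy] with x hx using hge x hx
  intro y hy
  refine DifferentiableAt.differentiableWithinAt ?_
  refine (Complex.analyticAt_of_differentiable_on_punctured_nhds_of_continuousAt ?_
    (hcont y hy)).differentiableAt
  have hda : AnalyticAt ℂ (deriv Ψ) (g y) := (han _ (hgm y hy)).deriv
  rcases hda.eventually_eq_zero_or_eventually_ne_zero with h | h
  · exfalso
    have h2 : EqOn (deriv Ψ) 0 (ball (0 : ℂ) 1) :=
      han.deriv.eqOn_zero_of_preconnected_of_eventuallyEq_zero
        (convex_ball (0:ℂ) 1).isPreconnected (hgm y hy) h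
    have h0 : (0 : ℂ) ∈ ball (0 : ℂ) 1 := by simp
    have h1 : (1/2 : ℂ) ∈ ball (0 : ℂ) 1 := by simp; norm_num
    have := isOpen_ball.is_const_of_deriv_eq_zero (convex_ball (0:ℂ) 1).isPreconnected hd h2 h0 h1
    have := hinj h0 h1 this
    norm_num at this
  · have ht : Tendsto g (𝓝[≠] y) (𝓝[≠] (g y)) := by
      refine tendsto_nhdsWithin_iff.2 ⟨(hcont y hy).mono_left nhdsWithin_le_nhds, ?_⟩
      filter_upwards [self_mem_nhdsWithin, mem_nhdsWithin_of_mem_nhds (hO.mem_nhds hy)] with x hx hx2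
      intro h
      apply hx
      have : Ψ (g x) = Ψ (g y) := congrArg Ψ h
      rwa [hge x hx2, hge y hy] at this
    filter_upwards [ht.eventually h, mem_nhdsWithin_of_mem_nhds (hO.mem_nhds hy)] with x hx hx2
    exact hdiff x hx2 hx

lemma star_norm_le (Ψ : ℂ → ℂ) (hd : DifferentiableOn ℂ Ψ (ball (0 : ℂ) 1)) (h0 : Ψ 0 = 0)
    (hinj : Set.InjOn Ψ (ball (0 : ℂ) 1)) (hconv : Convex ℝ (Ψ '' ball (0 : ℂ) 1))
    (v w : ℂ) (hv : v ∈ ball (0 : ℂ) 1) (hw : w ∈ ball (0 : ℂ) 1) (l : ℝ) (hl0 : 0 ≤ l)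
    (hl1 : l ≤ 1) (h : Ψ w = l * Ψ v) : ‖w‖ ≤ ‖v‖ := by
  obtain ⟨hO, hg⟩ := inv_differentiableOn Ψ hd hinj
  set g := Function.invFunOn Ψ (ball (0 : ℂ) 1)
  have hgm : ∀ y ∈ Ψ '' ball (0 : ℂ) 1, g y ∈ ball (0 : ℂ) 1 := fun y hy =>
    Function.invFunOn_mem hy
  have hge : ∀ y ∈ Ψ '' ball (0 : ℂ) 1, Ψ (g y) = y := fun y hy =>
    Function.invFunOn_eq hy
  have hgl : ∀ x ∈ ball (0 : ℂ) 1, g (Ψ x) = x := fun x hx =>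
    hinj (hgm _ ⟨x, hx, rfl⟩) hx (hge _ ⟨x, hx, rfl⟩)
  have hb0 : (0 : ℂ) ∈ ball (0 : ℂ) 1 := by simp
  have hm : ∀ z ∈ ball (0 : ℂ) 1, (l : ℂ) * Ψ z ∈ Ψ '' ball (0 : ℂ) 1 := by
    intro z hz
    have := hconv ⟨z, hz, rfl⟩ ⟨0, hb0, rfl⟩ hl0 (sub_nonneg.2 hl1) (by ring)
    simpa [h0] using this
  have := Complex.norm_le_norm_of_mapsTo_ball (f := fun z => g (l * Ψ z)) (R := 1) (z := v)
    (hg.comp (hd.const_mul (l : ℂ)) hm)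
    (fun z hz => ball_subset_closedBall (hgm _ (hm z hz)))
    (by simp only [h0, mul_zero]; have := hgl 0 hb0; rwa [h0] at this) (by simpa using hv)
  simp only [← h, hgl w hw] at this
  exact this

lemma tangential_zero (h : ℂ → ℂ) (h' z₀ : ℂ) (hd : HasDerivAt h h' z₀)
    (hmax : ∀ θ : ℝ, (h (z₀ * exp (θ * I))).re ≤ (h z₀).re) : (z₀ * h').im = 0 := by
  have h1 : HasDerivAt (fun θ : ℝ => z₀ * exp (θ * I)) (z₀ * I) 0 := by
    have a : HasDerivAt (fun θ : ℂ => z₀ * exp (θ * I)) (z₀ * (exp ((0:ℝ) * I) * (1 * I))) ((0:ℝ):ℂ) :=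
      (((hasDerivAt_id _).mul_const I).cexp).const_mul z₀
    simpa using a.comp_ofReal
  have h2 : HasDerivAt (fun θ : ℝ => h (z₀ * exp (θ * I))) (h' * (z₀ * I)) 0 :=
    HasDerivAt.comp (h₂ := h) (0:ℝ) (by simpa using hd) h1
  have h3 : HasDerivAt (fun θ : ℝ => (h (z₀ * exp (θ * I))).re) (h' * (z₀ * I)).re 0 :=
    (Complex.reCLM.hasFDerivAt.comp_hasDerivAt (0:ℝ) h2)
  have h4 : IsLocalMax (fun θ : ℝ => (h (z₀ * exp (θ * I))).re) 0 :=
    Eventually.of_forall (fun θ => by simpa using hmax θ)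
  have h5 := h4.hasDerivAt_eq_zero h3
  have h6 : h' * (z₀ * I) = (z₀ * h') * I := by ring
  rw [h6, Complex.mul_I_re] at h5
  linarith

lemma radial_hasDerivAt (h : ℂ → ℂ) (h' a : ℂ) (s : ℝ) (hd : HasDerivAt h h' (s * a)) :
    HasDerivAt (fun t : ℝ => (h (t * a)).re) (a * h').re s := by
  have h1 : HasDerivAt (fun t : ℝ => (t : ℂ) * a) a s := by
    simpa using (Complex.ofRealCLM.hasDerivAt (x := s)).mul_const a
  have h2 : HasDerivAt (fun t : ℝ => h (t * a)) (h' * a) s :=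
    HasDerivAt.comp (h₂ := h) s hd h1
  rw [mul_comm a]
  exact (Complex.reCLM.hasFDerivAt.comp_hasDerivAt s h2)

lemma radial_ge (h : ℂ → ℂ) (h' z₀ : ℂ) (c : ℝ) (hd : HasDerivAt h h' z₀)
    (hmax : ∀ᶠ t : ℝ in 𝓝[<] 1, c * (1 - t) ≤ (h z₀).re - (h (t * z₀)).re) :
    c ≤ (z₀ * h').re := by
  have h1 := radial_hasDerivAt h h' z₀ 1 (by simpa using hd)
  have h2 := (hasDerivAt_iff_tendsto_slope.1 h1).mono_left
    (nhdsWithin_mono (1:ℝ) (fun x (hx : x < 1) => ne_of_lt hx) : 𝓝[<] (1:ℝ) ≤ 𝓝[≠] 1)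
  refine ge_of_tendsto h2 ?_
  filter_upwards [hmax, self_mem_nhdsWithin] with t ht ht1
  have ht1 : t < 1 := ht1
  rw [slope_def_field, le_div_iff_of_neg (by linarith)]
  simp only [ofReal_one, one_mul]
  linarith

lemma exists_max_point (G : ℂ → ℂ) (hG : DifferentiableOn ℂ G (ball (0 : ℂ) 1)) (ρ : ℝ)
    (h0 : 0 < ρ) (h1 : ρ < 1) :
    ∃ w : ℂ, ‖w‖ = ρ ∧ (∀ y : ℂ, ‖y‖ ≤ ρ → (G y).re ≤ (G w).re) ∧
      (w * deriv G w).im = 0 ∧ 0 ≤ (w * deriv G w).re := by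
  have hsub : closedBall (0:ℂ) ρ ⊆ ball 0 1 := closedBall_subset_ball h1
  have hdc : DiffContOnCl ℂ (fun z => exp (G z)) (ball (0:ℂ) ρ) := by
    apply DifferentiableOn.diffContOnCl
    rw [closure_ball _ h0.ne']
    exact (hG.mono hsub).cexp
  obtain ⟨w, hw, hmax⟩ := Complex.exists_mem_frontier_isMaxOn_norm isBounded_ball
    ⟨0, by simpa using h0⟩ hdc
  rw [closure_ball _ h0.ne'] at hmax
  rw [frontier_ball _ h0.ne'] at hw
  have hwn : ‖w‖ = ρ := by simpa using hw
  have hm : ∀ y : ℂ, ‖y‖ ≤ ρ → (G y).re ≤ (G w).re := by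
    intro y hy
    have := hmax (show y ∈ closedBall (0:ℂ) ρ by simpa using hy)
    simpa [Complex.norm_exp] using this
  have hd : HasDerivAt G (deriv G w) w :=
    (hG.differentiableAt (isOpen_ball.mem_nhds (by simp [hwn, h1]))).hasDerivAt
  refine ⟨w, hwn, hm, tangential_zero G _ w hd fun θ => hm _ ?_, radial_ge G _ w 0 hd ?_⟩
  · simp [hwn, Complex.norm_exp_ofReal_mul_I]
  · filter_upwards [Ioo_mem_nhdsLT (show (0:ℝ) < 1 by norm_num)] with t ht
    have : (G (t * w)).re ≤ (G w).re := by
      apply hm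
      rw [norm_mul, Complex.norm_real, Real.norm_of_nonneg ht.1.le, hwn]
      nlinarith [ht.1, ht.2]
    linarith

lemma half_plane_s10 (Ψ G p ω : ℂ → ℂ) (M : ℝ) (hΨc : ContinuousOn Ψ (ball (0 : ℂ) 1))
    (hstar : ∀ v ∈ ball (0 : ℂ) 1, ∀ w ∈ ball (0 : ℂ) 1, ∀ l : ℝ, 0 ≤ l → l ≤ 1 →
      Ψ w = l * Ψ v → ‖w‖ ≤ ‖v‖)
    (hG : DifferentiableOn ℂ G (ball (0 : ℂ) 1)) (hG0 : G 0 = 0)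
    (hGΨ : ∀ z ∈ ball (0 : ℂ) 1, z * deriv G z = Ψ z)
    (hp : DifferentiableOn ℂ p (ball (0 : ℂ) 1)) (hp0 : p 0 = 0)
    (hpω : ∀ z ∈ ball (0 : ℂ) 1, z * deriv p z = Ψ (ω z))
    (hω : ∀ z ∈ ball (0 : ℂ) 1, z ≠ 0 → ‖ω z‖ < ‖z‖)
    (hM : ∀ z ∈ ball (0 : ℂ) 1, (G z).re ≤ M) :
    ∀ z ∈ ball (0 : ℂ) 1, (p z).re ≤ M := by
  -- the maximum of `Re G` over the disk of radius `‖z‖`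
  set B : ℂ → ℝ := fun z => ⨆ u : closedBall (0:ℂ) 1, (G (u * z)).re with hB
  have hmem : ∀ z ∈ ball (0:ℂ) 1, ∀ u : closedBall (0:ℂ) 1, (u : ℂ) * z ∈ ball (0:ℂ) 1 := by
    intro z hz u
    have hu : ‖(u:ℂ)‖ ≤ 1 := mem_closedBall_zero_iff.1 u.2
    have hz : ‖z‖ < 1 := by simpa using hz
    rw [mem_ball_zero_iff, norm_mul]
    nlinarith [norm_nonneg z, norm_nonneg (u:ℂ)]
  have hbdd : ∀ z ∈ ball (0:ℂ) 1,
      BddAbove (range fun u : closedBall (0:ℂ) 1 => (G (u * z)).re) := by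
    intro z hz
    refine ⟨M, ?_⟩
    rintro _ ⟨u, rfl⟩
    exact hM _ (hmem z hz u)
  have hne : Nonempty (closedBall (0:ℂ) 1) := ⟨⟨0, by simp⟩⟩
  have hBge : ∀ z ∈ ball (0:ℂ) 1, ∀ y : ℂ, ‖y‖ ≤ ‖z‖ → (G y).re ≤ B z := by
    intro z hz y hy
    by_cases hz0 : z = 0
    · subst hz0
      have : y = 0 := by simpa using hy
      subst this
      simp [hB]
    · have hu : y / z ∈ closedBall (0:ℂ) 1 := by
        rw [mem_closedBall_zero_iff, norm_div]
        exact div_le_one_of_le₀ hy (norm_nonneg _)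
      have := le_ciSup (hbdd z hz) ⟨y / z, hu⟩
      simpa [div_mul_cancel₀ _ hz0] using this
  have hBle : ∀ z ∈ ball (0:ℂ) 1, ∀ c : ℝ, (∀ y : ℂ, ‖y‖ ≤ ‖z‖ → (G y).re ≤ c) → B z ≤ c := by
    intro z hz c hc
    refine ciSup_le fun u => hc _ ?_
    have hu : ‖(u:ℂ)‖ ≤ 1 := mem_closedBall_zero_iff.1 u.2
    rw [norm_mul]
    nlinarith [norm_nonneg z]
  have hBmono : ∀ z ∈ ball (0:ℂ) 1, ∀ z' ∈ ball (0:ℂ) 1, ‖z‖ ≤ ‖z'‖ → B z ≤ B z' := by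
    intro z hz z' hz' h
    exact hBle z hz _ fun y hy => hBge z' hz' y (hy.trans h)
  have hB0 : B 0 = 0 := by simp [hB, hG0]
  have hlsc : LowerSemicontinuousOn B (ball (0:ℂ) 1) := by
    refine lowerSemicontinuousOn_ciSup hbdd fun u => ContinuousOn.lowerSemicontinuousOn ?_
    exact Complex.continuous_re.comp_continuousOn
      (hG.continuousOn.comp (by fun_prop) (fun z hz => hmem z hz u))
  have key : ∀ ε : ℝ, 0 < ε → ∀ z₁ ∈ ball (0 : ℂ) 1, (p z₁).re ≤ B z₁ + ε * ‖z₁‖ := by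
    intro ε hε z₁ hz₁
    have hR : ‖z₁‖ < 1 := by simpa using hz₁
    have hsub : closedBall (0:ℂ) ‖z₁‖ ⊆ ball 0 1 := closedBall_subset_ball hR
    have husc : UpperSemicontinuousOn (fun z => ((p z).re - ε * ‖z‖) + (- B z))
        (closedBall (0:ℂ) ‖z₁‖) := by
      refine UpperSemicontinuousOn.add (ContinuousOn.upperSemicontinuousOn ?_) ?_
      · exact (Complex.continuous_re.comp_continuousOn (hp.continuousOn.mono hsub)).sub
          (by fun_prop)
      · intro z hz
        have := (hlsc z (hsub hz)).mono hsub
        intro y hy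
        filter_upwards [this (-y) (by simp only [] at hy; linarith)] with x hx
        linarith
    obtain ⟨z₀, hz₀, hmax⟩ := husc.exists_isMaxOn ⟨0, by simp⟩ (isCompact_closedBall _ _)
    have hmax' : ∀ z : ℂ, ‖z‖ ≤ ‖z₁‖ →
        (p z).re - ε * ‖z‖ - B z ≤ (p z₀).re - ε * ‖z₀‖ - B z₀ := by
      intro z hz
      have := hmax (show z ∈ closedBall (0:ℂ) ‖z₁‖ by simpa using hz)
      simp only [mem_ofPred_eq] at this
      linarith
    have hz₀n : ‖z₀‖ ≤ ‖z₁‖ := by simpa using hz₀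
    have hz₀b := hsub hz₀
    have hr1 : ‖z₀‖ < 1 := by simpa using hz₀b
    by_cases h00 : z₀ = 0
    · have := hmax' z₁ le_rfl
      rw [h00] at this
      simp [hp0, hB0] at this
      linarith
    exfalso
    have hr : 0 < ‖z₀‖ := norm_pos_iff.2 h00
    have hd : HasDerivAt p (deriv p z₀) z₀ :=
      (hp.differentiableAt (isOpen_ball.mem_nhds hz₀b)).hasDerivAt
    have htan : (z₀ * deriv p z₀).im = 0 := by
      refine tangential_zero p _ z₀ hd fun θ => ?_
      have hn : ‖z₀ * exp (θ * I)‖ = ‖z₀‖ := by simp [Complex.norm_exp_ofReal_mul_I]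
      have h1 := hmax' (z₀ * exp (θ * I)) (by rw [hn]; exact hz₀n)
      have h2 := hBmono (z₀ * exp (θ * I)) (by rw [mem_ball_zero_iff, hn]; exact hr1) z₀ hz₀b hn.le
      rw [hn] at h1
      linarith
    have hnt : ∀ t : ℝ, 0 < t → ‖(t:ℂ) * z₀‖ = t * ‖z₀‖ := by
      intro t ht
      rw [norm_mul, Complex.norm_real, Real.norm_of_nonneg ht.le]
    have hrad : ∀ t : ℝ, 0 < t → t < 1 →
        B z₀ - B (t * z₀) + ε * ‖z₀‖ * (1 - t) ≤ (p z₀).re - (p (t * z₀)).re := by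
      intro t h0 h1
      have := hmax' (t * z₀) (by rw [hnt t h0]; nlinarith)
      rw [hnt t h0] at this
      linarith
    have hrad1 : ε * ‖z₀‖ ≤ (z₀ * deriv p z₀).re := by
      refine radial_ge p _ z₀ _ hd ?_
      filter_upwards [Ioo_mem_nhdsLT (show (0:ℝ) < 1 by norm_num)] with t ht
      have h1 := hrad t ht.1 ht.2
      have hn : ‖(t:ℂ) * z₀‖ ≤ ‖z₀‖ := by rw [hnt t ht.1]; nlinarith [ht.2]
      have h2 := hBmono (t * z₀) (by rw [mem_ball_zero_iff]; linarith) z₀ hz₀b hn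
      linarith
    set x₀ := (z₀ * deriv p z₀).re with hx₀
    have hx₀pos : 0 < x₀ := lt_of_lt_of_le (by positivity) hrad1
    have hv : Ψ (ω z₀) = (x₀ : ℂ) := by
      rw [← hpω z₀ hz₀b]
      apply Complex.ext <;> simp [hx₀, htan]
    have hvn := hω z₀ hz₀b h00
    set η : ℝ := min (ε * ‖z₀‖ / 2) x₀ with hη
    have hηpos : 0 < η := lt_min (by positivity) hx₀pos
    have hηx : η ≤ x₀ := min_le_right _ _
    have hηε : η ≤ ε * ‖z₀‖ / 2 := min_le_left _ _
    have hcont : UniformContinuousOn Ψ (closedBall (0:ℂ) ‖z₀‖) :=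
      (isCompact_closedBall _ _).uniformContinuousOn_of_continuous
        (hΨc.mono (closedBall_subset_ball hr1))
    obtain ⟨d, hdpos, hdd⟩ := Metric.uniformContinuousOn_iff.1 hcont η hηpos
    have hrad2 : (x₀ - η) + ε * ‖z₀‖ ≤ x₀ := by
      refine radial_ge p _ z₀ _ hd ?_
      have hlow : max (max (‖ω z₀‖ / ‖z₀‖) (1 - d)) (1/2) < 1 := by
        refine max_lt (max_lt ((div_lt_one hr).2 hvn) (by linarith)) (by norm_num)
      filter_upwards [Ioo_mem_nhdsLT hlow] with t ht
      have ht1 : t < 1 := ht.2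
      have hta : ‖ω z₀‖ / ‖z₀‖ < t :=
        lt_of_le_of_lt ((le_max_left _ _).trans (le_max_left _ _)) ht.1
      have htd : 1 - d < t :=
        lt_of_le_of_lt ((le_max_right _ _).trans (le_max_left _ _)) ht.1
      have ht0 : 0 < t :=
        lt_trans (by norm_num) (lt_of_le_of_lt (le_max_right _ _) ht.1)
      have hvt : ‖ω z₀‖ < t * ‖z₀‖ := (div_lt_iff₀ hr).1 hta
      have htr : t * ‖z₀‖ < ‖z₀‖ := by nlinarith
      obtain ⟨w, hwn, hwmax, hwim, hwre⟩ := exists_max_point G hG (t * ‖z₀‖) (by positivity)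
        (htr.trans hr1)
      have hwb : w ∈ ball (0:ℂ) 1 := by rw [mem_ball_zero_iff]; linarith
      rw [hGΨ w hwb] at hwim hwre
      have hx1 : x₀ ≤ (Ψ w).re := by
        by_contra hlt
        push Not at hlt
        have := hstar (ω z₀) (by rw [mem_ball_zero_iff]; linarith) w hwb ((Ψ w).re / x₀)
          (by positivity) ((div_le_one hx₀pos).2 hlt.le) (by
            rw [hv]
            have : (x₀:ℂ) ≠ 0 := by exact_mod_cast hx₀pos.ne'
            push_cast
            rw [div_mul_cancel₀ _ this]
            apply Complex.ext <;> simp [hwim])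
        linarith
      set a : ℂ := w / t with ha
      have htc : (t:ℂ) ≠ 0 := by exact_mod_cast ht0.ne'
      have hta' : (t:ℂ) * a = w := by rw [ha]; field_simp
      have han : ‖a‖ = ‖z₀‖ := by
        rw [ha, norm_div, hwn, Complex.norm_real, Real.norm_of_nonneg ht0.le]
        field_simp
      have hsa : ∀ s : ℝ, 0 < s → ‖(s:ℂ) * a‖ = s * ‖z₀‖ := by
        intro s hs
        rw [norm_mul, Complex.norm_real, Real.norm_of_nonneg hs.le, han]
      have hsb : ∀ s : ℝ, 0 < s → s ≤ 1 → (s:ℂ) * a ∈ ball (0:ℂ) 1 := by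
        intro s hs hs1
        rw [mem_ball_zero_iff, hsa s hs]
        nlinarith
      have hder : ∀ s : ℝ, 0 < s → s ≤ 1 →
          HasDerivAt (fun t : ℝ => (G (t * a)).re) (a * deriv G (s * a)).re s := by
        intro s hs hs1
        exact radial_hasDerivAt G _ a s
          (hG.differentiableAt (isOpen_ball.mem_nhds (hsb s hs hs1))).hasDerivAt
      have hmv : (x₀ - η) * (1 - t) ≤ (G ((1:ℝ) * a)).re - (G (t * a)).re := by
        refine (convex_Icc t 1).mul_sub_le_image_sub_of_le_deriv
          (f := fun s : ℝ => (G (s * a)).re) ?_ ?_ ?_ t ⟨le_rfl, ht1.le⟩ 1 ⟨ht1.le, le_rfl⟩ ht1.le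
        · intro s hs
          exact (hder s (ht0.trans_le hs.1) hs.2).continuousAt.continuousWithinAt
        · intro s hs
          rw [interior_Icc] at hs
          exact (hder s (ht0.trans hs.1) hs.2.le).differentiableAt.differentiableWithinAt
        · intro s hs
          rw [interior_Icc] at hs
          have hs0 := ht0.trans hs.1
          rw [(hder s hs0 hs.2.le).deriv]
          have h1 : (s:ℂ) * a * deriv G (s * a) = Ψ (s * a) := hGΨ _ (hsb s hs0 hs.2.le)
          have h2 : s * (a * deriv G (s * a)).re = (Ψ (s * a)).re := by
            rw [← h1, mul_assoc, Complex.re_ofReal_mul]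
          have h3 : dist (Ψ (s * a)) (Ψ w) < η := by
            refine hdd _ ?_ _ ?_ ?_
            · rw [mem_closedBall_zero_iff, hsa s hs0]; nlinarith [hs.2]
            · rw [mem_closedBall_zero_iff]; linarith
            · rw [← hta', dist_eq_norm, ← sub_mul, ← Complex.ofReal_sub, norm_mul,
                Complex.norm_real, Real.norm_of_nonneg (by linarith [hs.1]), han]
              nlinarith [hs.1, hs.2]
          have h4 : (Ψ w).re - (Ψ (s * a)).re < η := by
            rw [dist_comm, dist_eq_norm] at h3
            have := (Complex.re_le_norm (Ψ w - Ψ (s * a))).trans_lt h3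
            simpa using this
          have h5 : x₀ - η ≤ s * (a * deriv G (s * a)).re := by rw [h2]; linarith
          have h6 : 0 ≤ (a * deriv G (s * a)).re := by
            by_contra hneg
            push Not at hneg
            nlinarith
          nlinarith [hs.2]
      have hB1 : B (t * z₀) ≤ (G w).re := by
        refine hBle _ ?_ _ fun y hy => hwmax y ?_
        · rw [mem_ball_zero_iff, hnt t ht0]; linarith
        · rwa [hnt t ht0] at hy
      have hB2 : (G a).re ≤ B z₀ := hBge z₀ hz₀b a han.le
      have hfin := hrad t ht0 ht1
      rw [hta'] at hmv
      simp only [ofReal_one, one_mul] at hmv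
      nlinarith
    linarith [mul_pos hε hr]
  intro z hz
  refine le_of_forall_pos_le_add fun ε hε => ?_
  have h1 := key ε hε z hz
  have h2 : B z ≤ M := ciSup_le fun u => hM _ (hmem z hz u)
  have h3 : ‖z‖ < 1 := by simpa using hz
  nlinarith

lemma cos_tangent (v v₁ : ℝ) (hv : |v| < Real.pi / 2) (hv₁ : |v₁| < Real.pi / 2) :
    Real.cos v * Real.exp (Real.tan v₁ * (v - v₁)) ≤ Real.cos v₁ := by
  rw [abs_lt] at hv hv₁
  have hc : 0 < Real.cos v₁ := Real.cos_pos_of_mem_Ioo hv₁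
  set a := Real.tan v₁ with ha
  have hac : a * Real.cos v₁ = Real.sin v₁ := Real.tan_mul_cos hc.ne'
  have hd : ∀ x : ℝ, HasDerivAt (fun x => Real.cos x * Real.exp (a * (x - v₁)))
      (Real.exp (a * (x - v₁)) * (Real.sin (v₁ - x) / Real.cos v₁)) x := by
    intro x
    have h1 : HasDerivAt (fun x => Real.exp (a * (x - v₁))) (Real.exp (a * (x - v₁)) * (a * 1)) x :=
      (((hasDerivAt_id x).sub_const v₁).const_mul a).exp
    refine ((Real.hasDerivAt_cos x).mul h1).congr_deriv ?_
    rw [Real.sin_sub, ← hac]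
    field_simp
    ring
  have hcont : Continuous (fun x => Real.cos x * Real.exp (a * (x - v₁))) := by fun_prop
  have hdiff : Differentiable ℝ (fun x => Real.cos x * Real.exp (a * (x - v₁))) :=
    fun x => (hd x).differentiableAt
  have h0 : Real.cos v₁ * Real.exp (a * (v₁ - v₁)) = Real.cos v₁ := by simp
  rcases le_total v v₁ with h | h
  · have hm : MonotoneOn (fun x => Real.cos x * Real.exp (a * (x - v₁))) (Icc v v₁) := by
      refine monotoneOn_of_deriv_nonneg (convex_Icc _ _) hcont.continuousOn
        hdiff.differentiableOn fun x hx => ?_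
      rw [interior_Icc] at hx
      rw [(hd x).deriv]
      have := Real.sin_nonneg_of_nonneg_of_le_pi (x := v₁ - x) (by linarith [hx.2])
        (by linarith [hx.1])
      positivity
    have := hm (left_mem_Icc.2 h) (right_mem_Icc.2 h) h
    simpa [h0] using this
  · have hm : AntitoneOn (fun x => Real.cos x * Real.exp (a * (x - v₁))) (Icc v₁ v) := by
      refine antitoneOn_of_deriv_nonpos (convex_Icc _ _) hcont.continuousOn
        hdiff.differentiableOn fun x hx => ?_
      rw [interior_Icc] at hx
      rw [(hd x).deriv]
      have := Real.sin_nonpos_of_nonpos_of_neg_pi_le (x := v₁ - x) (by linarith [hx.1])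
        (by linarith [hx.2])
      exact mul_nonpos_of_nonneg_of_nonpos (Real.exp_pos _).le
        (div_nonpos_of_nonpos_of_nonneg this hc.le)
    have := hm (left_mem_Icc.2 h) (right_mem_Icc.2 h) h
    simpa [h0] using this

/-- If a point satisfies every tangent inequality, then it lies in the convex region. -/
lemma region_of_tangents (ξ : ℂ) (δ : ℝ) (hδ : 0 < δ)
    (h : ∀ v₁ : ℝ, |v₁| < Real.pi / 2 →
      δ ≤ Real.cos v₁ * Real.exp (ξ.re - Real.tan v₁ * (ξ.im - v₁))) :
    δ ≤ (exp ξ).re := by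
  rw [Complex.exp_re]
  have hpi := Real.pi_pos
  by_cases hv : |ξ.im| < Real.pi / 2
  · have := h ξ.im hv
    simp only [sub_self, mul_zero, sub_zero] at this
    linarith
  exfalso
  have hlim : Tendsto (fun x : ℝ => Real.cos x * Real.exp ξ.re) (𝓝[<] (Real.pi / 2)) (𝓝 0) := by
    have : Continuous (fun x : ℝ => Real.cos x * Real.exp ξ.re) := by fun_prop
    have := (this.tendsto (Real.pi / 2)).mono_left (nhdsWithin_le_nhds (s := Iio (Real.pi / 2)))
    simpa using this
  refine absurd (ge_of_tendsto hlim ?_) (not_le.2 hδ)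
  filter_upwards [Ioo_mem_nhdsLT (show (0:ℝ) < Real.pi / 2 by positivity)] with x hx
  have hcx : 0 < Real.cos x := Real.cos_pos_of_mem_Ioo ⟨by linarith [hx.1], hx.2⟩
  have htx : 0 < Real.tan x := Real.tan_pos_of_pos_of_lt_pi_div_two hx.1 hx.2
  push Not at hv
  rcases le_abs.1 hv with h1 | h1
  · have h2 := h x (by rw [abs_lt]; constructor <;> linarith [hx.1, hx.2])
    refine h2.trans (mul_le_mul_of_nonneg_left (Real.exp_le_exp.2 ?_) hcx.le)
    nlinarith [hx.2]
  · have h2 := h (-x) (by rw [abs_lt]; constructor <;> linarith [hx.1, hx.2])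
    rw [Real.cos_neg, Real.tan_neg] at h2
    refine h2.trans (mul_le_mul_of_nonneg_left (Real.exp_le_exp.2 ?_) hcx.le)
    nlinarith [hx.2]

lemma im_lt_of_exp (G : ℂ → ℂ) (hG : ContinuousOn G (ball (0 : ℂ) 1)) (hG0 : G 0 = 0)
    (h : ∀ z ∈ ball (0 : ℂ) 1, 0 < (exp (G z)).re) :
    ∀ z ∈ ball (0 : ℂ) 1, |(G z).im| < Real.pi / 2 := by
  have hcos : ∀ z ∈ ball (0 : ℂ) 1, 0 < Real.cos (G z).im := by
    intro z hz
    have := h z hz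
    rw [Complex.exp_re] at this
    exact pos_of_mul_pos_right this (Real.exp_pos _).le
  have hpi := Real.pi_pos
  intro z hz
  by_contra hlt
  push Not at hlt
  have hc : ContinuousOn (fun z => |(G z).im|) (ball (0:ℂ) 1) :=
    (Complex.continuous_im.comp_continuousOn hG).abs
  have h0 : (0:ℂ) ∈ ball (0:ℂ) 1 := by simp
  obtain ⟨y, hy, hyv⟩ := (convex_ball (0:ℂ) 1).isPreconnected.intermediate_value h0 hz hc
    (show Real.pi / 2 ∈ Icc _ _ from ⟨by simp [hG0]; positivity, hlt⟩)
  have h1 := hcos y hy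
  rw [← Real.cos_abs] at h1
  simp only [] at hyv
  rw [hyv, Real.cos_pi_div_two] at h1
  exact lt_irrefl _ h1

lemma primitive_ball (g : ℂ → ℂ) (hg : DifferentiableOn ℂ g (ball (0 : ℂ) 1)) :
    ∃ G : ℂ → ℂ, G 0 = 0 ∧ ∀ z ∈ ball (0 : ℂ) 1, HasDerivAt G (g z) z := by
  obtain ⟨G, h1, h2⟩ := hg.isExactOn_ball.with_val_at 0 0
  exact ⟨G, h1, h2⟩

lemma integral_eq (g G : ℂ → ℂ) (hg : ContinuousOn g (ball (0 : ℂ) 1)) (hG0 : G 0 = 0)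
    (hG : ∀ z ∈ ball (0 : ℂ) 1, HasDerivAt G (g z) z) (z : ℂ) (hz : z ∈ ball (0 : ℂ) 1) :
    z * ∫ s in (0:ℝ)..1, g ((s:ℂ) * z) = G z := by
  have hm : ∀ s ∈ uIcc (0:ℝ) 1, (s:ℂ) * z ∈ ball (0:ℂ) 1 := by
    intro s hs
    rw [uIcc_of_le zero_le_one] at hs
    have hz : ‖z‖ < 1 := by simpa using hz
    rw [mem_ball_zero_iff, norm_mul, Complex.norm_real, Real.norm_of_nonneg hs.1]
    nlinarith [hs.1, hs.2, norm_nonneg z]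
  have hint := intervalIntegral.integral_eq_sub_of_hasDerivAt (a := (0:ℝ)) (b := 1)
    (f := fun s : ℝ => G ((s:ℂ) * z)) (f' := fun s : ℝ => z * g ((s:ℂ) * z)) ?_ ?_
  · rw [intervalIntegral.integral_const_mul] at hint
    simpa [hG0] using hint
  · intro s hs
    have h1 : HasDerivAt (fun t : ℝ => (t : ℂ) * z) z s := by
      simpa using (Complex.ofRealCLM.hasDerivAt (x := s)).mul_const z
    rw [mul_comm]
    exact HasDerivAt.comp (h₂ := G) s (hG _ (hm s hs)) h1
  · apply ContinuousOn.intervalIntegrable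
    exact continuousOn_const.mul (hg.comp (by fun_prop) hm)

/-- if Ψ is convex univalent with Ψ(0)=0 and
Re(exp(∫₀^z Ψ(t)/t dt)) ≥ δ > 0 on 𝔻, then every f ∈ 𝒜 with
zf'(z)/f(z) - 1 ≺ Ψ(z) satisfies Re(f(z)/z) ≥ δ on 𝔻 \ {0}; in particular f ∈ 𝒢₀. -/
theorem F_Psi_subset_G0 (Ψ : ℂ → ℂ)
    (hΨd : DifferentiableOn ℂ Ψ (ball (0 : ℂ) 1)) (hΨ0 : Ψ 0 = 0)
    (hΨinj : Set.InjOn Ψ (ball (0 : ℂ) 1)) (hΨconv : Convex ℝ (Ψ '' ball (0 : ℂ) 1))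
    (δ : ℝ) (hδ : 0 < δ)
    (hδle : ∀ z ∈ ball (0 : ℂ) 1,
      δ ≤ (Complex.exp (z * ∫ s in (0 : ℝ)..1,
        (if (s : ℂ) * z = 0 then deriv Ψ 0 else Ψ ((s : ℂ) * z) / ((s : ℂ) * z)))).re)
    (f : ℂ → ℂ) (hf : memA f) (hf0 : ∀ z ∈ ball (0 : ℂ) 1, z ≠ 0 → f z ≠ 0)
    (hsub : subordinate (fun z => if z = 0 then 0 else z * deriv f z / f z - 1) Ψ) :
    (∀ z ∈ ball (0 : ℂ) 1, z ≠ 0 → δ ≤ (f z / z).re) ∧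
      (∀ z ∈ ball (0 : ℂ) 1, z ≠ 0 → 0 < (f z / z).re) := by
  have hpi := Real.pi_pos
  have h0b : (0:ℂ) ∈ ball (0:ℂ) 1 := by simp
  obtain ⟨hfd, hf00, hf1⟩ := hf
  obtain ⟨ω, hωd, hω0, hωm, hωe⟩ := hsub
  -- the primitive of `Ψ(t)/t`
  have hgd : DifferentiableOn ℂ (dslope Ψ 0) (ball (0:ℂ) 1) :=
    (Complex.differentiableOn_dslope (ball_mem_nhds 0 one_pos)).2 hΨd
  obtain ⟨G, hG0, hGd⟩ := primitive_ball _ hgd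
  have hGdiff : DifferentiableOn ℂ G (ball (0:ℂ) 1) := fun z hz =>
    (hGd z hz).differentiableAt.differentiableWithinAt
  have hGΨ : ∀ z ∈ ball (0 : ℂ) 1, z * deriv G z = Ψ z := by
    intro z hz
    rw [(hGd z hz).deriv]
    have := sub_smul_dslope Ψ 0 z
    simpa [hΨ0] using this
  have hGδ : ∀ z ∈ ball (0 : ℂ) 1, δ ≤ (exp (G z)).re := by
    intro z hz
    have h1 := hδle z hz
    have h2 : ∀ x : ℂ, (if x = 0 then deriv Ψ 0 else Ψ x / x) = dslope Ψ 0 x := by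
      intro x
      split_ifs with hx
      · rw [hx, dslope_same]
      · rw [dslope_of_ne _ hx, slope_def_field, hΨ0, sub_zero, sub_zero]
    simp only [h2] at h1
    rwa [integral_eq _ G hgd.continuousOn hG0 hGd z hz] at h1
  have hGim := im_lt_of_exp G hGdiff.continuousOn hG0 fun z hz => hδ.trans_le (hGδ z hz)
  -- the logarithm of `f(z)/z`
  set q := dslope f 0 with hq
  have hqd : DifferentiableOn ℂ q (ball (0:ℂ) 1) :=
    (Complex.differentiableOn_dslope (ball_mem_nhds 0 one_pos)).2 hfd
  have hq0 : q 0 = 1 := by rw [hq, dslope_same, hf1]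
  have hqz : ∀ z : ℂ, z * q z = f z := by
    intro z
    have := sub_smul_dslope f 0 z
    simpa [hf00] using this
  have hqne : ∀ z ∈ ball (0:ℂ) 1, q z ≠ 0 := by
    intro z hz h
    by_cases hz0 : z = 0
    · rw [hz0, hq0] at h; exact one_ne_zero h
    · apply hf0 z hz hz0
      rw [← hqz z, h, mul_zero]
  have hqat : ∀ z ∈ ball (0:ℂ) 1, HasDerivAt q (deriv q z) z := fun z hz =>
    (hqd.differentiableAt (isOpen_ball.mem_nhds hz)).hasDerivAt
  obtain ⟨p, hp0, hpd⟩ := primitive_ball (fun z => deriv q z / q z)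
    ((hqd.deriv isOpen_ball).div hqd hqne)
  have hpdiff : DifferentiableOn ℂ p (ball (0:ℂ) 1) := fun z hz =>
    (hpd z hz).differentiableAt.differentiableWithinAt
  have hexp : ∀ z ∈ ball (0:ℂ) 1, exp (p z) = q z := by
    intro z hz
    have hder : ∀ y ∈ ball (0:ℂ) 1, HasDerivAt (fun y => q y * exp (-p y)) 0 y := by
      intro y hy
      have h1 := (hqat y hy).mul ((hpd y hy).neg.cexp)
      have hne := hqne y hy
      refine h1.congr_deriv ?_
      field_simp
      ring
    have hconst := isOpen_ball.is_const_of_deriv_eq_zero (convex_ball (0:ℂ) 1).isPreconnected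
      (fun y hy => (hder y hy).differentiableAt.differentiableWithinAt)
      (fun y hy => (hder y hy).deriv) hz h0b
    simp only [hp0, hq0, neg_zero, Complex.exp_zero, mul_one, Complex.exp_neg] at hconst
    rw [mul_inv_eq_one₀ (Complex.exp_ne_zero _)] at hconst
    exact hconst.symm
  have hpω : ∀ z ∈ ball (0:ℂ) 1, z * deriv p z = Ψ (ω z) := by
    intro z hz
    rw [(hpd z hz).deriv, ← hωe z hz]
    by_cases hz0 : z = 0
    · simp [hz0]
    · simp only [hz0, if_false]
      have h1 : HasDerivAt (fun z => z * q z) (1 * q z + z * deriv q z) z :=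
        (hasDerivAt_id z).mul (hqat z hz)
      have h2 : (fun z => z * q z) = f := funext hqz
      rw [h2] at h1
      have hne := hqne z hz
      rw [h1.deriv, ← hqz z]
      field_simp
      ring
  have hωle : ∀ z ∈ ball (0:ℂ) 1, ‖ω z‖ ≤ ‖z‖ := fun z hz =>
    Complex.norm_le_norm_of_mapsTo_ball (R := 1) hωd
      (fun y hy => ball_subset_closedBall (hωm y hy)) hω0 (by simpa using hz)
  -- half-plane comparison
  have hcomp : ∀ c : ℂ, c ≠ 0 → ∀ M : ℝ, (∀ z ∈ ball (0:ℂ) 1, (c * G z).re ≤ M) →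
      ∀ z ∈ ball (0:ℂ) 1, (c * p z).re ≤ M := by
    intro c hc M hM z hz
    have hz1 : ‖z‖ < 1 := by simpa using hz
    obtain ⟨τ, hτ1, hτ2⟩ := exists_between hz1
    have hτ0 : 0 < τ := (norm_nonneg z).trans_lt hτ1
    have hτc : (τ:ℂ) ≠ 0 := by exact_mod_cast hτ0.ne'
    have hτn : ∀ y : ℂ, ‖(τ:ℂ) * y‖ = τ * ‖y‖ := fun y => by
      rw [norm_mul, Complex.norm_real, Real.norm_of_nonneg hτ0.le]
    have hτb : ∀ y ∈ ball (0:ℂ) 1, (τ:ℂ) * y ∈ ball (0:ℂ) 1 := by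
      intro y hy
      have : ‖y‖ < 1 := by simpa using hy
      rw [mem_ball_zero_iff, hτn]
      nlinarith [norm_nonneg y]
    have hpτ : ∀ y ∈ ball (0:ℂ) 1, HasDerivAt (fun y => c * p (τ * y))
        (c * (deriv p (τ * y) * τ)) y := by
      intro y hy
      have h1 : HasDerivAt (fun y : ℂ => (τ:ℂ) * y) τ y := by
        simpa using (hasDerivAt_id y).const_mul (τ:ℂ)
      exact (HasDerivAt.comp (h₂ := p) y
        (hpdiff.differentiableAt (isOpen_ball.mem_nhds (hτb y hy))).hasDerivAt h1).const_mul c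
    have := half_plane_s10 (fun y => c * Ψ y) (fun y => c * G y) (fun y => c * p (τ * y))
      (fun y => ω (τ * y)) M (continuousOn_const.mul hΨd.continuousOn)
      (fun v hv w hw l hl0 hl1 h => star_norm_le Ψ hΨd hΨ0 hΨinj hΨconv v w hv hw l hl0 hl1
        (mul_left_cancel₀ hc (by rw [h]; ring)))
      (hGdiff.const_mul c) (by simp [hG0])
      (fun y hy => by
        rw [((hGd y hy).const_mul c).deriv, ← hGΨ y hy, (hGd y hy).deriv]; ring)
      (fun y hy => (hpτ y hy).differentiableAt.differentiableWithinAt) (by simp [hp0])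
      (fun y hy => by
        rw [(hpτ y hy).deriv, ← hpω _ (hτb y hy)]; ring)
      (fun y hy hy0 => by
        have h1 := hωle _ (hτb y hy)
        rw [hτn] at h1
        have : 0 < ‖y‖ := norm_pos_iff.2 hy0
        nlinarith)
      hM (z / τ) (by
        rw [mem_ball_zero_iff, norm_div, Complex.norm_real, Real.norm_of_nonneg hτ0.le]
        exact (div_lt_one hτ0).2 hτ1)
    simpa [mul_div_cancel₀ z hτc] using this
  have main : ∀ z ∈ ball (0 : ℂ) 1, z ≠ 0 → δ ≤ (f z / z).re := by
    intro z hz hz0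
    have hfz : f z / z = exp (p z) := by
      rw [hexp z hz, ← hqz z]; field_simp
    rw [hfz]
    refine region_of_tangents _ δ hδ fun v₁ hv₁ => ?_
    have hc1 : 0 < Real.cos v₁ := Real.cos_pos_of_mem_Ioo (abs_lt.1 hv₁)
    set a := Real.tan v₁ with ha
    have hre : ∀ ξ : ℂ, ((-(1 + (a:ℂ) * I)) * ξ).re = -(ξ.re - a * ξ.im) := by
      intro ξ
      simp
      try ring
    have := hcomp (-(1 + (a:ℂ) * I)) (by
        intro h
        have := congrArg Complex.re h
        simp at this) (a * v₁ - Real.log (δ / Real.cos v₁)) (by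
        intro y hy
        rw [hre]
        have h1 := hGδ y hy
        have h2 := cos_tangent (G y).im v₁ (hGim y hy) hv₁
        rw [Complex.exp_re] at h1
        have h3 : δ / Real.cos v₁ ≤ Real.exp ((G y).re - a * ((G y).im - v₁)) := by
          rw [Real.exp_sub, div_le_div_iff₀ hc1 (Real.exp_pos _)]
          have he := Real.exp_pos (a * ((G y).im - v₁))
          have he2 := Real.exp_pos (G y).re
          calc δ * Real.exp (a * ((G y).im - v₁))
              ≤ (Real.exp (G y).re * Real.cos (G y).im) * Real.exp (a * ((G y).im - v₁)) := by
                gcongr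
            _ = Real.exp (G y).re * (Real.cos (G y).im * Real.exp (a * ((G y).im - v₁))) := by ring
            _ ≤ Real.exp (G y).re * Real.cos v₁ := by gcongr
        have h4 := (Real.log_le_iff_le_exp (by positivity)).2 h3
        linarith) z hz
    rw [hre] at this
    have h5 : Real.log (δ / Real.cos v₁) ≤ (p z).re - a * ((p z).im - v₁) := by linarith
    have h6 := (Real.log_le_iff_le_exp (by positivity)).1 h5
    rw [div_le_iff₀ hc1] at h6
    linarith
  exact ⟨main, fun z hz hz0 => hδ.trans_le (main z hz hz0)⟩
end
end
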